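/- arXiv:1801.04889 — 4 statements merged into one kernel-verified Lean document; each statement's English description precedes it below -/
import Mathlib

section
/- Let A and B be finitely generated, residually finite, amenable groups, let G = A ∗ B be their free product, and let ℓ be a proper length function on G. Then there exists a sequence (N_n)_{n∈ℕ} of finite-index normal subgroups of G with ⋂_n N_n = {1} such that the sequence of quotient groups (G/N_n)_{n∈ℕ}, each equipped with the metric coming from the quotient length induced by ℓ, coarsely embeds uniformly into Hilbert space. -/
/-- A length function on a group. -/
structure IsLengthFunction {G : Type*} [Group G] (ℓ : G → ℝ) : Prop where
  nonneg : ∀ g, 0 ≤ ℓ g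
  eq_zero_iff : ∀ g, ℓ g = 0 ↔ g = 1
  inv_eq : ∀ g, ℓ g⁻¹ = ℓ g
  subadd : ∀ g h, ℓ (g * h) ≤ ℓ g + ℓ h

/-- A proper length function: balls are finite. -/
def IsProperLength {G : Type*} [Group G] (ℓ : G → ℝ) : Prop :=
  IsLengthFunction ℓ ∧ ∀ R : ℝ, {g : G | ℓ g ≤ R}.Finite

/-- The quotient length on the coset space `G ⧸ N`:
`ℓ̄(gN) = inf {ℓ(g') : g'N = gN} = inf {ℓ(gh) : h ∈ N}`. -/
noncomputable def quotLength {G : Type*} [Group G] (ℓ : G → ℝ) (N : Subgroup G) :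
    G ⧸ N → ℝ :=
  fun x => sInf {r : ℝ | ∃ g : G, QuotientGroup.mk g = x ∧ ℓ g = r}

/-- The quotient metric on the coset space `G ⧸ N` induced by a length function `ℓ`:
`d̄(xN, yN) = inf {ℓ(g⁻¹h) : gN = xN, hN = yN}`; for normal `N` this is the metric of the
quotient length. -/
noncomputable def quotDist {G : Type*} [Group G] (ℓ : G → ℝ) (N : Subgroup G) :
    G ⧸ N → G ⧸ N → ℝ :=
  fun x y => sInf {r : ℝ | ∃ g h : G,
    QuotientGroup.mk g = x ∧ QuotientGroup.mk h = y ∧ ℓ (g⁻¹ * h) = r}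

/-- A family of spaces (with given distance functions) coarsely embeds uniformly into
Hilbert space: there are real Hilbert spaces `H j`, maps `F j`, and common nondecreasing
control functions `ρ₋, ρ₊` with `ρ₋ → ∞`. -/
def UnifCoarseEmbedHilbert {J : Type*} (X : J → Type*) (d : ∀ j, X j → X j → ℝ) : Prop :=
  ∃ (H : J → Type) (iN : ∀ j, NormedAddCommGroup (H j))
    (_ : ∀ j, @InnerProductSpace ℝ (H j) inferInstance (iN j).toSeminormedAddCommGroup)
    (_ : ∀ j, @CompleteSpace (H j) (iN j).toMetricSpace.toPseudoMetricSpace.toUniformSpace)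
    (F : ∀ j, X j → H j) (ρm ρp : ℝ → ℝ),
    Monotone ρm ∧ Monotone ρp ∧
    Filter.Tendsto ρm Filter.atTop Filter.atTop ∧
    ∀ (j : J) (x y : X j),
      ρm (d j x y) ≤ @dist (H j) (iN j).toMetricSpace.toPseudoMetricSpace.toDist (F j x) (F j y) ∧
      @dist (H j) (iN j).toMetricSpace.toPseudoMetricSpace.toDist (F j x) (F j y) ≤ ρp (d j x y)

/-- Residual finiteness: every nontrivial element survives in some finite quotient
(equivalently, has nontrivial image under some homomorphism to a finite group). -/
def ResiduallyFinite (G : Type*) [Group G] : Prop :=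
  ∀ g : G, g ≠ 1 → ∃ N : Subgroup G, N.Normal ∧ N.FiniteIndex ∧ g ∉ N

/-- Amenability via Reiter's ℓ²-condition: almost-invariant unit vectors in `ℓ²(G)`. -/
def ReiterAmenable (G : Type*) [Group G] : Prop :=
  ∀ (F : Finset G) (ε : ℝ), 0 < ε →
    ∃ ξ : G → ℝ, Summable (fun x => ξ x ^ 2) ∧ (∑' x, ξ x ^ 2) = 1 ∧
      ∀ g ∈ F, (∑' x, (ξ (g⁻¹ * x) - ξ x) ^ 2) ≤ ε ^ 2

/-- The Schreier metric on the coset space `G ⧸ H` with respect to a (symmetric) set `S`: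
the least `m` such that `y = s_m ⋯ s_1 • x` with all `s_i ∈ S`. -/
noncomputable def schreierDist {G : Type*} [Group G] (S : Set G) (H : Subgroup G)
    (x y : G ⧸ H) : ℝ :=
  sInf {r : ℝ | ∃ m : ℕ, r = m ∧ ∃ w : Fin m → G, (∀ i, w i ∈ S) ∧
    (List.ofFn w).prod • x = y}

/-- The word length with respect to a generating set `S` (closed under inverses). -/
noncomputable def wordLength {G : Type*} [Group G] (S : Set G) (g : G) : ℝ :=
  sInf {r : ℝ | ∃ m : ℕ, r = m ∧ ∃ w : Fin m → G, (∀ i, w i ∈ S) ∧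
    (List.ofFn w).prod = g}

/-- The Cheeger constant of a finite `G`-set `V` with respect to `S ⊆ G`:
`min {|∂_S A| / |A| : A ⊆ V nonempty, 2|A| ≤ |V|}`, where
`∂_S A = {(v, s) ∈ A × S : s • v ∉ A}`. -/
noncomputable def cheegerConst {G : Type*} [Group G] (S : Finset G)
    (V : Type*) [MulAction G V] : ℝ :=
  sInf {r : ℝ | ∃ A : Set V, A.Nonempty ∧ 2 * A.ncard ≤ Nat.card V ∧
    r = (Set.ncard {p : V × G | p.1 ∈ A ∧ p.2 ∈ (S : Set G) ∧ p.2 • p.1 ∉ A} : ℝ) / A.ncard}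

/-- Equi-exactness (uniform exactness) of a family of spaces: uniformly bounded,
uniformly Lipschitz partitions of unity. -/
def EquiExact {J : Type*} (X : J → Type*) (d : ∀ j, X j → X j → ℝ) : Prop :=
  ∀ R > (0:ℝ), ∀ ε > (0:ℝ), ∃ C > (0:ℝ), ∀ j, ∃ (I : Type) (φ : I → X j → ℝ),
    (∀ i x, 0 ≤ φ i x ∧ φ i x ≤ 1) ∧
    (∀ x, HasSum (fun i => φ i x) 1) ∧
    (∀ x y, d j x y ≤ R → ∃ s ≤ ε, HasSum (fun i => |φ i x - φ i y|) s) ∧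
    (∀ i x y, φ i x ≠ 0 → φ i y ≠ 0 → d j x y ≤ C)

namespace FP

open scoped Classical in
/-- indicator of nonzero elements of `ZMod 2` -/
noncomputable def chi (z : ZMod 2) : ℝ := if z = 0 then 0 else 1

lemma chi_nonneg (z : ZMod 2) : 0 ≤ chi z := by unfold chi; split_ifs <;> norm_num

lemma chi_le_one (z : ZMod 2) : chi z ≤ 1 := by unfold chi; split_ifs <;> norm_num

lemma chi_zero : chi 0 = 0 := by simp [chi]

lemma chi_of_ne {z : ZMod 2} (h : z ≠ 0) : chi z = 1 := by simp [chi, h]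

lemma chi_add (a b : ZMod 2) : chi (a + b) ≤ chi a + chi b := by
  have : ∀ a b : ZMod 2, a ≠ 0 → b ≠ 0 → a + b = 0 := by decide
  by_cases ha : a = 0
  · simp [ha, chi_zero]
  · by_cases hb : b = 0
    · simp [hb, chi_zero]
    · rw [this a b ha hb, chi_of_ne ha, chi_of_ne hb, chi_zero]; norm_num

lemma chi_neg (a : ZMod 2) : chi (-a) = chi a := by
  unfold chi; simp

lemma chi_sub_sq (a b : ZMod 2) : (chi a - chi b) ^ 2 = chi (a - b) := by
  have h2 : ∀ a b : ZMod 2, a ≠ 0 → b ≠ 0 → a - b = 0 := by decide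
  by_cases ha : a = 0
  · by_cases hb : b = 0
    · simp [ha, hb, chi_zero]
    · simp [ha, chi_zero, chi_of_ne hb]
  · by_cases hb : b = 0
    · simp [hb, chi_zero, chi_of_ne ha]
    · simp [h2 a b ha hb, chi_zero, chi_of_ne ha, chi_of_ne hb]

/-- alternating products of letters from `H true`, `H false`, not in `N`, lying in `K` -/
inductive Alt {G : Type*} [Group G] (H : Bool → Subgroup G) (N : Subgroup G) (K : Set G) :
    Bool → ℕ → G → Prop
  | one (t : Bool) (u : G) : u ∈ H t → u ∉ N → u ∈ K → Alt H N K t 1 u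
  | snoc (t : Bool) (m : ℕ) (w u : G) : Alt H N K t m w → u ∈ H (!t) → u ∉ N → u ∈ K →
      Alt H N K (!t) (m + 1) (w * u)

/-- no short relations -/
def Girth {G : Type*} [Group G] (H : Bool → Subgroup G) (N : Subgroup G) (m : ℕ) : Prop :=
  ∀ t j w, Alt H N Set.univ t j w → j ≤ m → w ∉ N

open scoped Classical in
/-- the mod 2 flow cocycle -/
structure Flow {G : Type*} [Group G] (H : Bool → Subgroup G) (N : Subgroup G) [N.Normal]
    (f : G → Bool → G ⧸ N → ZMod 2) : Prop where
  mul : ∀ g h t x, f (g * h) t x = f g t x + f h t ((g : G ⧸ N)⁻¹ * x)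
  same : ∀ t u, u ∈ H t → ∀ x, f u t x =
    (if x = 1 then 1 else 0) + (if x = (u : G ⧸ N) then 1 else 0)
  diff : ∀ t u, u ∈ H t → ∀ x, f u (!t) x = 0

/-- induction principle saying that the letters generate -/
def Gen {G : Type*} [Group G] (H : Bool → Subgroup G) : Prop :=
  ∀ p : G → Prop, (∀ t u, u ∈ H t → p u) → (∀ g h, p g → p h → p (g * h)) → ∀ g, p g

section abs

variable {G : Type*} [Group G] {H : Bool → Subgroup G}

lemma Alt.mono {N : Subgroup G} {K K' : Set G} (hK : K ⊆ K') {t : Bool} {m : ℕ} {w : G}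
    (h : Alt H N K t m w) : Alt H N K' t m w := by
  induction h with
  | one t u h1 h2 h3 => exact .one t u h1 h2 (hK h3)
  | snoc t m w u _ h1 h2 h3 ih => exact .snoc t m w u ih h1 h2 (hK h3)

lemma Alt.mono' {N N' : Subgroup G} {K : Set G} (hN : ∀ t u, u ∈ H t → u ∉ N → u ∉ N')
    {t : Bool} {m : ℕ} {w : G}
    (h : Alt H N K t m w) : Alt H N' K t m w := by
  induction h with
  | one t u h1 h2 h3 => exact .one t u h1 (hN _ _ h1 h2) h3
  | snoc t m w u _ h1 h2 h3 ih => exact .snoc t m w u ih h1 (hN _ _ h1 h2) h3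

lemma Alt.pos {N : Subgroup G} {K : Set G} {t : Bool} {m : ℕ} {w : G}
    (h : Alt H N K t m w) : 1 ≤ m := by
  cases h <;> omega

lemma Alt.length_bound {N : Subgroup G} {K : Set G} {ℓ : G → ℝ} (hℓ : IsLengthFunction ℓ)
    {c : ℝ} (hc : ∀ u ∈ K, ℓ u ≤ c) {t : Bool} {m : ℕ} {w : G}
    (h : Alt H N K t m w) : ℓ w ≤ m * c := by
  induction h with
  | one t u h1 h2 h3 => simpa using hc u h3
  | snoc t m w u _ h1 h2 h3 ih =>
    have := hℓ.subadd w u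
    have := hc u h3
    push_cast
    linarith

open scoped Classical in
lemma walk {N : Subgroup G} [N.Normal] {K : Set G} {M : ℕ} (hg : Girth H N M)
    (C : Bool → G ⧸ N → Prop) (D : Finset (G ⧸ N)) (hD : ∀ t x, C t x → x ∈ D)
    (hM : D.card ≤ M)
    (hpart : ∀ t x, C t x → ∃ u ∈ H t, u ∉ N ∧ u ∈ K ∧ C t (x * (u : G ⧸ N)))
    (p q : G ⧸ N) (t0 : Bool) (hp : C t0 p)
    (hc : ∀ t x, C t x → x ≠ p → x ≠ q → C (!t) x) :
    ∃ t j w, Alt H N K t j w ∧ j ≤ M ∧ p * (w : G ⧸ N) = q := by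
  by_contra hn
  push Not at hn
  have hne : ∀ (w : G) (x : G ⧸ N), w ∉ N → x ≠ x * (w : G ⧸ N) := by
    intro w x hw h
    have : (w : G ⧸ N) = 1 := by simpa using h.symm
    exact hw ((QuotientGroup.eq_one_iff w).1 this)
  have hMpos : 1 ≤ M := by
    have : 0 < D.card := Finset.card_pos.2 ⟨p, hD _ _ hp⟩
    omega
  have key : ∀ m, m + 1 ≤ M → ∃ t x w, ∃ V : Finset (G ⧸ N), Alt H N K t (m + 1) w ∧
      p * (w : G ⧸ N) = x ∧ C t x ∧ V ⊆ D ∧ V.card = m + 2 ∧ p ∈ V ∧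
      ∀ v ∈ V, v = x ∨ ∃ j w', j ≤ m + 1 ∧ Alt H N Set.univ t j w' ∧ v * (w' : G ⧸ N) = x := by
    intro m
    induction m with
    | zero =>
      intro _
      obtain ⟨u, hu, huN, huK, huC⟩ := hpart _ _ hp
      refine ⟨t0, _, u, {p, p * (u : G ⧸ N)}, .one _ _ hu huN huK, rfl, huC, ?_, ?_, by simp, ?_⟩
      · intro v hv
        simp only [Finset.mem_insert, Finset.mem_singleton] at hv
        rcases hv with rfl | rfl
        · exact hD _ _ hp
        · exact hD _ _ huC
      · rw [Finset.card_pair (hne u p huN)]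
      · intro v hv
        simp only [Finset.mem_insert, Finset.mem_singleton] at hv
        rcases hv with rfl | rfl
        · right; exact ⟨1, u, le_rfl, .one _ _ hu huN trivial, rfl⟩
        · left; rfl
    | succ m ih =>
      intro hm
      obtain ⟨t, x, w, V, hA, hx, hC, hV, hcard, hpV, hall⟩ := ih (by omega)
      have hwN : w ∉ N := hg t _ w (hA.mono (Set.subset_univ _)) (by omega)
      have hxp : x ≠ p := by rw [← hx]; exact (hne w p hwN).symm
      have hxq : x ≠ q := by rw [← hx]; exact hn t _ w hA (by omega)
      obtain ⟨u, hu, huN, huK, huC⟩ := hpart _ _ (hc t x hC hxp hxq)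
      have hall' : ∀ v ∈ V, ∃ j w', j ≤ m + 1 + 1 ∧ Alt H N Set.univ (!t) j w' ∧
          v * (w' : G ⧸ N) = x * (u : G ⧸ N) := by
        intro v hv
        rcases hall v hv with rfl | ⟨j, w', hj, hA', hw'⟩
        · exact ⟨1, u, by omega, .one _ _ hu huN trivial, rfl⟩
        · refine ⟨j + 1, w' * u, by omega, .snoc _ _ _ _ hA' hu huN trivial, ?_⟩
          rw [QuotientGroup.mk_mul, ← mul_assoc, hw']
      have hnot : x * (u : G ⧸ N) ∉ V := by
        intro hv
        obtain ⟨j, w', hj, hA', hw'⟩ := hall' _ hv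
        exact hne w' _ (hg _ _ _ hA' (by omega)) hw'.symm
      refine ⟨!t, _, w * u, insert (x * (u : G ⧸ N)) V, .snoc _ _ _ _ hA hu huN huK, ?_, huC,
        ?_, ?_, by simp [hpV], ?_⟩
      · rw [QuotientGroup.mk_mul, ← mul_assoc, hx]
      · exact Finset.insert_subset (hD _ _ huC) hV
      · rw [Finset.card_insert_of_notMem hnot, hcard]
      · intro v hv
        rcases Finset.mem_insert.1 hv with rfl | hv
        · left; rfl
        · right; exact hall' v hv
  obtain ⟨t, x, w, V, -, -, -, hV, hcard, -⟩ := key (M - 1) (by omega)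
  have := Finset.card_le_card hV
  omega

namespace Flow

variable {N : Subgroup G} [N.Normal] {f : G → Bool → G ⧸ N → ZMod 2}

lemma map_one (hf : Flow H N f) (t x) : f 1 t x = 0 := by
  have := hf.mul 1 1 t x
  simpa using this

lemma map_inv (hf : Flow H N f) (g t x) : f g⁻¹ t x = - f g t ((g : G ⧸ N) * x) := by
  have := hf.mul g⁻¹ g t x
  rw [inv_mul_cancel, hf.map_one] at this
  have h2 := eq_neg_of_add_eq_zero_left this.symm
  simpa using h2

open scoped Classical in
lemma bdry (hf : Flow H N f) (hgen : Gen H) (g : G) : ∀ x, f g true x + f g false x =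
    (if x = 1 then 1 else 0) + (if x = (g : G ⧸ N) then 1 else 0) := by
  refine hgen (fun g => ∀ x, f g true x + f g false x =
    (if x = 1 then 1 else 0) + (if x = (g : G ⧸ N) then 1 else 0)) ?_ ?_ g
  · intro t u hu x
    have h1 := hf.same t u hu x
    have h2 := hf.diff t u hu x
    cases t
    · simp only [Bool.not_false] at h2
      rw [h2, h1, zero_add]
    · simp only [Bool.not_true] at h2
      rw [h2, h1, add_zero]
  · intro g h hg hh x
    rw [hf.mul, hf.mul]
    have e1 := hg x
    have e2 := hh ((g : G ⧸ N)⁻¹ * x)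
    have e3 : ((g : G ⧸ N)⁻¹ * x = 1) ↔ x = (g : G ⧸ N) := by
      rw [inv_mul_eq_one]; exact eq_comm
    have e4 : ((g : G ⧸ N)⁻¹ * x = (h : G ⧸ N)) ↔ x = ((g * h : G) : G ⧸ N) := by
      rw [inv_mul_eq_iff_eq_mul, QuotientGroup.mk_mul]
    rw [if_congr e3 rfl rfl, if_congr e4 rfl rfl] at e2
    have e5 : f g true x + f h true ((g : G ⧸ N)⁻¹ * x) +
      (f g false x + f h false ((g : G ⧸ N)⁻¹ * x)) =
      (f g true x + f g false x) + (f h true ((g : G ⧸ N)⁻¹ * x) +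
        f h false ((g : G ⧸ N)⁻¹ * x)) := by ring
    rw [e5, e1, e2]
    have : ∀ a b c : ZMod 2, a + b + (b + c) = a + c := by decide
    exact this _ _ _

open scoped Classical in
lemma even [Fintype (G ⧸ N)] (hf : Flow H N f) (hgen : Gen H) (g : G) : ∀ t (x0 : G ⧸ N),
    ∑ x, (if x0⁻¹ * x ∈ (H t).map (QuotientGroup.mk' N) then f g t x else 0) = 0 := by
  refine hgen (fun g => ∀ t (x0 : G ⧸ N),
    ∑ x, (if x0⁻¹ * x ∈ (H t).map (QuotientGroup.mk' N) then f g t x else 0) = 0) ?_ ?_ g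
  · intro s u hu t x0
    by_cases hts : t = s
    · subst hts
      simp only [hf.same t u hu]
      have : ∀ x : G ⧸ N, (if x0⁻¹ * x ∈ (H t).map (QuotientGroup.mk' N) then
          ((if x = 1 then 1 else 0) + (if x = (u : G ⧸ N) then 1 else 0) : ZMod 2) else 0) =
          (if x = 1 then (if x0⁻¹ ∈ (H t).map (QuotientGroup.mk' N) then 1 else 0) else 0) +
          (if x = (u : G ⧸ N) then
            (if x0⁻¹ ∈ (H t).map (QuotientGroup.mk' N) then 1 else 0) else 0) := by
        intro x
        have hmem : (x0⁻¹ * (u : G ⧸ N) ∈ (H t).map (QuotientGroup.mk' N)) ↔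
            x0⁻¹ ∈ (H t).map (QuotientGroup.mk' N) := by
          apply Subgroup.mul_mem_cancel_right
          exact ⟨u, hu, rfl⟩
        by_cases h1 : x = 1
        · subst h1
          by_cases h2 : (1 : G ⧸ N) = u
          · simp [← h2]
            split_ifs <;> simp
          · simp [h2]
        · by_cases h2 : x = (u : G ⧸ N)
          · subst h2
            simp [h1, hmem]
          · simp [h1, h2]
      rw [Finset.sum_congr rfl (fun x _ => this x), Finset.sum_add_distrib]
      simp only [Finset.sum_ite_eq', Finset.mem_univ, if_true]
      have : ∀ a : ZMod 2, a + a = 0 := by decide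
      exact this _
    · have : t = !s := by cases t <;> cases s <;> simp_all
      subst this
      simp [hf.diff s u hu]
  · intro g h hg hh t x0
    simp only [hf.mul]
    have : ∀ x : G ⧸ N, (if x0⁻¹ * x ∈ (H t).map (QuotientGroup.mk' N) then
        f g t x + f h t ((g : G ⧸ N)⁻¹ * x) else 0) =
        (if x0⁻¹ * x ∈ (H t).map (QuotientGroup.mk' N) then f g t x else 0) +
        (if ((g : G ⧸ N)⁻¹ * x0)⁻¹ * ((g : G ⧸ N)⁻¹ * x) ∈ (H t).map (QuotientGroup.mk' N) then
          f h t ((g : G ⧸ N)⁻¹ * x) else 0) := by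
      intro x
      have : ((g : G ⧸ N)⁻¹ * x0)⁻¹ * ((g : G ⧸ N)⁻¹ * x) = x0⁻¹ * x := by group
      rw [this]
      split_ifs <;> simp
    rw [Finset.sum_congr rfl (fun x _ => this x), Finset.sum_add_distrib, hg, zero_add]
    refine Eq.trans ?_ (hh t ((g : G ⧸ N)⁻¹ * x0))
    exact Equiv.sum_comp (Equiv.mulLeft (g : G ⧸ N)⁻¹)
      (fun y => if ((g : G ⧸ N)⁻¹ * x0)⁻¹ * y ∈ (H t).map (QuotientGroup.mk' N) then
          f h t y else 0)

lemma partner [Finite (G ⧸ N)] (hf : Flow H N f) (hgen : Gen H) (g : G) (t : Bool) (x0 : G ⧸ N)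
    (h0 : f g t x0 ≠ 0) :
    ∃ u ∈ H t, u ∉ N ∧ f g t (x0 * (u : G ⧸ N)) ≠ 0 := by
  classical
  have := Fintype.ofFinite (G ⧸ N)
  by_contra hn
  push Not at hn
  have h := hf.even hgen g t x0
  rw [Finset.sum_eq_single x0] at h
  · simp [h0] at h
  · intro y _ hy
    split_ifs with hm
    · obtain ⟨u, hu, hu2⟩ := hm
      have hy2 : y = x0 * (u : G ⧸ N) := by
        have : (u : G ⧸ N) = x0⁻¹ * y := hu2
        rw [this]; group
      rw [hy2]
      apply hn u hu
      intro huN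
      apply hy
      rw [hy2, (QuotientGroup.eq_one_iff u).2 huN, mul_one]
    · rfl
  · simp

end Flow

end abs

end FP

namespace FP

section abs2

variable {G : Type*} [Group G] {H : Bool → Subgroup G}

/-- size of the support of a flow -/
noncomputable def cnt {P : Type*} [Fintype P] (v : Bool → P → ZMod 2) : ℝ :=
  ∑ t, ∑ x, chi (v t x)

/-- parity of a flow on a translate of `U⁻¹` -/
noncomputable def par {N : Subgroup G} [N.Normal] (U : Finset G) (t : Bool)
    (v : Bool → G ⧸ N → ZMod 2) (x : G ⧸ N) : ZMod 2 :=
  ∑ u ∈ U, v t (x * (u : G ⧸ N)⁻¹)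

/-- number of odd translates -/
noncomputable def wallc {N : Subgroup G} [N.Normal] [Fintype (G ⧸ N)] (U : Finset G) (t : Bool)
    (v : Bool → G ⧸ N → ZMod 2) : ℝ :=
  ∑ x, chi (par U t v x)

/-- the total kernel -/
noncomputable def QQ {N : Subgroup G} [N.Normal] [Fintype (G ⧸ N)] (U : Bool → ℕ → Finset G)
    (n : ℕ) (v : Bool → G ⧸ N → ZMod 2) : ℝ :=
  cnt v + ∑ t, ∑ k : Fin n, wallc (U t k) t v / (U t k).card

lemma cnt_nonneg {P : Type*} [Fintype P] (v : Bool → P → ZMod 2) : 0 ≤ cnt v :=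
  Finset.sum_nonneg fun _ _ => Finset.sum_nonneg fun _ _ => chi_nonneg _

lemma cnt_add {P : Type*} [Fintype P] (v w : Bool → P → ZMod 2) :
    cnt (v + w) ≤ cnt v + cnt w := by
  unfold cnt
  rw [← Finset.sum_add_distrib]
  refine Finset.sum_le_sum fun t _ => ?_
  rw [← Finset.sum_add_distrib]
  exact Finset.sum_le_sum fun x _ => chi_add _ _

/-- shift of a flow -/
def shift {P : Type*} [Group P] (p : P) (v : Bool → P → ZMod 2) : Bool → P → ZMod 2 :=
  fun t x => v t (p⁻¹ * x)

lemma cnt_shift {P : Type*} [Group P] [Fintype P] (p : P) (v : Bool → P → ZMod 2) :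
    cnt (shift p v) = cnt v := by
  unfold cnt shift
  refine Finset.sum_congr rfl fun t _ => ?_
  exact Equiv.sum_comp (Equiv.mulLeft p⁻¹) (fun x => chi (v t x))

variable {N : Subgroup G} [N.Normal]

lemma par_add (U : Finset G) (t : Bool) (v w : Bool → G ⧸ N → ZMod 2) (x : G ⧸ N) :
    par U t (v + w) x = par U t v x + par U t w x := by
  simp [par, Finset.sum_add_distrib]

lemma par_sub (U : Finset G) (t : Bool) (v w : Bool → G ⧸ N → ZMod 2) (x : G ⧸ N) :
    par U t (v - w) x = par U t v x - par U t w x := by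
  simp [par, Finset.sum_sub_distrib]

lemma wallc_nonneg [Fintype (G ⧸ N)] (U : Finset G) (t : Bool)
    (v : Bool → G ⧸ N → ZMod 2) : 0 ≤ wallc U t v :=
  Finset.sum_nonneg fun _ _ => chi_nonneg _

lemma wallc_add [Fintype (G ⧸ N)] (U : Finset G) (t : Bool)
    (v w : Bool → G ⧸ N → ZMod 2) : wallc U t (v + w) ≤ wallc U t v + wallc U t w := by
  unfold wallc
  rw [← Finset.sum_add_distrib]
  refine Finset.sum_le_sum fun x _ => ?_
  rw [par_add]
  exact chi_add _ _

lemma wallc_shift [Fintype (G ⧸ N)] (U : Finset G) (t : Bool) (p : G ⧸ N)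
    (v : Bool → G ⧸ N → ZMod 2) : wallc U t (shift p v) = wallc U t v := by
  unfold wallc
  rw [← Equiv.sum_comp (Equiv.mulLeft p⁻¹) (fun x => chi (par U t v x))]
  refine Finset.sum_congr rfl fun x _ => ?_
  simp [par, shift, mul_assoc]

lemma QQ_add [Fintype (G ⧸ N)] (U : Bool → ℕ → Finset G) (n : ℕ)
    (v w : Bool → G ⧸ N → ZMod 2) : QQ U n (v + w) ≤ QQ U n v + QQ U n w := by
  unfold QQ
  have h : ∑ t, ∑ k : Fin n, wallc (U t k) t (v + w) / (U t k).card ≤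
      ∑ t, ∑ k : Fin n, wallc (U t k) t v / (U t k).card +
      ∑ t, ∑ k : Fin n, wallc (U t k) t w / (U t k).card := by
    rw [← Finset.sum_add_distrib]
    refine Finset.sum_le_sum fun t _ => ?_
    rw [← Finset.sum_add_distrib]
    refine Finset.sum_le_sum fun x _ => ?_
    rw [← add_div]
    exact div_le_div_of_nonneg_right (wallc_add _ _ _ _) (by positivity)
  have := cnt_add v w
  linarith

lemma QQ_shift [Fintype (G ⧸ N)] (U : Bool → ℕ → Finset G) (n : ℕ) (p : G ⧸ N)
    (v : Bool → G ⧸ N → ZMod 2) : QQ U n (shift p v) = QQ U n v := by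
  unfold QQ
  simp only [cnt_shift, wallc_shift]

namespace Flow

variable {f : G → Bool → G ⧸ N → ZMod 2}

lemma mul' (hf : Flow H N f) (g h : G) : f (g * h) = f g + shift (g : G ⧸ N) (f h) := by
  funext t x
  exact hf.mul g h t x

lemma cnt_inv [Fintype (G ⧸ N)] (hf : Flow H N f) (g : G) : cnt (f g⁻¹) = cnt (f g) := by
  have : f g⁻¹ = fun t x => - shift (g : G ⧸ N)⁻¹ (f g) t x := by
    funext t x
    simp [hf.map_inv, shift]
  rw [← cnt_shift (g : G ⧸ N)⁻¹ (f g), this]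
  simp [cnt]

lemma cnt_letter [Fintype (G ⧸ N)] (hf : Flow H N f) {t : Bool} {u : G} (hu : u ∈ H t) :
    cnt (f u) ≤ 2 := by
  classical
  have h1 : ∑ x, chi (f u (!t) x) = 0 := by simp [hf.diff t u hu, chi_zero]
  have h2 : ∑ x, chi (f u t x) ≤ 2 := by
    calc ∑ x, chi (f u t x) ≤ ∑ x, ((if x = 1 then 1 else 0) +
          (if x = (u : G ⧸ N) then (1 : ℝ) else 0)) := by
          refine Finset.sum_le_sum fun x _ => ?_
          rw [hf.same t u hu]
          refine (chi_add _ _).trans ?_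
          gcongr
          · split_ifs
            · exact chi_le_one _
            · exact chi_zero.le
          · split_ifs
            · exact chi_le_one _
            · exact chi_zero.le
      _ = 2 := by
          rw [Finset.sum_add_distrib]
          simp
          norm_num
  unfold cnt
  rw [Fintype.sum_bool]
  cases t <;> simp at h1 <;> linarith

lemma cnt_alt [Fintype (G ⧸ N)] (hf : Flow H N f) {N' : Subgroup G} {K : Set G} {t : Bool}
    {m : ℕ} {w : G} (h : Alt H N' K t m w) : cnt (f w) ≤ 2 * m := by
  induction h with
  | one t u h1 h2 h3 => simpa using hf.cnt_letter h1
  | snoc t m w u _ h1 h2 h3 ih =>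
    rw [hf.mul']
    have := cnt_add (f w) (shift (w : G ⧸ N) (f u))
    rw [cnt_shift] at this
    have := hf.cnt_letter h1
    push_cast
    linarith

lemma wallc_letter_diff [Fintype (G ⧸ N)] (hf : Flow H N f) {t : Bool} {u : G} (hu : u ∈ H t)
    (U : Finset G) : wallc U (!t) (f u) = 0 := by
  simp [wallc, par, hf.diff t u hu, chi_zero]

open scoped Classical in
lemma wallc_letter_same [Fintype (G ⧸ N)] (hf : Flow H N f) {t : Bool} {a : G} (ha : a ∈ H t)
    (U : Finset G) : wallc U t (f a) ≤ (symmDiff (U.image (a * ·)) U).card := by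
  have hpar : ∀ x, par U t (f a) x ≠ 0 →
      x ∈ (symmDiff (U.image (a * ·)) U).image (QuotientGroup.mk : G → G ⧸ N) := by
    intro x hx
    by_contra hn
    apply hx
    have e : par U t (f a) x = ∑ u ∈ U, (if (u : G ⧸ N) = x then 1 else 0) +
        ∑ u ∈ U.image (a * ·), (if (u : G ⧸ N) = x then 1 else 0) := by
      rw [Finset.sum_image (by intro x _ y _ h; exact mul_left_cancel h), ← Finset.sum_add_distrib]
      unfold par
      refine Finset.sum_congr rfl fun u _ => ?_
      rw [hf.same t a ha]
      have e1 : x * (u : G ⧸ N)⁻¹ = 1 ↔ (u : G ⧸ N) = x := by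
        rw [mul_inv_eq_one]; exact eq_comm
      have e2 : x * (u : G ⧸ N)⁻¹ = a ↔ ((a * u : G) : G ⧸ N) = x := by
        rw [mul_inv_eq_iff_eq_mul, QuotientGroup.mk_mul]; exact eq_comm
      rw [if_congr e1 rfl rfl, if_congr e2 rfl rfl]
    have red : ∀ s s' : Finset G, (∀ u ∈ symmDiff s' s, (u : G ⧸ N) ≠ x) →
        ∑ u ∈ s, (if (u : G ⧸ N) = x then (1 : ZMod 2) else 0) =
        ∑ u ∈ s ∩ s', (if (u : G ⧸ N) = x then 1 else 0) := by
      intro s s' h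
      symm
      apply Finset.sum_subset Finset.inter_subset_left
      intro u hu hu'
      rw [if_neg]
      apply h
      rw [Finset.mem_symmDiff]
      right
      refine ⟨hu, fun h' => hu' (Finset.mem_inter.2 ⟨hu, h'⟩)⟩
    have hn' : ∀ u ∈ symmDiff (U.image (a * ·)) U, (u : G ⧸ N) ≠ x := by
      intro u hu h
      exact hn (Finset.mem_image.2 ⟨u, hu, h⟩)
    rw [e, red _ _ hn', red (U.image (a * ·)) U (by rw [symmDiff_comm]; exact hn'),
      Finset.inter_comm]
    have : ∀ a : ZMod 2, a + a = 0 := by decide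
    exact this _
  calc wallc U t (f a) ≤ ∑ x, (if x ∈ (symmDiff (U.image (a * ·)) U).image
        (QuotientGroup.mk : G → G ⧸ N) then (1 : ℝ) else 0) := by
        refine Finset.sum_le_sum fun x _ => ?_
        split_ifs with h
        · exact chi_le_one _
        · have : par U t (f a) x = 0 := by
            by_contra h'
            exact h (hpar x h')
          rw [this, chi_zero]
    _ = ((symmDiff (U.image (a * ·)) U).image (QuotientGroup.mk : G → G ⧸ N)).card := by
        rw [Finset.sum_boole, Finset.filter_mem_eq_inter, Finset.univ_inter]
    _ ≤ _ := by exact_mod_cast Finset.card_image_le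

lemma card_supp_le {P : Type*} [Fintype P] (v : Bool → P → ZMod 2)
    [DecidablePred fun x => ∃ t, v t x ≠ 0] :
    ((Finset.univ.filter fun x => ∃ t, v t x ≠ 0).card : ℝ) ≤ cnt v := by
  rw [Finset.card_filter]
  push_cast
  unfold cnt
  rw [Finset.sum_comm]
  refine Finset.sum_le_sum fun x _ => ?_
  split_ifs with h
  · obtain ⟨t, ht⟩ := h
    calc (1 : ℝ) = chi (v t x) := (chi_of_ne ht).symm
      _ ≤ ∑ t, chi (v t x) :=
        Finset.single_le_sum (f := fun t => chi (v t x)) (fun _ _ => chi_nonneg _)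
          (Finset.mem_univ t)
  · exact Finset.sum_nonneg fun _ _ => chi_nonneg _

/-- a flow with small support of an element of `N` vanishes -/
lemma closed_zero [Fintype (G ⧸ N)] (hf : Flow H N f) (hgen : Gen H) {M : ℕ}
    (hg : Girth H N M) {h : G} (hN : h ∈ N) (hM : cnt (f h) ≤ M) : f h = 0 := by
  classical
  by_contra hne
  obtain ⟨t0, ht0⟩ := Function.ne_iff.1 hne
  obtain ⟨p, hp⟩ := Function.ne_iff.1 ht0
  have hsum : ∀ t x, f h t x ≠ 0 → f h (!t) x ≠ 0 := by
    have hb := hf.bdry hgen h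
    rw [(QuotientGroup.eq_one_iff h).2 hN] at hb
    have h2 : ∀ a : ZMod 2, a + a = 0 := by decide
    intro t x hx hx'
    have := hb x
    rw [h2] at this
    cases t
    · rw [Bool.not_false] at hx'
      rw [hx', zero_add] at this
      exact hx this
    · rw [Bool.not_true] at hx'
      rw [hx', add_zero] at this
      exact hx this
  obtain ⟨t, j, w, hA, hj, hw⟩ := walk (K := Set.univ) hg (fun t x => f h t x ≠ 0)
    (Finset.univ.filter fun x => ∃ t, f h t x ≠ 0) (by
      intro t x hx
      simp only [Finset.mem_filter, Finset.mem_univ, true_and]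
      exact ⟨t, hx⟩) (by exact_mod_cast (card_supp_le (f h)).trans hM)
    (by
      intro t x hx
      obtain ⟨u, hu, huN, hu2⟩ := hf.partner hgen h t x hx
      exact ⟨u, hu, huN, trivial, hu2⟩) p p t0 hp (fun t x hx _ _ => hsum t x hx)
  apply hg t j w hA hj
  rw [← QuotientGroup.eq_one_iff]
  simpa using hw

open scoped Pointwise in
lemma lower [Fintype (G ⧸ N)] (hf : Flow H N f) (hgen : Gen H) {M : ℕ}
    (hg : Girth H N (3 * M)) (U : Bool → Finset G) (hU : ∀ t, ∀ u ∈ U t, u ∈ H t)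
    (hinj : ∀ t, Set.InjOn (QuotientGroup.mk : G → G ⧸ N) (U t))
    {K : Set G} (hK : ∀ t, ∀ u ∈ U t, ∀ u' ∈ U t, u * u'⁻¹ ∈ K)
    {h : G} (hM : cnt (f h) ≤ M) (hw : ∀ t, wallc (U t) t (f h) < (U t).card) :
    ∃ w, (w = 1 ∨ ∃ t j, j ≤ M ∧ Alt H N K t j w) ∧ w⁻¹ * h ∈ N ∧ f (w⁻¹ * h) = 0 := by
  classical
  suffices ∃ w, (w = 1 ∨ ∃ t j, j ≤ M ∧ Alt H N K t j w) ∧ (w : G ⧸ N) = h by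
    obtain ⟨w, hw1, hw2⟩ := this
    have hN : w⁻¹ * h ∈ N := QuotientGroup.eq.1 hw2
    refine ⟨w, hw1, hN, hf.closed_zero hgen hg hN ?_⟩
    rw [hf.mul']
    have h1 := cnt_add (f w⁻¹) (shift ((w⁻¹ : G) : G ⧸ N) (f h))
    rw [cnt_shift, hf.cnt_inv] at h1
    have h2 : cnt (f w) ≤ 2 * M := by
      rcases hw1 with rfl | ⟨t, j, hj, hA⟩
      · have : f 1 = 0 := by funext t x; exact hf.map_one t x
        rw [this]
        simp [cnt, chi_zero]
      · refine (hf.cnt_alt hA).trans ?_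
        have : (j : ℝ) ≤ M := by exact_mod_cast hj
        linarith
    push_cast
    linarith
  by_cases h1 : (h : G ⧸ N) = 1
  · exact ⟨1, Or.inl rfl, by rw [h1]; rfl⟩
  have hb := hf.bdry hgen h
  have hb1 : ∃ t0, f h t0 1 ≠ 0 := by
    have := hb 1
    rw [if_pos rfl, if_neg (Ne.symm h1)] at this
    by_contra hn
    push Not at hn
    rw [hn, hn] at this
    simp at this
  obtain ⟨t0, hp⟩ := hb1
  obtain ⟨t, j, w, hA, hj, hw⟩ := walk (K := K) (M := M)
    (fun t j w hA hj => hg t j w hA (by omega)) (fun t x => f h t x ≠ 0)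
    (Finset.univ.filter fun x => ∃ t, f h t x ≠ 0) (by
      intro t x hx
      simp only [Finset.mem_filter, Finset.mem_univ, true_and]
      exact ⟨t, hx⟩) (by exact_mod_cast (card_supp_le (f h)).trans hM)
    (by
      intro t x0 hx
      by_contra hn
      push Not at hn
      have hpar : ∀ u ∈ U t, par (U t) t (f h) (x0 * (u : G ⧸ N)) ≠ 0 := by
        intro u hu
        unfold par
        rw [Finset.sum_eq_single u]
        · simpa using hx
        · intro u' hu' hne
          have := hn (u * u'⁻¹) ((H t).mul_mem (hU t u hu) ((H t).inv_mem (hU t u' hu'))) ?_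
            (hK t u hu u' hu')
          · rw [QuotientGroup.mk_mul, QuotientGroup.mk_inv, ← mul_assoc] at this
            exact this
          · intro hN
            apply hne
            refine hinj t hu' hu ?_
            rw [← QuotientGroup.eq_one_iff, QuotientGroup.mk_mul, QuotientGroup.mk_inv,
              mul_inv_eq_one] at hN
            exact hN.symm
        · exact fun h' => absurd hu h'
      have : ((U t).card : ℝ) ≤ wallc (U t) t (f h) := by
        have hc : ((U t).image fun u : G => x0 * (u : G ⧸ N)).card = (U t).card := by
          apply Finset.card_image_of_injOn
          intro u hu u' hu' he
          exact hinj t hu hu' (mul_left_cancel he)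
        rw [← hc, ← nsmul_one, ← Finset.sum_const]
        unfold wallc
        calc ∑ x ∈ (U t).image fun u : G => x0 * (u : G ⧸ N), (1 : ℝ) =
            ∑ x ∈ (U t).image fun u : G => x0 * (u : G ⧸ N), chi (par (U t) t (f h) x) := by
              refine Finset.sum_congr rfl fun x hx => ?_
              obtain ⟨u, hu, rfl⟩ := Finset.mem_image.1 hx
              rw [chi_of_ne (hpar u hu)]
          _ ≤ _ := Finset.sum_le_sum_of_subset_of_nonneg (Finset.subset_univ _)
              fun _ _ _ => chi_nonneg _
      exact absurd this (not_le.2 (hw t))) 1 (h : G ⧸ N) t0 hp (by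
      intro t x hx hx1 hxq hx'
      have := hb x
      rw [if_neg hx1, if_neg hxq, add_zero] at this
      cases t
      · rw [Bool.not_false] at hx'
        rw [hx', zero_add] at this
        exact hx this
      · rw [Bool.not_true] at hx'
        rw [hx', add_zero] at this
        exact hx this)
  exact ⟨w, Or.inr ⟨t, j, hj, hA⟩, by simpa using hw⟩

/-- support of the flow along an alternating word -/
lemma alt_supp (hf : Flow H N f) {t : Bool} {m : ℕ} {w : G} (h : Alt H N Set.univ t m w) :
    (∀ s x, f w s x ≠ 0 → x = w ∨ ∃ j v, j ≤ m ∧ Alt H N Set.univ t j v ∧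
      x * (v : G ⧸ N) = w) ∧
    (∀ x, f w (!t) x ≠ 0 → ∃ j v, j ≤ m ∧ Alt H N Set.univ t j v ∧ x * (v : G ⧸ N) = w) := by
  classical
  have hletter : ∀ t u x s, u ∈ H t → f u s x ≠ 0 → s = t ∧ (x = 1 ∨ x = u) := by
    intro t u x s hu h
    have hs : s = t := by
      by_contra hne
      have : s = !t := by cases s <;> cases t <;> simp_all
      subst this
      exact h (hf.diff t u hu x)
    subst hs
    refine ⟨rfl, ?_⟩
    by_contra hn
    push Not at hn
    apply h
    rw [hf.same _ _ hu, if_neg hn.1, if_neg hn.2, add_zero]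
  induction h with
  | one t u h1 h2 h3 =>
    constructor
    · intro s x hx
      rcases (hletter t u x s h1 hx).2 with rfl | rfl
      · right; exact ⟨1, u, le_rfl, .one _ _ h1 h2 trivial, one_mul _⟩
      · left; rfl
    · intro x hx
      exact absurd (hf.diff t u h1 x) hx
  | snoc t m w u hA h1 h2 h3 ih =>
    have prev : ∀ s x, f w s x ≠ 0 → ∃ j v, j ≤ m + 1 ∧ Alt H N Set.univ (!t) j v ∧
        x * (v : G ⧸ N) = ((w * u : G) : G ⧸ N) := by
      intro s x hx
      rcases ih.1 s x hx with rfl | ⟨j, v, hj, hv, hx2⟩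
      · exact ⟨1, u, by omega, .one _ _ h1 h2 trivial, rfl⟩
      · refine ⟨j + 1, v * u, by omega, .snoc _ _ _ _ hv h1 h2 trivial, ?_⟩
        rw [QuotientGroup.mk_mul, ← mul_assoc, hx2, QuotientGroup.mk_mul]
    have h0 : ∀ s x, f (w * u) s x ≠ 0 → f w s x ≠ 0 ∨ f u s ((w : G ⧸ N)⁻¹ * x) ≠ 0 := by
      intro s x hx
      by_contra hn
      push Not at hn
      rw [hf.mul, hn.1, hn.2] at hx
      simp at hx
    constructor
    · intro s x hx
      rcases h0 s x hx with h | h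
      · right; exact prev s x h
      · rcases (hletter _ u _ s h1 h).2 with h | h
        · right
          refine ⟨1, u, by omega, .one _ _ h1 h2 trivial, ?_⟩
          rw [inv_mul_eq_one] at h
          rw [← h, QuotientGroup.mk_mul]
        · left
          rw [QuotientGroup.mk_mul, ← h]; group
    · intro x hx
      rcases h0 _ x hx with h | h
      · exact prev _ x h
      · exact absurd (hletter _ u _ _ h1 h).1 (by simp)

lemma girth_step (hf : Flow H N f) {N' : Subgroup G} (hN' : ∀ g, g ∈ N' ↔ g ∈ N ∧ f g = 0)
    {m : ℕ} (hg : Girth H N m) : Girth H N' (m + 1) := by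
  classical
  have hlet : ∀ t u, u ∈ H t → u ∉ N' → u ∉ N := by
    intro t u hu hn hN
    apply hn
    rw [hN']
    refine ⟨hN, ?_⟩
    funext s x
    by_cases hs : s = t
    · subst hs
      rw [hf.same s u hu, (QuotientGroup.eq_one_iff u).2 hN]
      have : ∀ a : ZMod 2, a + a = 0 := by decide
      exact this _
    · have : s = !t := by cases s <;> cases t <;> simp_all
      subst this
      exact hf.diff t u hu x
  intro t j w hA hj hw
  rw [hN'] at hw
  have hA' := hA.mono' hlet
  clear hA
  cases hA' with
  | one t u h1 h2 h3 => exact h2 hw.1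
  | snoc t k w u hA h1 h2 h3 =>
    have e1 : f w (!t) (w : G ⧸ N) = 0 := by
      by_contra hne
      obtain ⟨j, v, hj', hv, hx⟩ := (hf.alt_supp hA).2 _ hne
      apply hg _ _ _ hv (by omega)
      rw [← QuotientGroup.eq_one_iff]
      simpa using hx
    have e2 : f (w * u) (!t) (w : G ⧸ N) = 1 := by
      rw [hf.mul, e1, hf.same _ _ h1, inv_mul_cancel, if_pos rfl, if_neg]
      · simp
      · intro h
        exact h2 ((QuotientGroup.eq_one_iff u).1 h.symm)
    rw [hw.2] at e2
    simp at e2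

end Flow

end abs2

end FP

namespace FP

section concrete

open Monoid

/-- translation as a homomorphism to permutations -/
def shiftHom (P : Type*) [Group P] : P →* Equiv.Perm (Bool → P → ZMod 2) where
  toFun p :=
    { toFun := shift p
      invFun := shift p⁻¹
      left_inv := by intro v; funext t x; simp [shift]
      right_inv := by intro v; funext t x; simp [shift] }
  map_one' := by ext v t x; simp [shift]
  map_mul' p q := by ext v t x; simp [shift, mul_assoc]

open scoped Classical in
/-- basic flow -/
noncomputable def dl (P : Type*) [Group P] (t : Bool) : Bool → P → ZMod 2 :=
  fun s x => if s = t ∧ x = 1 then 1 else 0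

/-- the letters of the free product -/
def Hs (A B : Type*) [Group A] [Group B] : Bool → Subgroup (Coprod A B)
  | true => (Coprod.inl : A →* Coprod A B).range
  | false => (Coprod.inr : B →* Coprod A B).range

variable {A B : Type*} [Group A] [Group B]

lemma gen_Hs : Gen (Hs A B) := by
  intro p h1 h2 g
  induction g using Coprod.induction_on with
  | inl a => exact h1 true _ ⟨a, rfl⟩
  | inr b => exact h1 false _ ⟨b, rfl⟩
  | mul x y hx hy => exact h2 _ _ hx hy

/-- affine action on flows -/
noncomputable def rho (N : Subgroup (Coprod A B)) [N.Normal] :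
    Coprod A B →* Equiv.Perm (Bool → (Coprod A B) ⧸ N → ZMod 2) :=
  Coprod.lift
    ((MulAut.conj (Equiv.addRight (dl ((Coprod A B) ⧸ N) true))).toMonoidHom.comp
      ((shiftHom _).comp ((QuotientGroup.mk' N).comp Coprod.inl)))
    ((MulAut.conj (Equiv.addRight (dl ((Coprod A B) ⧸ N) false))).toMonoidHom.comp
      ((shiftHom _).comp ((QuotientGroup.mk' N).comp Coprod.inr)))

lemma rho_letter (N : Subgroup (Coprod A B)) [N.Normal] (t : Bool) (u : Coprod A B)
    (hu : u ∈ Hs A B t) (v : Bool → (Coprod A B) ⧸ N → ZMod 2) :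
    rho N u v = shift (u : (Coprod A B) ⧸ N) (v - dl _ t) + dl _ t := by
  cases t
  · obtain ⟨b, rfl⟩ := hu
    simp only [rho, Coprod.lift_apply_inr]
    rw [sub_eq_add_neg]
    rfl
  · obtain ⟨b, rfl⟩ := hu
    simp only [rho, Coprod.lift_apply_inl]
    rw [sub_eq_add_neg]
    rfl

lemma rho_affine (N : Subgroup (Coprod A B)) [N.Normal] (g : Coprod A B) :
    ∀ v, rho N g v = rho N g 0 + shift (g : (Coprod A B) ⧸ N) v := by
  refine gen_Hs (fun g => ∀ v, rho N g v = rho N g 0 + shift (g : (Coprod A B) ⧸ N) v) ?_ ?_ g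
  · intro t u hu v
    rw [rho_letter N t u hu, rho_letter N t u hu]
    funext s x
    simp only [shift, Pi.add_apply, Pi.sub_apply, Pi.zero_apply]
    ring
  · intro g h hg hh v
    rw [map_mul, Equiv.Perm.mul_apply, Equiv.Perm.mul_apply, hg, hh, hg (rho N h 0)]
    funext s x
    simp only [shift, Pi.add_apply, QuotientGroup.mk_mul, mul_inv_rev, mul_assoc]
    ring

lemma exists_flow (N : Subgroup (Coprod A B)) [N.Normal] (hN : N.FiniteIndex) :
    ∃ f, Flow (Hs A B) N f ∧ ∃ N' : Subgroup (Coprod A B), N'.Normal ∧ N'.FiniteIndex ∧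
      ∀ g, g ∈ N' ↔ g ∈ N ∧ f g = 0 := by
  classical
  refine ⟨fun g => rho N g 0, ⟨?_, ?_, ?_⟩, N ⊓ (rho N).ker, inferInstance, ?_, ?_⟩
  · intro g h t x
    rw [map_mul, Equiv.Perm.mul_apply, rho_affine]
    rfl
  · intro t u hu x
    rw [rho_letter N t u hu]
    have e : ((u : (Coprod A B) ⧸ N)⁻¹ * x = 1) ↔ x = u := by
      rw [inv_mul_eq_one]; exact eq_comm
    simp only [shift, dl, Pi.add_apply, Pi.sub_apply, Pi.zero_apply, true_and, e]
    have : ∀ a b : ZMod 2, 0 - a + b = b + a := by decide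
    exact this _ _
  · intro t u hu x
    rw [rho_letter N t u hu]
    simp [shift, dl]
  · have : Finite ((Coprod A B) ⧸ N) := inferInstance
    have : Finite (rho N).range := inferInstance
    have : (rho N).ker.FiniteIndex := Subgroup.finiteIndex_ker (rho N)
    infer_instance
  · intro g
    rw [Subgroup.mem_inf, MonoidHom.mem_ker]
    refine and_congr_right fun hg => ⟨fun h => by simp only [h]; rfl, fun h => ?_⟩
    have h : rho N g 0 = 0 := h
    ext1 v
    rw [rho_affine, h, (QuotientGroup.eq_one_iff g).2 hg]
    funext s x
    simp [shift]

lemma rf_letters (hA : ResiduallyFinite A) (hB : ResiduallyFinite B) (t : Bool)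
    (u : Coprod A B) (hu : u ∈ Hs A B t) (h1 : u ≠ 1) :
    ∃ N : Subgroup (Coprod A B), N.Normal ∧ N.FiniteIndex ∧ u ∉ N := by
  cases t
  · obtain ⟨b, rfl⟩ := hu
    obtain ⟨N, hN, hfi, hb⟩ := hB b (by rintro rfl; exact h1 (map_one _))
    refine ⟨((QuotientGroup.mk' N).comp Coprod.snd).ker, inferInstance, Subgroup.finiteIndex_ker _, ?_⟩
    simpa [MonoidHom.mem_ker] using hb
  · obtain ⟨b, rfl⟩ := hu
    obtain ⟨N, hN, hfi, hb⟩ := hA b (by rintro rfl; exact h1 (map_one _))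
    refine ⟨((QuotientGroup.mk' N).comp Coprod.fst).ker, inferInstance, Subgroup.finiteIndex_ker _, ?_⟩
    simpa [MonoidHom.mem_ker] using hb

open scoped Classical in
set_option maxHeartbeats 2000000 in
/-- Reiter implies Folner -/
lemma folner {C : Type*} [Group C] [Countable C] (h : ReiterAmenable C) (E : Finset C) (δ : ℝ)
    (hδ : 0 < δ) : ∃ U : Finset C, U.Nonempty ∧ ∀ a ∈ E,
      ((symmDiff (U.image (a * ·)) U).card : ℝ) ≤ δ * U.card := by
  obtain ⟨ε, hε, hεE⟩ : ∃ ε : ℝ, 0 < ε ∧ E.card * (5 / 2 * ε) < δ := by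
    refine ⟨δ / (5 * (E.card + 1)), by positivity, ?_⟩
    have : (E.card : ℝ) * (5 / 2 * (δ / (5 * (E.card + 1)))) =
      δ * (E.card / (E.card + 1)) / 2 := by field_simp
    rw [this]
    have h2 : (E.card : ℝ) / (E.card + 1) ≤ 1 := by
      rw [div_le_one (by positivity)]; linarith
    nlinarith
  obtain ⟨ξ, hs, h1, hinv⟩ := h E ε hε
  set F : C → ℝ := fun x => ξ x ^ 2 with hF
  have hF0 : ∀ x, 0 ≤ F x := fun x => sq_nonneg _
  -- the l1 estimate
  have hl1 : ∀ a ∈ E, Summable (fun x => |F (a⁻¹ * x) - F x|) ∧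
      ∑' x, |F (a⁻¹ * x) - F x| ≤ 5 / 2 * ε := by
    intro a ha
    have hs' : Summable (fun x => ξ (a⁻¹ * x) ^ 2) :=
      (Equiv.mulLeft a⁻¹).summable_iff.2 hs
    have h1' : ∑' x, ξ (a⁻¹ * x) ^ 2 = 1 := by
      rw [← h1]; exact (Equiv.mulLeft a⁻¹).tsum_eq (fun x => ξ x ^ 2)
    have hd : Summable (fun x => (ξ (a⁻¹ * x) - ξ x) ^ 2) := by
      refine Summable.of_nonneg_of_le (fun _ => sq_nonneg _) (fun x => ?_)
        ((hs'.add hs).mul_left 2)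
      nlinarith [sq_nonneg (ξ (a⁻¹ * x) + ξ x)]
    have hb : ∀ x, |F (a⁻¹ * x) - F x| ≤ ε * (ξ (a⁻¹ * x) ^ 2 + ξ x ^ 2) +
        (1 / (2 * ε)) * (ξ (a⁻¹ * x) - ξ x) ^ 2 := by
      intro x
      set p := ξ (a⁻¹ * x)
      set q := ξ x
      have e : F (a⁻¹ * x) - F x = (p - q) * (p + q) := by simp only [hF]; ring
      have h3 : (p + q) ^ 2 ≤ 2 * (p ^ 2 + q ^ 2) := by nlinarith [sq_nonneg (p - q)]
      have h4 : |(p - q) * (p + q)| ≤ ε / 2 * (p + q) ^ 2 + 1 / (2 * ε) * (p - q) ^ 2 := by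
        rw [abs_le]
        have e1 : ε / 2 * (p + q) ^ 2 + 1 / (2 * ε) * (p - q) ^ 2 - (p - q) * (p + q) =
          1 / (2 * ε) * (ε * (p + q) - (p - q)) ^ 2 := by field_simp; ring
        have e2 : ε / 2 * (p + q) ^ 2 + 1 / (2 * ε) * (p - q) ^ 2 + (p - q) * (p + q) =
          1 / (2 * ε) * (ε * (p + q) + (p - q)) ^ 2 := by field_simp; ring
        have n1 : 0 ≤ 1 / (2 * ε) * (ε * (p + q) - (p - q)) ^ 2 := by positivity
        have n2 : 0 ≤ 1 / (2 * ε) * (ε * (p + q) + (p - q)) ^ 2 := by positivity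
        constructor <;> linarith
      rw [e]
      nlinarith
    have hbs := ((hs'.add hs).mul_left ε).add (hd.mul_left (1 / (2 * ε)))
    have hsum : Summable (fun x => |F (a⁻¹ * x) - F x|) :=
      Summable.of_nonneg_of_le (fun _ => abs_nonneg _) hb hbs
    refine ⟨hsum, (hsum.tsum_le_tsum hb hbs).trans ?_⟩
    rw [((hs'.add hs).mul_left ε).tsum_add (hd.mul_left _), tsum_mul_left, tsum_mul_left,
      hs'.tsum_add hs, h1, h1']
    have h5 := hinv a ha
    have : 1 / (2 * ε) * ∑' x, (ξ (a⁻¹ * x) - ξ x) ^ 2 ≤ 1 / (2 * ε) * ε ^ 2 := by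
      gcongr
    have e : 1 / (2 * ε) * ε ^ 2 = ε / 2 := by field_simp
    linarith
  -- level sets
  let ind : ℝ → C → ENNReal := fun t x => if t < F x then 1 else 0
  let dif : C → ℝ → C → ENNReal := fun a t x =>
    if (t < F (a⁻¹ * x) ∧ ¬ t < F x) ∨ (t < F x ∧ ¬ t < F (a⁻¹ * x)) then 1 else 0
  have mind : ∀ x, Measurable fun t => ind t x := by
    intro x
    exact Measurable.ite measurableSet_Iio measurable_const measurable_const
  have mdif : ∀ a x, Measurable fun t => dif a t x := by
    intro a x
    refine Measurable.ite ?_ measurable_const measurable_const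
    have : {t | (t < F (a⁻¹ * x) ∧ ¬ t < F x) ∨ (t < F x ∧ ¬ t < F (a⁻¹ * x))} =
      (Set.Iio (F (a⁻¹ * x)) \ Set.Iio (F x)) ∪ (Set.Iio (F x) \ Set.Iio (F (a⁻¹ * x))) := by
      ext t; simp; tauto
    rw [this]
    exact (measurableSet_Iio.diff measurableSet_Iio).union
      (measurableSet_Iio.diff measurableSet_Iio)
  have iind : ∫⁻ t in Set.Ioi (0 : ℝ), ∑' x, ind t x = 1 := by
    rw [MeasureTheory.lintegral_tsum (fun x => (mind x).aemeasurable)]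
    have : ∀ x, ∫⁻ t in Set.Ioi (0 : ℝ), ind t x = ENNReal.ofReal (F x) := by
      intro x
      have e : (fun t => ind t x) = (Set.Iio (F x)).indicator 1 := by
        funext t; simp [ind, Set.indicator]
      rw [e, MeasureTheory.lintegral_indicator_one measurableSet_Iio,
        MeasureTheory.Measure.restrict_apply measurableSet_Iio, Set.Iio_inter_Ioi,
        Real.volume_Ioo, sub_zero]
    simp_rw [this]
    rw [← ENNReal.ofReal_tsum_of_nonneg hF0 hs, h1, ENNReal.ofReal_one]
  have idif : ∀ a ∈ E, ∫⁻ t in Set.Ioi (0 : ℝ), ∑' x, dif a t x ≤ ENNReal.ofReal (5 / 2 * ε) := by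
    intro a ha
    rw [MeasureTheory.lintegral_tsum (fun x => (mdif a x).aemeasurable)]
    have : ∀ x, ∫⁻ t in Set.Ioi (0 : ℝ), dif a t x ≤ ENNReal.ofReal |F (a⁻¹ * x) - F x| := by
      intro x
      refine (MeasureTheory.lintegral_mono' MeasureTheory.Measure.restrict_le_self
        (le_refl _)).trans ?_
      calc ∫⁻ t, dif a t x ≤ ∫⁻ t, (Set.uIcc (F x) (F (a⁻¹ * x))).indicator 1 t := by
            refine MeasureTheory.lintegral_mono fun t => ?_
            simp only [dif]
            split_ifs with hc
            · rw [Set.indicator_of_mem]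
              · rfl
              · rw [Set.mem_uIcc]
                push Not at hc
                rcases hc with hc | hc
                · left; exact ⟨hc.2, hc.1.le⟩
                · right; exact ⟨hc.2, hc.1.le⟩
            · exact zero_le
        _ = ENNReal.ofReal |F (a⁻¹ * x) - F x| := by
            rw [MeasureTheory.lintegral_indicator_one measurableSet_uIcc, Real.volume_interval]
    refine (ENNReal.tsum_le_tsum this).trans ?_
    rw [← ENNReal.ofReal_tsum_of_nonneg (fun _ => abs_nonneg _) (hl1 a ha).1]
    exact ENNReal.ofReal_le_ofReal (hl1 a ha).2
  have hex : ∃ t, 0 < t ∧ ∑ a ∈ E, ∑' x, dif a t x < ENNReal.ofReal δ * ∑' x, ind t x := by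
    by_contra hn
    push Not at hn
    have : ENNReal.ofReal δ ≤ ENNReal.ofReal (E.card * (5 / 2 * ε)) := by
      calc ENNReal.ofReal δ = ∫⁻ t in Set.Ioi (0 : ℝ), ENNReal.ofReal δ * ∑' x, ind t x := by
            rw [MeasureTheory.lintegral_const_mul _ (Measurable.tsum mind), iind, mul_one]
        _ ≤ ∫⁻ t in Set.Ioi (0 : ℝ), ∑ a ∈ E, ∑' x, dif a t x :=
            MeasureTheory.setLIntegral_mono' measurableSet_Ioi fun t ht => hn t ht
        _ = ∑ a ∈ E, ∫⁻ t in Set.Ioi (0 : ℝ), ∑' x, dif a t x :=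
            MeasureTheory.lintegral_finsetSum _ fun a _ => Measurable.tsum (mdif a)
        _ ≤ ∑ a ∈ E, ENNReal.ofReal (5 / 2 * ε) := Finset.sum_le_sum idif
        _ = _ := by
            rw [Finset.sum_const, nsmul_eq_mul,
              ENNReal.ofReal_mul (p := (E.card : ℝ)) (by positivity), ENNReal.ofReal_natCast]
    rw [ENNReal.ofReal_le_ofReal_iff (by positivity)] at this
    linarith
  obtain ⟨t, ht, hlt⟩ := hex
  have hfin : {x | t < F x}.Finite := by
    have := hs.tendsto_cofinite_zero.eventually (gt_mem_nhds ht)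
    rw [Filter.eventually_cofinite] at this
    exact this.subset fun x hx => by simpa using le_of_lt hx
  let U := hfin.toFinset
  have hU : ∀ x, x ∈ U ↔ t < F x := by intro x; simp [U]
  have hUi : ∑' x, ind t x = (U.card : ENNReal) := by
    rw [tsum_eq_sum (s := U)]
    · rw [Finset.sum_congr rfl (g := fun _ => 1)]
      · simp
      · intro x hx; simp [ind, (hU x).1 hx]
    · intro x hx; simp [ind]; rw [hU] at hx; linarith
  have hUd : ∀ a, ((symmDiff (U.image (a * ·)) U).card : ENNReal) ≤ ∑' x, dif a t x := by
    intro a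
    refine le_trans ?_ (ENNReal.sum_le_tsum (symmDiff (U.image (a * ·)) U))
    rw [Finset.card_eq_sum_ones]
    push_cast
    refine Finset.sum_le_sum fun x hx => ?_
    have him : x ∈ U.image (a * ·) ↔ t < F (a⁻¹ * x) := by
      rw [Finset.mem_image]
      constructor
      · rintro ⟨y, hy, rfl⟩
        simpa using (hU y).1 hy
      · intro hx
        exact ⟨a⁻¹ * x, (hU _).2 hx, by simp⟩
    rw [Finset.mem_symmDiff, him, hU] at hx
    simp only [dif]
    rw [if_pos hx]
  rw [hUi] at hlt
  refine ⟨U, ?_, ?_⟩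
  · by_contra hne
    rw [Finset.not_nonempty_iff_eq_empty] at hne
    rw [hne] at hlt
    simp at hlt
  · intro a ha
    have h6 : ((symmDiff (U.image (a * ·)) U).card : ENNReal) ≤ ENNReal.ofReal δ * U.card := by
      refine le_trans (hUd a) (le_trans ?_ hlt.le)
      exact Finset.single_le_sum (f := fun a => ∑' x, dif a t x) (fun _ _ => zero_le) ha
    rw [← ENNReal.ofReal_natCast, ← ENNReal.ofReal_natCast, ← ENNReal.ofReal_mul hδ.le,
      ENNReal.ofReal_le_ofReal_iff (by positivity)] at h6
    exact h6

open scoped Classical in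
lemma folner_map {C G : Type*} [Group C] [Group G] [Countable C] (h : ReiterAmenable C)
    (φ : C →* G) (hφ : Function.Injective φ) (E : Finset G) (δ : ℝ)
    (hδ : 0 < δ) : ∃ U : Finset G, U.Nonempty ∧ (∀ u ∈ U, u ∈ φ.range) ∧ ∀ a ∈ E, a ∈ φ.range →
      ((symmDiff (U.image (a * ·)) U).card : ℝ) ≤ δ * U.card := by
  obtain ⟨U, hU, hE⟩ := folner h (E.preimage φ hφ.injOn) δ hδ
  refine ⟨U.image φ, hU.image _, ?_, ?_⟩
  · intro u hu
    obtain ⟨x, -, rfl⟩ := Finset.mem_image.1 hu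
    exact ⟨x, rfl⟩
  · rintro _ ha ⟨c, rfl⟩
    have := hE c (by simpa using ha)
    rw [Finset.card_image_of_injective _ hφ]
    refine le_trans ?_ this
    have e : (U.image φ).image (φ c * ·) = (U.image (c * ·)).image φ := by
      rw [Finset.image_image, Finset.image_image]
      exact Finset.image_congr fun x _ => (map_mul φ c x).symm
    rw [e, ← Finset.image_symmDiff _ _ hφ, Finset.card_image_of_injective _ hφ]

open scoped Classical in
lemma folner_Hs (hA : ReiterAmenable A) (hB : ReiterAmenable B) [Countable (Coprod A B)]
    (t : Bool) (E : Finset (Coprod A B)) (δ : ℝ) (hδ : 0 < δ) :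
    ∃ U : Finset (Coprod A B), U.Nonempty ∧ (∀ u ∈ U, u ∈ Hs A B t) ∧ ∀ a ∈ E, a ∈ Hs A B t →
      ((symmDiff (U.image (a * ·)) U).card : ℝ) ≤ δ * U.card := by
  cases t
  · have : Countable B := (Coprod.inr_injective (M := A) (N := B)).countable
    exact folner_map hB Coprod.inr Coprod.inr_injective E δ hδ
  · have : Countable A := (Coprod.inl_injective (M := A) (N := B)).countable
    exact folner_map hA Coprod.inl Coprod.inl_injective E δ hδ

end concrete

end FP

namespace FP

section abs4

variable {G : Type*} [Group G] {H : Bool → Subgroup G}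

lemma alt_of_gen (hgen : Gen H) (g : G) (hg : g ≠ 1) :
    ∃ t m, Alt H ⊥ Set.univ t m g := by
  have key : ∀ g : G, ∀ w : G, (w = 1 ∨ ∃ t m, Alt H ⊥ Set.univ t m w) →
      (w * g = 1 ∨ ∃ t m, Alt H ⊥ Set.univ t m (w * g)) := by
    refine hgen _ ?_ ?_
    · intro t u hu w hw
      by_cases hu1 : u = 1
      · subst hu1; simpa using hw
      · have hub : u ∉ (⊥ : Subgroup G) := by simpa using hu1
        rcases hw with rfl | ⟨s, m, hw⟩
        · right; rw [one_mul]; exact ⟨t, 1, .one t u hu hub trivial⟩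
        · by_cases hs : t = !s
          · subst hs
            right; exact ⟨_, _, .snoc s m w u hw hu hub trivial⟩
          · have hs : s = t := by cases s <;> cases t <;> simp_all
            subst hs
            cases hw with
            | one _ _ h1 h2 h3 =>
              by_cases h : w * u = 1
              · left; exact h
              · right; exact ⟨s, 1, .one s _ ((H s).mul_mem h1 hu) (by simpa using h) trivial⟩
            | snoc t' m' w' u' h0 h1 h2 h3 =>
              rw [mul_assoc]
              by_cases h : u' * u = 1
              · right; rw [h, mul_one]; exact ⟨_, _, h0⟩
              · right
                exact ⟨_, _, .snoc _ _ w' _ h0 ((H _).mul_mem h1 hu) (by simpa using h) trivial⟩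
    · intro g h hg hh w hw
      rw [← mul_assoc]
      exact hh _ (hg _ hw)
  have := key g 1 (Or.inl rfl)
  rw [one_mul] at this
  exact this.resolve_left hg

lemma Alt.finite_letters {t : Bool} {m : ℕ} {g : G} (h : Alt H ⊥ Set.univ t m g) :
    ∃ Z : Finset G, (∀ z ∈ Z, z ≠ 1 ∧ ∃ t, z ∈ H t) ∧
      ∀ N : Subgroup G, (∀ z ∈ Z, z ∉ N) → Alt H N Set.univ t m g := by
  classical
  induction h with
  | one t u h1 h2 h3 =>
    refine ⟨{u}, ?_, ?_⟩
    · intro z hz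
      rw [Finset.mem_singleton] at hz
      subst hz
      exact ⟨by simpa using h2, t, h1⟩
    · intro N hN
      exact .one t u h1 (hN u (by simp)) trivial
  | snoc t m w u _ h1 h2 h3 ih =>
    obtain ⟨Z, hZ, hZN⟩ := ih
    refine ⟨insert u Z, ?_, ?_⟩
    · intro z hz
      rw [Finset.mem_insert] at hz
      rcases hz with rfl | hz
      · exact ⟨by simpa using h2, _, h1⟩
      · exact hZ z hz
    · intro N hN
      exact .snoc t m w u (hZN N fun z hz => hN z (Finset.mem_insert_of_mem hz)) h1
        (hN u (Finset.mem_insert_self _ _)) trivial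

lemma avoid (hrf : ∀ t u, u ∈ H t → u ≠ 1 → ∃ N : Subgroup G, N.Normal ∧ N.FiniteIndex ∧ u ∉ N)
    (Z : Finset G) : ∃ N : Subgroup G, N.Normal ∧ N.FiniteIndex ∧
      ∀ z ∈ Z, ∀ t, z ∈ H t → z ≠ 1 → z ∉ N := by
  classical
  induction Z using Finset.induction_on with
  | empty => exact ⟨⊤, inferInstance, inferInstance, by simp⟩
  | insert a Z _ ih =>
    obtain ⟨N, h1, h2, h3⟩ := ih
    by_cases ha : (∃ t, a ∈ H t) ∧ a ≠ 1
    · obtain ⟨⟨t, ht⟩, ha1⟩ := ha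
      obtain ⟨N', h1', h2', h3'⟩ := hrf t a ht ha1
      refine ⟨N ⊓ N', inferInstance, inferInstance, ?_⟩
      intro z hz s hs hz1 hzN
      rcases Finset.mem_insert.1 hz with rfl | hz
      · exact h3' hzN.2
      · exact h3 z hz s hs hz1 hzN.1
    · refine ⟨N, h1, h2, ?_⟩
      intro z hz s hs hz1
      rcases Finset.mem_insert.1 hz with rfl | hz
      · exact absurd ⟨⟨s, hs⟩, hz1⟩ ha
      · exact h3 z hz s hs hz1

lemma good_N
    (hrf : ∀ t u, u ∈ H t → u ≠ 1 → ∃ N : Subgroup G, N.Normal ∧ N.FiniteIndex ∧ u ∉ N)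
    (hfl : ∀ (N : Subgroup G) [N.Normal], N.FiniteIndex → ∃ f, Flow H N f ∧
      ∃ N' : Subgroup G, N'.Normal ∧ N'.FiniteIndex ∧ ∀ g, g ∈ N' ↔ g ∈ N ∧ f g = 0)
    (Z : Finset G) (m : ℕ) : ∃ N : Subgroup G, N.Normal ∧ N.FiniteIndex ∧
      (∀ z ∈ Z, ∀ t, z ∈ H t → z ≠ 1 → z ∉ N) ∧ Girth H N m := by
  induction m with
  | zero =>
    obtain ⟨N, h1, h2, h3⟩ := avoid hrf Z
    refine ⟨N, h1, h2, h3, ?_⟩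
    intro t j w hw hj
    have := hw.pos
    omega
  | succ m ih =>
    obtain ⟨N, h1, h2, h3, h4⟩ := ih
    obtain ⟨f, hf, N', h1', h2', h3'⟩ := hfl N h2
    refine ⟨N', h1', h2', ?_, hf.girth_step h3' h4⟩
    intro z hz t ht hz1 hzN
    exact h3 z hz t ht hz1 ((h3' z).1 hzN).1

lemma Girth.mono {N : Subgroup G} {m m' : ℕ} (h : m' ≤ m) (hg : Girth H N m) : Girth H N m' :=
  fun t j w hw hj => hg t j w hw (hj.trans h)

/-- the Hilbert space coordinates -/
noncomputable def Phi {N : Subgroup G} [N.Normal] (U : Bool → ℕ → Finset G)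
    (n : ℕ) (v : Bool → G ⧸ N → ZMod 2) : (Bool × (G ⧸ N)) ⊕ (Bool × Fin n × (G ⧸ N)) → ℝ
  | Sum.inl p => chi (v p.1 p.2)
  | Sum.inr p => chi (par (U p.1 p.2.1) p.1 v p.2.2) / Real.sqrt (U p.1 p.2.1).card

lemma Phi_dist {N : Subgroup G} [N.Normal] [Fintype (G ⧸ N)] (U : Bool → ℕ → Finset G)
    (n : ℕ) (v w : Bool → G ⧸ N → ZMod 2) :
    ∑ i, (Phi U n v i - Phi U n w i) ^ 2 = QQ U n (v - w) := by
  rw [Fintype.sum_sum_type, QQ]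
  congr 1
  · rw [Fintype.sum_prod_type, cnt]
    simp only [Phi, chi_sub_sq, Pi.sub_apply]
  · rw [Fintype.sum_prod_type]
    refine Finset.sum_congr rfl fun t _ => ?_
    rw [Fintype.sum_prod_type]
    refine Finset.sum_congr rfl fun k _ => ?_
    rw [wallc, Finset.sum_div]
    refine Finset.sum_congr rfl fun x _ => ?_
    simp only [Phi]
    rw [← sub_div, div_pow, chi_sub_sq, Real.sq_sqrt (Nat.cast_nonneg _), par_sub]

lemma QQ_flow {N : Subgroup G} [N.Normal] [Fintype (G ⧸ N)] {f : G → Bool → G ⧸ N → ZMod 2}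
    (hf : Flow H N f) (U : Bool → ℕ → Finset G) (n : ℕ) (g h : G) :
    QQ U n (f h - f g) = QQ U n (f (g⁻¹ * h)) := by
  have e : f h - f g = shift (g : G ⧸ N) (f (g⁻¹ * h)) := by
    have := hf.mul' g (g⁻¹ * h)
    rw [mul_inv_cancel_left] at this
    rw [this, add_sub_cancel_left]
  rw [e, QQ_shift]

open scoped Classical in
lemma upper (hgen : Gen H) {ℓ : G → ℝ} (U : Bool → ℕ → Finset G)
    (hfol : ∀ t (k : ℕ) a, ℓ a ≤ k → a ∈ H t →
      ((symmDiff ((U t k).image (a * ·)) (U t k)).card : ℝ) ≤ (1 / 2) ^ k * (U t k).card)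
    (hne : ∀ t k, (U t k).Nonempty) :
    ∀ g : G, ∃ c : ℝ, ∀ (N : Subgroup G) [N.Normal] [Fintype (G ⧸ N)]
      (f : G → Bool → G ⧸ N → ZMod 2), Flow H N f → ∀ n, QQ U n (f g) ≤ c := by
  refine hgen _ ?_ ?_
  · intro t a ha
    let b : ℕ → ℝ := fun k => ((symmDiff ((U t k).image (a * ·)) (U t k)).card : ℝ) / (U t k).card
    have hb0 : ∀ k, 0 ≤ b k := fun k => by positivity
    have hcard : ∀ t k, (0 : ℝ) < (U t k).card := fun t k => by
      exact_mod_cast (hne t k).card_pos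
    have hb : Summable b := by
      refine Summable.of_norm_bounded_eventually_nat (g := fun k => (1 / 2 : ℝ) ^ k)
        (summable_geometric_of_lt_one (by norm_num) (by norm_num)) ?_
      filter_upwards [Filter.eventually_ge_atTop ⌈ℓ a⌉₊] with k hk
      rw [Real.norm_of_nonneg (hb0 k), div_le_iff₀ (hcard t k)]
      exact hfol t k a (Nat.ceil_le.1 hk) ha
    refine ⟨2 + ∑' k, b k, ?_⟩
    intro N _ _ f hf n
    unfold QQ
    refine add_le_add (hf.cnt_letter ha) ?_
    have h1 : ∑ k : Fin n, wallc (U (!t) k) (!t) (f a) / (U (!t) k).card = 0 := by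
      refine Finset.sum_eq_zero fun k _ => ?_
      rw [hf.wallc_letter_diff ha, zero_div]
    have h2 : ∑ k : Fin n, wallc (U t k) t (f a) / (U t k).card ≤ ∑' k, b k := by
      calc ∑ k : Fin n, wallc (U t k) t (f a) / (U t k).card ≤ ∑ k : Fin n, b k := by
            refine Finset.sum_le_sum fun k _ => ?_
            refine div_le_div_of_nonneg_right ?_ (hcard t k).le
            convert hf.wallc_letter_same ha (U t k)
        _ = ∑ k ∈ Finset.range n, b k := Fin.sum_univ_eq_sum_range b n
        _ ≤ _ := hb.sum_le_tsum _ fun k _ => hb0 k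
    rw [Fintype.sum_bool]
    cases t
    · simp only [Bool.not_false] at h1
      linarith
    · simp only [Bool.not_true] at h1
      linarith
  · rintro g h ⟨c, hc⟩ ⟨c', hc'⟩
    refine ⟨c + c', ?_⟩
    intro N _ _ f hf n
    rw [hf.mul']
    refine (QQ_add _ _ _ _).trans ?_
    rw [QQ_shift]
    exact add_le_add (hc N f hf n) (hc' N f hf n)

lemma lower_QQ (hgen : Gen H) {N : Subgroup G} [N.Normal] [Fintype (G ⧸ N)]
    {f : G → Bool → G ⧸ N → ZMod 2} (hf : Flow H N f)
    (U : Bool → ℕ → Finset G) (hU : ∀ t k, ∀ u ∈ U t k, u ∈ H t)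
    (hne : ∀ t k, (U t k).Nonempty) {M n : ℕ}
    (hn : M < n) (hg : Girth H N (3 * M))
    (hinj : ∀ t k, k < n → Set.InjOn (QuotientGroup.mk : G → G ⧸ N) (U t k))
    {K : Set G} (hK : ∀ t k, k < M + 1 → ∀ u ∈ U t k, ∀ u' ∈ U t k, u * u'⁻¹ ∈ K)
    {h : G} (hQ : QQ U n (f h) ≤ M) :
    ∃ w, (w = 1 ∨ ∃ t j, j ≤ M ∧ Alt H N K t j w) ∧ w⁻¹ * h ∈ N ∧ f (w⁻¹ * h) = 0 := by
  have hcard : ∀ t k, (0 : ℝ) < (U t k).card := fun t k => by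
    exact_mod_cast (hne t k).card_pos
  have hr0 : ∀ t k, 0 ≤ wallc (U t k) t (f h) / (U t k).card := fun t k =>
    div_nonneg (wallc_nonneg _ _ _) (hcard t k).le
  have hcnt : cnt (f h) ≤ M := by
    have : 0 ≤ ∑ t, ∑ k : Fin n, wallc (U t k) t (f h) / (U t k).card :=
      Finset.sum_nonneg fun t _ => Finset.sum_nonneg fun k _ => hr0 t k
    unfold QQ at hQ
    linarith
  obtain ⟨k, hk, hkw⟩ : ∃ k, k < M + 1 ∧ ∀ t, wallc (U t k) t (f h) < (U t k).card := by
    by_contra hcon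
    push Not at hcon
    have h1 : ∑ t, ∑ k : Fin n, wallc (U t k) t (f h) / (U t k).card ≤ M := by
      have := cnt_nonneg (f h)
      unfold QQ at hQ
      linarith
    rw [Finset.sum_comm, Fin.sum_univ_eq_sum_range
      (fun k => ∑ t, wallc (U t k) t (f h) / (U t k).card) n] at h1
    have h2 : ∑ k ∈ Finset.range (M + 1), (1 : ℝ) ≤
        ∑ k ∈ Finset.range (M + 1), ∑ t, wallc (U t k) t (f h) / (U t k).card := by
      refine Finset.sum_le_sum fun k hk => ?_
      obtain ⟨t, ht⟩ := hcon k (Finset.mem_range.1 hk)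
      refine le_trans ?_ (Finset.single_le_sum
        (f := fun t => wallc (U t k) t (f h) / (U t k).card) (fun t _ => hr0 t k)
        (Finset.mem_univ t))
      simpa using (one_le_div (hcard t k)).2 ht
    have h3 : ∑ k ∈ Finset.range (M + 1), ∑ t, wallc (U t k) t (f h) / (U t k).card ≤
        ∑ k ∈ Finset.range n, ∑ t, wallc (U t k) t (f h) / (U t k).card :=
      Finset.sum_le_sum_of_subset_of_nonneg (Finset.range_mono hn)
        fun k _ _ => Finset.sum_nonneg fun t _ => hr0 t k
    simp only [Finset.sum_const, Finset.card_range, nsmul_eq_mul, mul_one] at h2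
    push_cast at h2
    linarith
  exact hf.lower hgen hg (fun t => U t k) (fun t => hU t k) (fun t => hinj t k (by omega))
    (fun t => hK t k hk) hcnt hkw

end abs4

lemma ucee {X : ℕ → Type*} [∀ n, Nonempty (X n)] (d : ∀ n, X n → X n → ℝ) {ι : ℕ → Type*}
    [∀ n, Fintype (ι n)] (Φ : ∀ n, X n → ι n → ℝ)
    (h1 : ∀ R, ∃ C, ∀ n x y, d n x y ≤ R → ∑ i, (Φ n x i - Φ n y i) ^ 2 ≤ C)
    (h2 : ∀ R, ∃ S, ∀ n x y, ∑ i, (Φ n x i - Φ n y i) ^ 2 ≤ R → d n x y ≤ S) :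
    UnifCoarseEmbedHilbert X d := by
  let F : ∀ n, X n → EuclideanSpace ℝ (Fin (Fintype.card (ι n))) := fun n x =>
    WithLp.toLp 2 fun i => Φ n x ((Fintype.equivFin (ι n)).symm i)
  have hF : ∀ n x y, dist (F n x) (F n y) = Real.sqrt (∑ i, (Φ n x i - Φ n y i) ^ 2) := by
    intro n x y
    rw [EuclideanSpace.dist_eq, ← Equiv.sum_comp (Fintype.equivFin (ι n)).symm]
    simp [F, Real.dist_eq, sq_abs]
  let D : (Σ n, X n × X n) → ℝ := fun p => dist (F p.1 p.2.1) (F p.1 p.2.2)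
  let e : (Σ n, X n × X n) → ℝ := fun p => d p.1 p.2.1 p.2.2
  have hD0 : ∀ p, 0 ≤ D p := fun p => dist_nonneg
  have hbb : ∀ t, BddBelow (Set.range fun p => D p + max 0 (t - e p)) := by
    intro t
    refine ⟨0, ?_⟩
    rintro _ ⟨p, rfl⟩
    exact add_nonneg (hD0 p) (le_max_left _ _)
  have hne : Nonempty (Σ n, X n × X n) :=
    ⟨⟨0, Classical.arbitrary (X 0), Classical.arbitrary (X 0)⟩⟩
  have hba : ∀ t, BddAbove (insert 0 {r | ∃ p, e p ≤ t ∧ D p = r}) := by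
    intro t
    obtain ⟨C, hC⟩ := h1 t
    refine ⟨Real.sqrt C, ?_⟩
    rintro r (rfl | ⟨p, hp, rfl⟩)
    · exact Real.sqrt_nonneg _
    · simp only [D, hF]
      exact Real.sqrt_le_sqrt (hC _ _ _ hp)
  refine ⟨fun n => EuclideanSpace ℝ (Fin (Fintype.card (ι n))), inferInstance, inferInstance,
    inferInstance, F, fun t => ⨅ p, (D p + max 0 (t - e p)),
    fun t => sSup (insert 0 {r | ∃ p, e p ≤ t ∧ D p = r}), ?_, ?_, ?_, ?_⟩
  · intro s t hst
    refine ciInf_mono (hbb s) fun p => ?_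
    gcongr
  · intro s t hst
    refine csSup_le_csSup (hba t) ⟨0, Set.mem_insert _ _⟩ (Set.insert_subset_insert ?_)
    rintro r ⟨p, hp, rfl⟩
    exact ⟨p, hp.trans hst, rfl⟩
  · rw [Filter.tendsto_atTop_atTop]
    intro b
    obtain ⟨S, hS⟩ := h2 (b ^ 2)
    refine ⟨S + b, fun t ht => ?_⟩
    refine le_ciInf fun p => ?_
    by_cases hp : ∑ i, (Φ p.1 p.2.1 i - Φ p.1 p.2.2 i) ^ 2 ≤ b ^ 2
    · have h3 : e p ≤ S := hS _ _ _ hp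
      have := le_max_right 0 (t - e p)
      linarith [hD0 p]
    · push Not at hp
      have h4 : b ≤ D p := by
        simp only [D, hF]
        exact Real.le_sqrt_of_sq_le hp.le
      have := le_max_left 0 (t - e p)
      linarith
  · intro n x y
    constructor
    · refine (ciInf_le (hbb _) ⟨n, x, y⟩).trans ?_
      simp [D, e]
    · exact le_csSup (hba _) (Set.mem_insert_of_mem _ ⟨⟨n, x, y⟩, le_rfl, rfl⟩)

end FP

namespace FP

section abs5

variable {G : Type*} [Group G] {H : Bool → Subgroup G}

lemma quotDist_le {ℓ : G → ℝ} (hℓ : IsLengthFunction ℓ) (N : Subgroup G) (g h : G) :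
    quotDist ℓ N (QuotientGroup.mk g) (QuotientGroup.mk h) ≤ ℓ (g⁻¹ * h) := by
  refine csInf_le ⟨0, ?_⟩ ⟨g, h, rfl, rfl, rfl⟩
  rintro r ⟨_, _, _, _, rfl⟩
  exact hℓ.nonneg _

lemma exists_quotDist {ℓ : G → ℝ} (N : Subgroup G) (x y : G ⧸ N) {R : ℝ}
    (hR : quotDist ℓ N x y < R) : ∃ g h : G, QuotientGroup.mk g = x ∧ QuotientGroup.mk h = y ∧
      ℓ (g⁻¹ * h) < R := by
  have hne : {r : ℝ | ∃ g h : G,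
      (QuotientGroup.mk g : G ⧸ N) = x ∧ QuotientGroup.mk h = y ∧ ℓ (g⁻¹ * h) = r}.Nonempty := by
    obtain ⟨g, rfl⟩ := QuotientGroup.mk_surjective x
    obtain ⟨h, rfl⟩ := QuotientGroup.mk_surjective y
    exact ⟨_, g, h, rfl, rfl, rfl⟩
  obtain ⟨r, ⟨g, h, hg, hh, rfl⟩, hr⟩ := exists_lt_of_csInf_lt hne hR
  exact ⟨g, h, hg, hh, hr⟩

lemma flow_out {N N' : Subgroup G} [N.Normal] {f : G → Bool → G ⧸ N → ZMod 2}
    (hf : Flow H N f) (hN' : ∀ g, g ∈ N' ↔ g ∈ N ∧ f g = 0) (g : G) :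
    f ((QuotientGroup.mk g : G ⧸ N').out) = f g := by
  obtain ⟨z, hz⟩ := QuotientGroup.mk_out_eq_mul N' g
  rw [hz, hf.mul', ((hN' _).1 z.2).2]
  funext t x
  simp [shift]

open scoped Classical in
lemma main_abs (hgen : Gen H)
    (hrf : ∀ t u, u ∈ H t → u ≠ 1 → ∃ N : Subgroup G, N.Normal ∧ N.FiniteIndex ∧ u ∉ N)
    (hfl : ∀ (N : Subgroup G) [N.Normal], N.FiniteIndex → ∃ f, Flow H N f ∧
      ∃ N' : Subgroup G, N'.Normal ∧ N'.FiniteIndex ∧ ∀ g, g ∈ N' ↔ g ∈ N ∧ f g = 0)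
    (hfol : ∀ (t : Bool) (E : Finset G) (δ : ℝ), 0 < δ → ∃ U : Finset G, U.Nonempty ∧
      (∀ u ∈ U, u ∈ H t) ∧ ∀ a ∈ E, a ∈ H t →
      ((symmDiff (U.image (a * ·)) U).card : ℝ) ≤ δ * U.card)
    (ℓ : G → ℝ) (hℓ : IsProperLength ℓ) :
    ∃ N : ℕ → Subgroup G, (∀ n, (N n).Normal) ∧ (∀ n, (N n).FiniteIndex) ∧ (⨅ n, N n) = ⊥ ∧
      UnifCoarseEmbedHilbert (fun n => G ⧸ N n) (fun n => quotDist ℓ (N n)) := by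
  obtain ⟨hlen, hprop⟩ := hℓ
  choose U hne hU hUE using fun (t : Bool) (k : ℕ) =>
    hfol t (hprop k).toFinset ((1 / 2 : ℝ) ^ k) (by positivity)
  have hup := upper hgen (ℓ := ℓ) U (fun t k a ha hat => hUE t k a (by simpa using ha) hat) hne
  choose c hc using hup
  let Z : ℕ → Finset G := fun n => (hprop n).toFinset ∪
    Finset.univ.biUnion fun t : Bool => (Finset.range n).biUnion fun k =>
      Finset.image₂ (fun u u' => u⁻¹ * u') (U t k) (U t k)
  choose Nh hNn hNfi hNZ hNg using fun n => good_N hrf hfl (Z n) n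
  choose f hf N' hn' hfi' hN' using fun n => hfl (Nh n) (hNfi n)
  letI : ∀ n, Fintype (G ⧸ Nh n) := fun n => Fintype.ofFinite _
  have hinj : ∀ n t k, k < n → Set.InjOn (QuotientGroup.mk : G → G ⧸ Nh n) (U t k) := by
    intro n t k hk u hu u' hu' he
    by_contra hne
    refine hNZ n (u⁻¹ * u') ?_ t ((H t).mul_mem ((H t).inv_mem (hU t k u hu)) (hU t k u' hu')) ?_
      (QuotientGroup.eq.1 he)
    · refine Finset.mem_union_right _ ?_
      simp only [Finset.mem_biUnion, Finset.mem_univ, true_and, Finset.mem_range]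
      exact ⟨t, k, hk, Finset.mem_image₂_of_mem hu hu'⟩
    · rw [Ne, inv_mul_eq_one]; exact hne
  refine ⟨N', hn', hfi', ?_, ?_⟩
  · rw [eq_bot_iff]
    intro g hg
    rw [Subgroup.mem_bot]
    by_contra hg1
    obtain ⟨t, m, halt⟩ := alt_of_gen hgen g hg1
    obtain ⟨L, hL, hLN⟩ := halt.finite_letters
    obtain ⟨n0, hn0⟩ : ∃ n0 : ℕ, ∀ z ∈ L, ℓ z ≤ n0 := by
      refine ⟨∑ z ∈ L, ⌈ℓ z⌉₊, fun z hz => (Nat.le_ceil _).trans ?_⟩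
      exact_mod_cast Finset.single_le_sum (f := fun z => ⌈ℓ z⌉₊) (fun _ _ => Nat.zero_le _) hz
    have hmem : g ∈ N' (max n0 m) := (Subgroup.mem_iInf.1 hg) _
    refine hNg (max n0 m) t m g (hLN _ fun z hz => ?_) (le_max_right _ _) ((hN' _ g).1 hmem).1
    obtain ⟨hz1, s, hs⟩ := hL z hz
    refine hNZ _ z (Finset.mem_union_left _ ?_) s hs hz1
    have h3 : ℓ z ≤ ((max n0 m : ℕ) : ℝ) :=
      (hn0 z hz).trans (by exact_mod_cast le_max_left _ _)
    simpa using h3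
  · have hS : ∀ n (g h : G), ∑ i, (Phi U n (f n ((QuotientGroup.mk g : G ⧸ N' n).out)) i -
        Phi U n (f n ((QuotientGroup.mk h : G ⧸ N' n).out)) i) ^ 2 = QQ U n (f n (h⁻¹ * g)) := by
      intro n g h
      rw [flow_out (hf n) (hN' n), flow_out (hf n) (hN' n), Phi_dist, QQ_flow (hf n)]
    refine ucee _ (fun n x => Phi U n (f n x.out)) ?_ ?_
    · intro R
      refine ⟨∑ g ∈ (hprop (R + 1)).toFinset, |c g|, ?_⟩
      intro n x y hxy
      obtain ⟨g, h, rfl, rfl, hgh⟩ := exists_quotDist (N' n) x y (lt_of_le_of_lt hxy (lt_add_one R))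
      rw [hS]
      refine (hc (h⁻¹ * g) (Nh n) (f n) (hf n) n).trans ((le_abs_self _).trans ?_)
      refine Finset.single_le_sum (f := fun g => |c g|) (fun _ _ => abs_nonneg _) ?_
      have e : ℓ (h⁻¹ * g) = ℓ (g⁻¹ * h) := by
        rw [← hlen.inv_eq, mul_inv_rev, inv_inv]
      simpa [e] using hgh.le
    · intro R
      let M := ⌈R⌉₊
      let Ks : Finset G := Finset.univ.biUnion fun t : Bool =>
        (Finset.range (M + 1)).biUnion fun k =>
          Finset.image₂ (fun u u' => u * u'⁻¹) (U t k) (U t k)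
      let b : ℝ := ∑ z ∈ Ks, ℓ z
      have hb0 : 0 ≤ b := Finset.sum_nonneg fun _ _ => hlen.nonneg _
      have hb : ∀ z ∈ (Ks : Set G), ℓ z ≤ b := fun z hz =>
        Finset.single_le_sum (f := ℓ) (fun _ _ => hlen.nonneg _) hz
      have hsm : ∀ n, ∃ s, ∀ x y : G ⧸ N' n, quotDist ℓ (N' n) x y ≤ s := by
        intro n
        obtain ⟨s, hs⟩ := (Set.finite_range
          fun p : (G ⧸ N' n) × (G ⧸ N' n) => quotDist ℓ (N' n) p.1 p.2).bddAbove
        exact ⟨s, fun x y => hs ⟨(x, y), rfl⟩⟩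
      choose s hs using hsm
      have hs0 : 0 ≤ ∑ n ∈ Finset.range (3 * M + 1), |s n| :=
        Finset.sum_nonneg fun _ _ => abs_nonneg _
      refine ⟨M * b + ∑ n ∈ Finset.range (3 * M + 1), |s n|, ?_⟩
      intro n x y hxy
      by_cases hn : n < 3 * M + 1
      · have h1 : |s n| ≤ ∑ n ∈ Finset.range (3 * M + 1), |s n| :=
          Finset.single_le_sum (f := fun n => |s n|) (fun _ _ => abs_nonneg _)
            (Finset.mem_range.2 hn)
        have h2 : 0 ≤ M * b := by positivity
        linarith [hs n x y, le_abs_self (s n)]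
      · obtain ⟨g, rfl⟩ := QuotientGroup.mk_surjective x
        obtain ⟨h, rfl⟩ := QuotientGroup.mk_surjective y
        rw [hS] at hxy
        obtain ⟨w, hw, hwN, hw0⟩ := lower_QQ hgen (hf n) U hU hne (M := M) (n := n) (by omega)
          ((hNg n).mono (by omega)) (hinj n) (K := (Ks : Set G)) (by
            intro t k hk u hu u' hu'
            simp only [Ks, Finset.mem_coe, Finset.mem_biUnion, Finset.mem_univ, true_and,
              Finset.mem_range]
            exact ⟨t, k, hk, Finset.mem_image₂_of_mem hu hu'⟩)
          (hxy.trans (Nat.le_ceil R))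
        have hwl : ℓ w ≤ M * b := by
          rcases hw with rfl | ⟨t, j, hj, ha⟩
          · rw [(hlen.eq_zero_iff 1).2 rfl]; positivity
          · refine (ha.length_bound hlen hb).trans ?_
            have : (j : ℝ) ≤ M := by exact_mod_cast hj
            gcongr
        have hmk : (QuotientGroup.mk g : G ⧸ N' n) = QuotientGroup.mk (h * w) := by
          refine (QuotientGroup.eq.2 ?_).symm
          have := (hN' n _).2 ⟨hwN, hw0⟩
          rwa [mul_inv_rev, mul_assoc]
        have hd := quotDist_le hlen (N' n) (h * w) h
        have e : ℓ ((h * w)⁻¹ * h) = ℓ w := by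
          rw [mul_inv_rev, inv_mul_cancel_right, hlen.inv_eq]
        rw [hmk]
        linarith

end abs5

end FP

/-- If `A` and `B` are finitely generated, residually finite, amenable
groups and `ℓ` is a proper length function on `G = A ∗ B`, then `G` admits a sequence of
finite-index normal subgroups with trivial intersection whose quotients, with the quotient
metrics induced by `ℓ`, coarsely embed uniformly into Hilbert space. -/
theorem statement0 {A B : Type*} [Group A] [Group B]
    (hAfg : Group.FG A) (hBfg : Group.FG B)
    (hArf : ResiduallyFinite A) (hBrf : ResiduallyFinite B)
    (hAam : ReiterAmenable A) (hBam : ReiterAmenable B)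
    (ℓ : Monoid.Coprod A B → ℝ) (hℓ : IsProperLength ℓ) :
    ∃ N : ℕ → Subgroup (Monoid.Coprod A B),
      (∀ n, (N n).Normal) ∧ (∀ n, (N n).FiniteIndex) ∧ (⨅ n, N n) = ⊥ ∧
      UnifCoarseEmbedHilbert (fun n => Monoid.Coprod A B ⧸ N n)
        (fun n => quotDist ℓ (N n)) := by
  have : Countable (Monoid.Coprod A B) := by
    have h : (Set.univ : Set (Monoid.Coprod A B)) = ⋃ n : ℕ, {g | ℓ g ≤ n} := by
      ext g
      simpa using ⟨⌈ℓ g⌉₊, Nat.le_ceil _⟩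
    rw [← Set.countable_univ_iff, h]
    exact Set.countable_iUnion fun n => (hℓ.2 n).countable
  exact FP.main_abs FP.gen_Hs (FP.rf_letters hArf hBrf) (fun N _ hN => FP.exists_flow N hN)
    (FP.folner_Hs hAam hBam) ℓ hℓ
end

section
/- Let F₂ be the free group on two generators a, b and let S = {a, a⁻¹, b, b⁻¹}. Then there exists a sequence (H_j)_{j∈ℕ} of finite-index subgroups of F₂ such that: (i) for every g ∈ F₂ with g ≠ 1, the left translation action of g on F₂/H_j is nontrivial for all but finitely many j; and (ii) the sequence of Schreier coset spaces has property A uniformly, i.e. for all R > 0 and ε > 0 there exist C > 0 and, for each j, a map φ_j : F₂/H_j → ℓ²(F₂/H_j) such that ‖φ_j(x)‖ = 1 for all x, |1 − ⟨φ_j(x), φ_j(y)⟩| ≤ ε whenever d(x,y) ≤ R, and φ_j(x) is supported in the ball of radius C around x, where d is the Schreier metric on F₂/H_j determined by S. -/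
/-- The generating set `{a, a⁻¹, b, b⁻¹}` of the free group on two generators. -/
def stdGenSet : Set (FreeGroup Bool) :=
  {FreeGroup.of true, (FreeGroup.of true)⁻¹, FreeGroup.of false, (FreeGroup.of false)⁻¹}

open scoped RealInnerProductSpace

section Helpers
open Finset

/-! ### Words in three involutions -/

/-- Images of the generators in a group with three chosen involutions. -/
def genImg {P : Type} [Group P] (T : Fin 3 → P) : Bool → P :=
  fun i => if i then T 0 * T 1 else T 1 * T 2

def Represents (g : FreeGroup Bool) (v : List (Fin 3)) : Prop :=
  ∀ (P : Type) [Group P] (T : Fin 3 → P), (∀ i, T i * T i = 1) →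
    FreeGroup.lift (genImg T) g = (v.map T).prod

lemma exists_represents (g : FreeGroup Bool) : ∃ v, Represents g v := by
  induction g using FreeGroup.induction_on with
  | C1 => exact ⟨[], fun P _ T h => by simp⟩
  | of i =>
    cases i
    · exact ⟨[1, 2], fun P _ T h => by simp [genImg]⟩
    · exact ⟨[0, 1], fun P _ T h => by simp [genImg]⟩
  | inv_of i _ =>
    cases i
    · refine ⟨[2, 1], fun P _ T h => ?_⟩
      have h' : ∀ i, (T i)⁻¹ = T i := fun i => inv_eq_of_mul_eq_one_left (h i)
      simp [genImg, h']
    · refine ⟨[1, 0], fun P _ T h => ?_⟩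
      have h' : ∀ i, (T i)⁻¹ = T i := fun i => inv_eq_of_mul_eq_one_left (h i)
      simp [genImg, h']
  | mul x y hx hy =>
    obtain ⟨u, hu⟩ := hx
    obtain ⟨v, hv⟩ := hy
    exact ⟨u ++ v, fun P _ T h => by rw [map_mul, hu P T h, hv P T h]; simp⟩

lemma exists_reduced (u : List (Fin 3)) : ∃ v : List (Fin 3), v.IsChain (· ≠ ·) ∧
    ∀ (P : Type) [Group P] (T : Fin 3 → P), (∀ i, T i * T i = 1) →
      (u.map T).prod = (v.map T).prod := by
  induction u with
  | nil => exact ⟨[], by simp, fun P _ T h => rfl⟩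
  | cons c u ih =>
    obtain ⟨v, hv, hp⟩ := ih
    cases v with
    | nil => exact ⟨[c], by simp, fun P _ T h => by simp [hp P T h]⟩
    | cons d v =>
      by_cases hcd : c = d
      · subst hcd
        refine ⟨v, hv.tail, fun P _ T h => ?_⟩
        rw [List.map_cons, List.prod_cons, hp P T h, List.map_cons, List.prod_cons,
          ← mul_assoc, h, one_mul]
      · refine ⟨c :: d :: v, ?_, fun P _ T h => ?_⟩
        · rw [List.isChain_cons_cons]; exact ⟨hcd, hv⟩
        · rw [List.map_cons, List.prod_cons, hp P T h, List.map_cons (l := d :: v),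
            List.prod_cons]

/-- The automorphism inverting both generators. -/
def flipHom : FreeGroup Bool →* FreeGroup Bool := FreeGroup.lift (fun i => (FreeGroup.of i)⁻¹)

lemma flipHom_flipHom (x : FreeGroup Bool) : flipHom (flipHom x) = x := by
  have : flipHom.comp flipHom = MonoidHom.id _ := by
    ext i; simp [flipHom]
  exact DFunLike.congr_fun this x

def flipPerm : Equiv.Perm (FreeGroup Bool) := ⟨flipHom, flipHom, flipHom_flipHom, flipHom_flipHom⟩

def modelT : Fin 3 → Equiv.Perm (FreeGroup Bool) :=
  ![Equiv.mulLeft (FreeGroup.of true) * flipPerm, flipPerm,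
    flipPerm * Equiv.mulLeft (FreeGroup.of false)]

lemma flipPerm_apply (x) : flipPerm x = flipHom x := rfl

lemma flipHom_of (i) : flipHom (FreeGroup.of i) = (FreeGroup.of i)⁻¹ := by simp [flipHom]

lemma modelT_sq (i : Fin 3) : modelT i * modelT i = 1 := by
  ext1 x
  fin_cases i <;> simp [modelT, flipPerm_apply, flipHom_of, flipHom_flipHom]

lemma modelT_lift (g x : FreeGroup Bool) : FreeGroup.lift (genImg modelT) g x = g * x := by
  have : FreeGroup.lift (genImg modelT) = MulAction.toPermHom (FreeGroup Bool) (FreeGroup Bool) := by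
    ext1 i
    ext1 x
    cases i <;> simp [genImg, modelT, flipPerm_apply, flipHom_flipHom]
  rw [this]; rfl

lemma exists_color_word (g : FreeGroup Bool) : ∃ v : List (Fin 3), v.IsChain (· ≠ ·) ∧
    Represents g v ∧ (g ≠ 1 → v ≠ []) := by
  obtain ⟨u, hu⟩ := exists_represents g
  obtain ⟨v, hv, hp⟩ := exists_reduced u
  have hr : Represents g v := fun P _ T h => by rw [hu P T h, hp P T h]
  refine ⟨v, hv, hr, ?_⟩
  rintro hg rfl
  apply hg
  have h1 := hr _ modelT modelT_sq
  have h2 := modelT_lift g 1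
  rw [h1] at h2
  simpa using h2.symm

lemma exists_third (c d : Fin 3) : ∃ t, t ≠ c ∧ t ≠ d := by
  revert c d; decide

lemma exists_third' (c d : Option (Fin 3)) : ∃ t : Fin 3, some t ≠ c ∧ some t ≠ d := by
  revert c d; decide

lemma exists_coloring (v : ℕ → List (Fin 3)) (hv : ∀ k, (v k).IsChain (· ≠ ·)) (j : ℕ) :
    ∃ l : List (Fin 3), l.IsChain (· ≠ ·) ∧ ∀ k < j, v k <:+: l := by
  induction j with
  | zero => exact ⟨[], by simp, by simp⟩
  | succ j ih =>
    obtain ⟨l, hl, hk⟩ := ih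
    obtain ⟨t, h1, h2⟩ := exists_third' l.getLast? (v j).head?
    refine ⟨l ++ ([t] ++ v j), ?_, ?_⟩
    · rw [List.isChain_append, List.isChain_append]
      refine ⟨hl, ⟨by simp, hv j, ?_⟩, ?_⟩
      · intro x hx y hy
        simp at hx
        subst hx
        rintro rfl
        exact h2 hy.symm
      · intro x hx y hy
        simp at hy
        subst hy
        rintro rfl
        exact h1 hx.symm
    · intro k hkj
      rcases Nat.lt_succ_iff_lt_or_eq.mp hkj with h | rfl
      · exact (hk k h).trans (List.prefix_append _ _).isInfix
      · exact ((List.suffix_append _ _).trans (List.suffix_append _ _)).isInfix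

/-! ### The action on a coloured path -/

def tauFun (l : List (Fin 3)) (c : Fin 3) (i : ℕ) : ℕ :=
  if l[i]? = some c then i + 1 else if 0 < i ∧ l[i-1]? = some c then i - 1 else i

lemma chain_next {l : List (Fin 3)} (hl : l.IsChain (· ≠ ·)) {i : ℕ} {c : Fin 3}
    (h : l[i]? = some c) : l[i+1]? ≠ some c := by
  intro h'
  rw [List.isChain_iff_getElem] at hl
  obtain ⟨a, b⟩ := List.getElem?_eq_some_iff.mp h
  obtain ⟨a', b'⟩ := List.getElem?_eq_some_iff.mp h'
  exact hl i a' (b.trans b'.symm)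

lemma tau_down {l : List (Fin 3)} (hl : l.IsChain (· ≠ ·)) {i : ℕ} {c : Fin 3}
    (h : l[i]? = some c) : tauFun l c (i+1) = i := by
  simp [tauFun, chain_next hl h, h]

lemma tau_up {l : List (Fin 3)} {i : ℕ} {c : Fin 3}
    (h : l[i]? = some c) : tauFun l c i = i + 1 := by
  simp [tauFun, h]

lemma tau_tau {l : List (Fin 3)} (hl : l.IsChain (· ≠ ·)) (c : Fin 3) (i : ℕ) :
    tauFun l c (tauFun l c i) = i := by
  by_cases h : l[i]? = some c
  · rw [tau_up h, tau_down hl h]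
  · by_cases h2 : 0 < i ∧ l[i-1]? = some c
    · obtain ⟨k, rfl⟩ : ∃ k, i = k + 1 := ⟨i - 1, by omega⟩
      have h3 : l[k]? = some c := by simpa using h2.2
      rw [tau_down hl h3, tau_up h3]
    · have : tauFun l c i = i := by rw [tauFun, if_neg h, if_neg h2]
      rw [this, this]

lemma tau_near (l : List (Fin 3)) (c : Fin 3) (i : ℕ) :
    tauFun l c i ≤ i + 1 ∧ i ≤ tauFun l c i + 1 := by
  unfold tauFun; split_ifs <;> omega

lemma tau_le (l : List (Fin 3)) (c : Fin 3) (i : ℕ) (hi : i ≤ l.length) :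
    tauFun l c i ≤ l.length := by
  unfold tauFun; split_ifs with h
  · obtain ⟨a, b⟩ := List.getElem?_eq_some_iff.mp h
    omega
  · omega
  · omega

def tau (l : List (Fin 3)) (hl : l.IsChain (· ≠ ·)) (c : Fin 3) : Equiv.Perm ℕ :=
  ⟨tauFun l c, tauFun l c, tau_tau hl c, tau_tau hl c⟩

lemma tau_apply (l : List (Fin 3)) (hl : l.IsChain (· ≠ ·)) (c : Fin 3) (i : ℕ) :
    tau l hl c i = tauFun l c i := rfl

lemma tau_sq (l : List (Fin 3)) (hl : l.IsChain (· ≠ ·)) (c : Fin 3) :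
    tau l hl c * tau l hl c = 1 := by
  ext1 x
  simp [tau_apply, tau_tau hl]

lemma tau_inv (l : List (Fin 3)) (hl : l.IsChain (· ≠ ·)) (c : Fin 3) :
    (tau l hl c)⁻¹ = tau l hl c := inv_eq_of_mul_eq_one_left (tau_sq l hl c)

def rho (l : List (Fin 3)) (hl : l.IsChain (· ≠ ·)) : FreeGroup Bool →* Equiv.Perm ℕ :=
  FreeGroup.lift (genImg (tau l hl))

lemma gen_form (l : List (Fin 3)) (hl : l.IsChain (· ≠ ·)) (s : FreeGroup Bool)
    (hs : s ∈ stdGenSet) : ∃ c d, rho l hl s = tau l hl c * tau l hl d := by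
  rcases hs with rfl | rfl | rfl | rfl
  · exact ⟨0, 1, by simp [rho, genImg]⟩
  · exact ⟨1, 0, by simp [rho, genImg, tau_inv]⟩
  · exact ⟨1, 2, by simp [rho, genImg]⟩
  · exact ⟨2, 1, by simp [rho, genImg, tau_inv]⟩

lemma pair_word (l : List (Fin 3)) (hl : l.IsChain (· ≠ ·)) (c d : Fin 3) (h : c ≠ d) :
    ∃ w : List (FreeGroup Bool), (∀ s ∈ w, s ∈ stdGenSet) ∧ w.length ≤ 2 ∧
      rho l hl w.prod = tau l hl c * tau l hl d := by
  have h3 : ∀ x, tau l hl 1 * (tau l hl 1 * x) = x := fun x => by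
    rw [← mul_assoc, tau_sq, one_mul]
  fin_cases c <;> fin_cases d
  · simp at h
  · exact ⟨[FreeGroup.of true], by simp [stdGenSet], by simp, by simp [rho, genImg]⟩
  · exact ⟨[FreeGroup.of true, FreeGroup.of false], by simp [stdGenSet], by simp,
      by simp [rho, genImg, mul_assoc, h3]⟩
  · exact ⟨[(FreeGroup.of true)⁻¹], by simp [stdGenSet], by simp, by simp [rho, genImg, tau_inv]⟩
  · simp at h
  · exact ⟨[FreeGroup.of false], by simp [stdGenSet], by simp, by simp [rho, genImg]⟩
  · exact ⟨[(FreeGroup.of false)⁻¹, (FreeGroup.of true)⁻¹], by simp [stdGenSet], by simp,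
      by simp [rho, genImg, mul_assoc, h3, tau_inv]⟩
  · exact ⟨[(FreeGroup.of false)⁻¹], by simp [stdGenSet], by simp, by simp [rho, genImg, tau_inv]⟩
  · simp at h

lemma exists_word (g : FreeGroup Bool) :
    ∃ w : List (FreeGroup Bool), (∀ s ∈ w, s ∈ stdGenSet) ∧ w.prod = g := by
  induction g using FreeGroup.induction_on with
  | C1 => exact ⟨[], by simp, by simp⟩
  | of i => exact ⟨[FreeGroup.of i], by cases i <;> simp [stdGenSet], by simp⟩
  | inv_of i _ => exact ⟨[(FreeGroup.of i)⁻¹], by cases i <;> simp [stdGenSet], by simp⟩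
  | mul x y hx hy =>
    obtain ⟨u, hu, rfl⟩ := hx
    obtain ⟨v, hv, rfl⟩ := hy
    refine ⟨u ++ v, ?_, by simp⟩
    intro s hs
    rcases List.mem_append.mp hs with h | h
    · exact hu s h
    · exact hv s h

lemma rho_le (l : List (Fin 3)) (hl : l.IsChain (· ≠ ·)) (g : FreeGroup Bool) (p : ℕ)
    (hp : p ≤ l.length) : rho l hl g p ≤ l.length := by
  obtain ⟨w, hw, rfl⟩ := exists_word g
  induction w with
  | nil => simpa using hp
  | cons s w ih =>
    obtain ⟨c, d, h⟩ := gen_form l hl s (hw s (by simp))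
    rw [List.prod_cons, map_mul, h]
    simp only [Equiv.Perm.mul_apply, tau_apply]
    exact tau_le _ _ _ (tau_le _ _ _ (ih fun s hs => hw s (by simp [hs])))

lemma rho_near (l : List (Fin 3)) (hl : l.IsChain (· ≠ ·)) (w : List (FreeGroup Bool))
    (hw : ∀ s ∈ w, s ∈ stdGenSet) (p : ℕ) :
    rho l hl w.prod p ≤ p + 2 * w.length ∧ p ≤ rho l hl w.prod p + 2 * w.length := by
  induction w with
  | nil => simp
  | cons s w ih =>
    obtain ⟨c, d, h⟩ := gen_form l hl s (hw s (by simp))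
    rw [List.prod_cons, map_mul, h]
    simp only [Equiv.Perm.mul_apply, tau_apply, List.length_cons]
    have h1 := ih fun s hs => hw s (by simp [hs])
    have h2 := tau_near l d (rho l hl w.prod p)
    have h3 := tau_near l c (tauFun l d (rho l hl w.prod p))
    omega

lemma rho_down (l : List (Fin 3)) (hl : l.IsChain (· ≠ ·)) (p : ℕ) (hp : p + 1 ≤ l.length) :
    ∃ w : List (FreeGroup Bool), (∀ s ∈ w, s ∈ stdGenSet) ∧ w.length ≤ 2 ∧
      rho l hl w.prod (p+1) = p := by
  obtain ⟨t, h1, h2⟩ := exists_third' l[p]? l[p+1]?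
  have hc : l[p]? = some l[p] := List.getElem?_eq_getElem (by omega)
  have hne : l[p] ≠ t := by rintro h; rw [hc, h] at h1; exact h1 rfl
  obtain ⟨w, hw, hlen, hr⟩ := pair_word l hl _ _ hne
  refine ⟨w, hw, hlen, ?_⟩
  rw [hr, Equiv.Perm.mul_apply, tau_apply, tau_apply]
  have : tauFun l t (p+1) = p + 1 := by
    simp [tauFun, h1.symm, h2.symm]
  rw [this, tau_down hl hc]

lemma word_moves (l : List (Fin 3)) (hl : l.IsChain (· ≠ ·)) (v : List (Fin 3)) (s : ℕ)
    (h : ∀ i < v.length, l[s+i]? = v[i]?) : (v.map (tau l hl)).prod (s + v.length) = s := by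
  induction v generalizing s with
  | nil => simp
  | cons c v ih =>
    have h1 := ih (s+1) (fun i hi => by
      have := h (i+1) (by simpa using hi)
      simpa [add_assoc, add_comm 1 i] using this)
    have h0 : l[s]? = some c := by simpa using h 0 (by simp)
    rw [List.map_cons, List.prod_cons, Equiv.Perm.mul_apply, List.length_cons,
      show s + (v.length + 1) = s + 1 + v.length by ring, h1, tau_apply, tau_down hl h0]

/-! ### The subgroup and the coordinate on its coset space -/

def stab (l : List (Fin 3)) (hl : l.IsChain (· ≠ ·)) : Subgroup (FreeGroup Bool) :=
  (MulAction.stabilizer (Equiv.Perm ℕ) l.length).comap (rho l hl)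

lemma mem_stab (l : List (Fin 3)) (hl : l.IsChain (· ≠ ·)) (g) :
    g ∈ stab l hl ↔ rho l hl g l.length = l.length := Iff.rfl

def coord (l : List (Fin 3)) (hl : l.IsChain (· ≠ ·)) : FreeGroup Bool ⧸ stab l hl → ℕ :=
  Quotient.lift (fun g => rho l hl g l.length) (by
    intro a b hab
    have h : a⁻¹ * b ∈ stab l hl := QuotientGroup.leftRel_apply.mp hab
    rw [mem_stab, map_mul, Equiv.Perm.mul_apply, map_inv, Equiv.Perm.inv_eq_iff_eq] at h
    exact h.symm)

lemma coord_mk (l : List (Fin 3)) (hl : l.IsChain (· ≠ ·)) (g : FreeGroup Bool) :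
    coord l hl (QuotientGroup.mk g) = rho l hl g l.length := rfl

lemma coord_smul (l : List (Fin 3)) (hl : l.IsChain (· ≠ ·)) (g : FreeGroup Bool) (x) :
    coord l hl (g • x) = rho l hl g (coord l hl x) := by
  induction x using QuotientGroup.induction_on with
  | H z =>
    rw [MulAction.Quotient.smul_mk, coord_mk, coord_mk, smul_eq_mul, map_mul]; rfl

lemma coord_inj (l : List (Fin 3)) (hl : l.IsChain (· ≠ ·)) :
    Function.Injective (coord l hl) := by
  intro x y h
  induction x using QuotientGroup.induction_on with
  | H a =>
    induction y using QuotientGroup.induction_on with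
    | H b =>
      rw [QuotientGroup.eq, mem_stab, map_mul, Equiv.Perm.mul_apply, map_inv,
        Equiv.Perm.inv_eq_iff_eq]
      exact h.symm

lemma coord_le (l : List (Fin 3)) (hl : l.IsChain (· ≠ ·)) (x) :
    coord l hl x ≤ l.length := by
  induction x using QuotientGroup.induction_on with
  | H a => exact rho_le l hl a _ le_rfl

lemma coord_finite (l : List (Fin 3)) (hl : l.IsChain (· ≠ ·)) :
    Finite (FreeGroup Bool ⧸ stab l hl) :=
  Finite.of_injective (fun x => (⟨coord l hl x, Nat.lt_succ_of_le (coord_le l hl x)⟩ :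
    Fin (l.length + 1))) (fun x y h => coord_inj l hl (by simpa using h))

/-- Going down `i` steps. -/
lemma coord_down (l : List (Fin 3)) (hl : l.IsChain (· ≠ ·)) (x) (i : ℕ) :
    ∃ w : List (FreeGroup Bool), (∀ s ∈ w, s ∈ stdGenSet) ∧ w.length ≤ 2 * i ∧
      coord l hl (w.prod • x) = coord l hl x - i := by
  induction i with
  | zero => exact ⟨[], by simp, by simp, by simp⟩
  | succ i ih =>
    obtain ⟨w, hw, hlen, h⟩ := ih
    rcases Nat.eq_zero_or_pos (coord l hl x - i) with h0 | h0
    · exact ⟨w, hw, by omega, by omega⟩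
    · obtain ⟨w', hw', hlen', h'⟩ := rho_down l hl (coord l hl x - (i+1))
        (by have := coord_le l hl x; omega)
      refine ⟨w' ++ w, ?_, by simp; omega, ?_⟩
      · intro s hs
        rcases List.mem_append.mp hs with h | h
        · exact hw' s h
        · exact hw s h
      · rw [List.prod_append, mul_smul, coord_smul, h,
          show coord l hl x - i = coord l hl x - (i+1) + 1 by omega, h']

lemma schreier_le {H : Subgroup (FreeGroup Bool)} (x : FreeGroup Bool ⧸ H)
    (w : List (FreeGroup Bool)) (hw : ∀ s ∈ w, s ∈ stdGenSet) :
    schreierDist stdGenSet H x (w.prod • x) ≤ w.length := by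
  apply csInf_le
  · refine ⟨0, ?_⟩
    rintro r ⟨m, rfl, -⟩
    positivity
  · exact ⟨w.length, rfl, fun i => w.get i, fun i => hw _ (List.get_mem _ _), by
      rw [List.ofFn_get]⟩

lemma exists_of_schreier_le {H : Subgroup (FreeGroup Bool)} (x y : FreeGroup Bool ⧸ H)
    (R : ℝ) (h : schreierDist stdGenSet H x y ≤ R) :
    ∃ w : List (FreeGroup Bool), (∀ s ∈ w, s ∈ stdGenSet) ∧ (w.length : ℝ) < R + 1 ∧
      w.prod • x = y := by
  obtain ⟨g, hg⟩ := MulAction.exists_smul_eq (FreeGroup Bool) x y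
  obtain ⟨w, hw, rfl⟩ := exists_word g
  unfold schreierDist at h
  obtain ⟨r, ⟨m, rfl, w', hw', e⟩, hr⟩ := exists_lt_of_csInf_lt
    (by exact ⟨(w.length : ℝ), w.length, rfl, fun i => w.get i, fun i => hw _ (List.get_mem _ _), by
      rw [List.ofFn_get, hg]⟩) (lt_of_le_of_lt h (lt_add_one R))
  refine ⟨List.ofFn w', ?_, by simpa using hr, e⟩
  intro s hs
  obtain ⟨i, rfl⟩ := (List.mem_ofFn' _ _).mp hs
  exact (hw' i : w' i ∈ stdGenSet)

/-! ### Property A for the path -/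

open scoped Classical in
/-- Number of `i < K` with `u i = z`. -/
noncomputable def cnt {X : Type} (u : ℕ → X) (K : ℕ) (z : X) : ℕ :=
  ((range K).filter (fun i => u i = z)).card

lemma cnt_sum {X : Type} [Fintype X] (u : ℕ → X) (K : ℕ) : ∑ z, cnt u K z = K := by
  classical
  have := Finset.card_eq_sum_card_fiberwise (s := range K) (t := (univ : Finset X)) (f := u)
    (by intro x _; simp)
  rw [card_range] at this
  refine Eq.trans ?_ this.symm
  unfold cnt
  congr!

noncomputable def vec {X : Type} [Finite X] (u : ℕ → X) (K : ℕ) : lp (fun _ : X => ℝ) 2 :=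
  ⟨fun z => √((cnt u K z : ℝ) / K), Memℓp.all _⟩

lemma vec_apply {X : Type} [Finite X] (u : ℕ → X) (K : ℕ) (z : X) :
    vec u K z = √((cnt u K z : ℝ) / K) := rfl

lemma vec_inner {X : Type} [Fintype X] (u v : ℕ → X) (K : ℕ) :
    ⟪vec u K, vec v K⟫ = ∑ z, √((cnt u K z : ℝ) / K) * √((cnt v K z : ℝ) / K) := by
  rw [lp.inner_eq_tsum, tsum_fintype]
  simp [vec_apply, mul_comm]

lemma vec_norm {X : Type} [Fintype X] (u : ℕ → X) (K : ℕ) (hK : 0 < K) : ‖vec u K‖ = 1 := by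
  have h : ‖vec u K‖ ^ 2 = 1 := by
    rw [← real_inner_self_eq_norm_sq, vec_inner]
    have : ∀ z, √((cnt u K z : ℝ) / K) * √((cnt u K z : ℝ) / K) = (cnt u K z : ℝ) / K :=
      fun z => Real.mul_self_sqrt (by positivity)
    simp only [this]
    rw [← Finset.sum_div, ← Nat.cast_sum, cnt_sum]
    field_simp
  have h0 := norm_nonneg (vec u K)
  nlinarith

lemma vec_close {X : Type} [Fintype X] (u v : ℕ → X) (K s : ℕ) (hK : 0 < K)
    (h : ∀ i, v (i + s) = u i) : |1 - ⟪vec u K, vec v K⟫| ≤ s / K := by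
  classical
  have hle : ⟪vec u K, vec v K⟫ ≤ 1 := by
    have := real_inner_le_norm (vec u K) (vec v K)
    rwa [vec_norm u K hK, vec_norm v K hK, mul_one] at this
  rw [abs_of_nonneg (by linarith)]
  have h1 : ∀ z, cnt u (K - s) z ≤ cnt u K z := fun z => by
    unfold cnt
    apply card_le_card
    intro i hi
    simp only [mem_filter, mem_range] at hi ⊢
    exact ⟨by omega, hi.2⟩
  have h2 : ∀ z, cnt u (K - s) z ≤ cnt v K z := fun z => by
    unfold cnt
    apply card_le_card_of_injOn (fun i => i + s)
    · intro i hi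
      simp only [coe_filter, mem_range, Set.mem_ofPred_eq] at hi ⊢
      exact ⟨by omega, by rw [h]; exact hi.2⟩
    · intro a _ b _ hab
      simpa using hab
  have hK' : (0:ℝ) < K := by exact_mod_cast hK
  have h3 : ((K - s : ℕ) : ℝ) / K ≤ ⟪vec u K, vec v K⟫ := by
    rw [vec_inner, ← cnt_sum u (K - s), Nat.cast_sum, Finset.sum_div]
    apply Finset.sum_le_sum
    intro z _
    have e : (cnt u (K - s) z : ℝ) / K =
        √((cnt u (K - s) z : ℝ) / K) * √((cnt u (K - s) z : ℝ) / K) :=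
      (Real.mul_self_sqrt (by positivity)).symm
    rw [e]
    have h1' : (cnt u (K - s) z : ℝ) ≤ cnt u K z := by exact_mod_cast h1 z
    have h2' : (cnt u (K - s) z : ℝ) ≤ cnt v K z := by exact_mod_cast h2 z
    gcongr
  have h4 : (K : ℝ) ≤ ((K - s : ℕ) : ℝ) + s := by exact_mod_cast (by omega : K ≤ K - s + s)
  have h5 : (1 : ℝ) ≤ ((K - s : ℕ) : ℝ) / K + s / K := by
    rw [← add_div, le_div_iff₀ hK']; linarith
  linarith

lemma propA (l : List (Fin 3)) (hl : l.IsChain (· ≠ ·)) (R ε : ℝ) (K : ℕ)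
    (hK : 0 < K) (hKR : 2 * (R + 1) ≤ ε * K) :
    ∃ φ : (FreeGroup Bool ⧸ stab l hl) → lp (fun _ : FreeGroup Bool ⧸ stab l hl => ℝ) 2,
      (∀ x, ‖φ x‖ = 1) ∧
      (∀ x y, schreierDist stdGenSet (stab l hl) x y ≤ R → |1 - ⟪φ x, φ y⟫| ≤ ε) ∧
      (∀ x z, φ x z ≠ 0 → schreierDist stdGenSet (stab l hl) x z ≤ 2 * K) := by
  have := coord_finite l hl
  have := Fintype.ofFinite (FreeGroup Bool ⧸ stab l hl)
  choose w hw hlen hc using coord_down l hl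
  have hK' : (0:ℝ) < K := by exact_mod_cast hK
  have key : ∀ x y s, coord l hl y = coord l hl x + s → (s : ℝ) ≤ 2 * (R + 1) →
      |1 - ⟪vec (fun i => (w x i).prod • x) K, vec (fun i => (w y i).prod • y) K⟫| ≤ ε := by
    intro x y s hs hsR
    refine (vec_close _ _ K s hK ?_).trans ?_
    · intro i
      apply coord_inj l hl
      rw [hc, hc]; omega
    · rw [div_le_iff₀ hK']; linarith
  refine ⟨fun x => vec (fun i => (w x i).prod • x) K, fun x => vec_norm _ K hK, ?_, ?_⟩
  · intro x y hxy
    obtain ⟨v, hv, hvl, rfl⟩ := exists_of_schreier_le x y R hxy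
    have hn := rho_near l hl v hv (coord l hl x)
    rw [← coord_smul] at hn
    rcases le_total (coord l hl x) (coord l hl (v.prod • x)) with h | h
    · refine key _ _ (coord l hl (v.prod • x) - coord l hl x) (by omega) ?_
      have : ((coord l hl (v.prod • x) - coord l hl x : ℕ) : ℝ) ≤ ((2 * v.length : ℕ) : ℝ) := by
        exact_mod_cast (by omega)
      push_cast at this ⊢
      linarith
    · rw [real_inner_comm]
      refine key _ _ (coord l hl x - coord l hl (v.prod • x)) (by omega) ?_
      have : ((coord l hl x - coord l hl (v.prod • x) : ℕ) : ℝ) ≤ ((2 * v.length : ℕ) : ℝ) := by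
        exact_mod_cast (by omega)
      push_cast at this ⊢
      linarith
  · intro x z hz
    rw [vec_apply] at hz
    have : cnt (fun i => (w x i).prod • x) K z ≠ 0 := by
      intro h0; apply hz; rw [h0]; simp
    obtain ⟨i, hi⟩ := Finset.card_ne_zero.mp this
    simp only [mem_filter, mem_range] at hi
    rw [← hi.2]
    refine (schreier_le x (w x i) (hw x i)).trans ?_
    have h1 := hlen x i
    have : (w x i).length ≤ 2 * K := by omega
    exact_mod_cast this

lemma moves (l : List (Fin 3)) (hl : l.IsChain (· ≠ ·)) (g : FreeGroup Bool) (v : List (Fin 3))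
    (hv : Represents g v) (hne : v ≠ []) (hin : v <:+: l) :
    ∃ x : FreeGroup Bool ⧸ stab l hl, g • x ≠ x := by
  obtain ⟨l₁, l₂, e⟩ := hin
  have hlen : l₁.length + v.length + l₂.length = l.length := by rw [← e]; simp [add_assoc]
  obtain ⟨w, -, -, h⟩ := coord_down l hl (QuotientGroup.mk 1) l₂.length
  have h1 : coord l hl (w.prod • (QuotientGroup.mk 1)) = l₁.length + v.length := by
    rw [h, coord_mk, map_one, Equiv.Perm.one_apply]; omega
  refine ⟨w.prod • (QuotientGroup.mk 1), fun hx => ?_⟩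
  have h2 := congrArg (coord l hl) hx
  rw [coord_smul, h1] at h2
  have h3 : rho l hl g = (v.map (tau l hl)).prod := hv _ _ (tau_sq l hl)
  rw [h3, word_moves l hl v l₁.length] at h2
  · have := List.length_pos_iff.mpr hne
    omega
  · intro i hi
    rw [← e, List.append_assoc, List.getElem?_append_right (by omega),
      List.getElem?_append_left (by omega)]
    congr 1; omega

end Helpers

/-- The free group `F₂` has a faithful sequence of finite-index
(not necessarily normal) subgroups whose Schreier coset spaces have property A uniformly. -/
theorem statement2 :
    ∃ H : ℕ → Subgroup (FreeGroup Bool),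
      (∀ j, (H j).FiniteIndex) ∧
      (∀ g : FreeGroup Bool, g ≠ 1 →
        ∃ J, ∀ j ≥ J, ∃ x : FreeGroup Bool ⧸ H j, g • x ≠ x) ∧
      (∀ R > (0:ℝ), ∀ ε > (0:ℝ), ∃ C > (0:ℝ), ∀ j : ℕ,
        ∃ φ : (FreeGroup Bool ⧸ H j) → lp (fun _ : FreeGroup Bool ⧸ H j => ℝ) 2,
          (∀ x, ‖φ x‖ = 1) ∧
          (∀ x y, schreierDist stdGenSet (H j) x y ≤ R → |1 - ⟪φ x, φ y⟫| ≤ ε) ∧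
          (∀ x z, φ x z ≠ 0 → schreierDist stdGenSet (H j) x z ≤ C)) := by
  classical
  obtain ⟨e, he⟩ := exists_surjective_nat (FreeGroup Bool)
  choose v hv hr hne using exists_color_word
  choose l hl hin using exists_coloring (fun k => v (e k)) (fun k => hv (e k))
  refine ⟨fun j => stab (l j) (hl j), ?_, ?_, ?_⟩
  · intro j
    have := coord_finite (l j) (hl j)
    exact Subgroup.finiteIndex_of_finite_quotient
  · intro g hg
    obtain ⟨k, rfl⟩ := he g
    exact ⟨k + 1, fun j hj => moves (l j) (hl j) (e k) _ (hr _) (hne _ hg) (hin j k (by omega))⟩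
  · intro R hR ε hε
    obtain ⟨K, hK⟩ := exists_nat_ge (2 * (R + 1) / ε)
    have hK0 : (0:ℝ) < K := lt_of_lt_of_le (by positivity) hK
    refine ⟨2 * K, by positivity, fun j => propA (l j) (hl j) R ε K (by exact_mod_cast hK0) ?_⟩
    rw [div_le_iff₀ hε] at hK
    linarith
end

section
/- Let A and B be nontrivial finitely generated residually finite groups, G = A ∗ B their free product, and S a finite symmetric generating set of G. Then there exists a sequence (N_j)_{j∈ℕ} of finite-index normal subgroups of G with ⋂_j N_j = {1} such that the Cheeger constants h_{S_j}(G/N_j) tend to 0 as j → ∞, where S_j is the image of S in the finite group G/N_j acting by left multiplication. In particular, G has a non-expander box space. -/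
theorem fi_comap {G H : Type*} [Group G] [Group H] (f : G →* H) (N : Subgroup H) [N.FiniteIndex] :
    (N.comap f).FiniteIndex := by
  constructor
  rw [Subgroup.index_comap]
  exact fun h => Subgroup.FiniteIndex.index_ne_zero (Subgroup.index_eq_zero_of_relIndex_eq_zero h)

open Monoid in
/-- truncated action -/
theorem coprodI_trunc {ι : Type*} [Finite ι] (M : ι → Type*) [∀ i, Group (M i)] [∀ i, Finite (M i)]
    (w : CoprodI.Word M) (hw : w ≠ CoprodI.Word.empty) :
    ∃ N : Subgroup (CoprodI M), N.Normal ∧ N.FiniteIndex ∧ w.prod ∉ N := by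
  classical
  set n := w.toList.length with hn
  let T := {u : CoprodI.Word M // u.toList.length ≤ n}
  have hTfin : Finite T := by
    have : Finite {l : List (Σ i, M i) // l.length ≤ n} := List.finite_length_le _ n
    refine Finite.of_injective (β := {l : List (Σ i, M i) // l.length ≤ n})
      (fun u => ⟨u.1.toList, u.2⟩) ?_
    intro u v huv
    apply Subtype.ext
    apply CoprodI.Word.ext
    exact congrArg Subtype.val huv
  have hlen : ∀ (i) (m : M i) (u : CoprodI.Word M),
      (CoprodI.Word.equivPair i u).tail.toList.length < n → (m • u).toList.length ≤ n := by
    intro i m u h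
    rw [CoprodI.Word.smul_def, CoprodI.Word.rcons]
    split_ifs
    · exact h.le
    · simpa [CoprodI.Word.cons] using h
  let act : ∀ i, M i → T → T := fun i m u =>
    if h : (CoprodI.Word.equivPair i u.1).tail.toList.length < n then ⟨m • u.1, hlen i m u.1 h⟩
    else u
  have act_one : ∀ i u, act i 1 u = u := by
    intro i u
    simp only [act]
    split_ifs
    · simp
    · rfl
  have act_mul : ∀ i (a b : M i) u, act i (a * b) u = act i a (act i b u) := by
    intro i a b u
    by_cases h : (CoprodI.Word.equivPair i u.1).tail.toList.length < n
    · have h' : (CoprodI.Word.equivPair i (b • u.1)).tail.toList.length < n := by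
        have h0 := congrArg CoprodI.Word.Pair.tail (CoprodI.Word.equivPair_smul_same b u.1)
        change (CoprodI.Word.equivPair i (b • u.1)).tail = _ at h0
        rw [h0]; exact h
      simp only [act, dif_pos h, dif_pos h', mul_smul]
    · simp only [act, dif_neg h]
  let f : ∀ i, M i →* Function.End T := fun i =>
    { toFun := fun m => act i m
      map_one' := by funext u; exact act_one i u
      map_mul' := fun a b => by funext u; exact act_mul i a b u }
  let Φ : CoprodI M →* Equiv.Perm T := CoprodI.lift (fun i => (f i).toHomPerm)
  have key : ∀ (u : CoprodI.Word M) (hu : u.toList.length ≤ n),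
      Φ u.prod ⟨CoprodI.Word.empty, by simp⟩ = ⟨u, hu⟩ := by
    intro u
    induction u using CoprodI.Word.consRecOn with
    | empty => intro hu; simp
    | cons i m u h1 h2 ih =>
      intro hu
      have hu' : u.toList.length < n := by simpa [CoprodI.Word.cons] using hu
      rw [CoprodI.Word.prod_cons, map_mul, Equiv.Perm.mul_apply, ih hu'.le]
      have : Φ (CoprodI.of m) ⟨u, hu'.le⟩ = act i m ⟨u, hu'.le⟩ := by
        simp only [Φ, CoprodI.lift_of]
        rfl
      rw [this]
      have h3 : (CoprodI.Word.equivPair i u).tail.toList.length < n := by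
        rw [CoprodI.Word.equivPair_eq_of_fstIdx_ne h1]; exact hu'
      simp only [act, dif_pos h3, CoprodI.Word.cons_eq_smul]
      simp [CoprodI.Word.of_smul_def, CoprodI.Word.smul_def]
  refine ⟨Φ.ker, inferInstance, inferInstance, ?_⟩
  intro hmem
  have := key w le_rfl
  rw [MonoidHom.mem_ker.mp hmem] at this
  exact hw (congrArg Subtype.val this).symm

open Monoid in
theorem coprodI_rf {ι : Type*} [Finite ι] (M : ι → Type*) [∀ i, Group (M i)]
    (hM : ∀ i, ∀ g : M i, g ≠ 1 → ∃ N : Subgroup (M i), N.Normal ∧ N.FiniteIndex ∧ g ∉ N)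
    (g : CoprodI M) (hg : g ≠ 1) :
    ∃ N : Subgroup (CoprodI M), N.Normal ∧ N.FiniteIndex ∧ g ∉ N := by
  classical
  obtain ⟨w, rfl⟩ : ∃ w : CoprodI.Word M, w.prod = g :=
    ⟨CoprodI.Word.equiv g, CoprodI.Word.equiv.symm_apply_apply g⟩
  have hM' : ∀ i, ∀ g : M i, ∃ N : Subgroup (M i), N.Normal ∧ N.FiniteIndex ∧ (g ≠ 1 → g ∉ N) := by
    intro i g
    by_cases h : g = 1
    · exact ⟨⊤, inferInstance, inferInstance, fun h' => absurd h h'⟩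
    · obtain ⟨N, a, b, c⟩ := hM i g h
      exact ⟨N, a, b, fun _ => c⟩
  choose K hK1 hK2 hK3 using hM'
  let L : ∀ i, Subgroup (M i) := fun i =>
    ⨅ l : {l : Σ i, M i // l ∈ w.toList ∧ l.1 = i}, K i (l.2.2 ▸ l.1.2)
  have hfin : ∀ i, Finite {l : Σ i, M i // l ∈ w.toList ∧ l.1 = i} := fun i =>
    ((List.finite_toSet w.toList).subset (fun l hl => hl.1) :
      {l : Σ i, M i | l ∈ w.toList ∧ l.1 = i}.Finite)
  have hL1 : ∀ i, (L i).Normal := fun i => Subgroup.normal_iInf_normal (fun l => hK1 _ _)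
  have hL2 : ∀ i, (L i).FiniteIndex := fun i => by
    have := hfin i
    exact Subgroup.finiteIndex_iInf (fun l => hK2 _ _)
  have hL3 : ∀ l ∈ w.toList, l.2 ∉ L l.1 := by
    intro l hl hmem
    have := (Subgroup.mem_iInf.mp hmem) ⟨l, hl, rfl⟩
    exact hK3 _ _ (w.ne_one l hl) this
  have hQfin : ∀ i, Finite (M i ⧸ L i) := fun i => inferInstance
  let w' : CoprodI.Word (fun i => M i ⧸ L i) :=
    { toList := w.toList.map (fun l => ⟨l.1, (l.2 : M l.1 ⧸ L l.1)⟩)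
      ne_one := by
        intro l hl
        obtain ⟨l', hl', rfl⟩ := List.mem_map.mp hl
        intro h
        exact hL3 l' hl' ((QuotientGroup.eq_one_iff _).mp h)
      chain_ne := by
        rw [List.isChain_map]
        exact w.chain_ne }
  have hw' : w' ≠ CoprodI.Word.empty := by
    intro h
    have h2 : w'.toList = [] := by rw [h]; rfl
    have h3 : w.toList = [] := by simpa [w'] using h2
    apply hg
    simp [CoprodI.Word.prod, h3]
  obtain ⟨N, h1, h2, h3⟩ := coprodI_trunc _ w' hw'
  let Ψ : CoprodI M →* CoprodI (fun i => M i ⧸ L i) :=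
    CoprodI.lift (fun i => (CoprodI.of).comp (QuotientGroup.mk' (L i)))
  have hΨ : Ψ w.prod = w'.prod := by
    simp only [CoprodI.Word.prod, w', map_list_prod, List.map_map]
    rfl
  refine ⟨N.comap Ψ, inferInstance, fi_comap _ _, ?_⟩
  rw [Subgroup.mem_comap, hΨ]
  exact h3

open Monoid in
theorem coprod_rf_aux {A B : Type*} [Group A] [Group B]
    (hA : ∀ g : A, g ≠ 1 → ∃ N : Subgroup A, N.Normal ∧ N.FiniteIndex ∧ g ∉ N)
    (hB : ∀ g : B, g ≠ 1 → ∃ N : Subgroup B, N.Normal ∧ N.FiniteIndex ∧ g ∉ N)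
    (M : Bool → Type*) [∀ b, Group (M b)] (eA : A ≃* M false) (eB : B ≃* M true)
    (g : Coprod A B) (hg : g ≠ 1) :
    ∃ N : Subgroup (Coprod A B), N.Normal ∧ N.FiniteIndex ∧ g ∉ N := by
  let F : Coprod A B →* CoprodI M := Coprod.lift
    ((CoprodI.of (M := M) (i := false)).comp eA.toMonoidHom)
    ((CoprodI.of (M := M) (i := true)).comp eB.toMonoidHom)
  let R : CoprodI M →* Coprod A B := CoprodI.lift (fun b =>
    match b with
    | false => (Coprod.inl).comp eA.symm.toMonoidHom
    | true => (Coprod.inr).comp eB.symm.toMonoidHom)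
  have hRF : R.comp F = MonoidHom.id _ := by
    apply Coprod.hom_ext
    · ext a; simp [R, F]
    · ext a; simp [R, F]
  have hFg : F g ≠ 1 := by
    intro h
    apply hg
    have := DFunLike.congr_fun hRF g
    simpa [h] using this.symm
  have hM : ∀ i, ∀ g : M i, g ≠ 1 → ∃ N : Subgroup (M i), N.Normal ∧ N.FiniteIndex ∧ g ∉ N := by
    intro i
    cases i
    · intro g hg
      obtain ⟨N, h1, h2, h3⟩ := hA (eA.symm g) (fun h => hg ((MulEquiv.map_eq_one_iff _).mp h))
      exact ⟨N.comap eA.symm.toMonoidHom, inferInstance, fi_comap _ _, h3⟩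
    · intro g hg
      obtain ⟨N, h1, h2, h3⟩ := hB (eB.symm g) (fun h => hg ((MulEquiv.map_eq_one_iff _).mp h))
      exact ⟨N.comap eB.symm.toMonoidHom, inferInstance, fi_comap _ _, h3⟩
  obtain ⟨N, h1, h2, h3⟩ := coprodI_rf M hM (F g) hFg
  exact ⟨N.comap F, inferInstance, fi_comap _ _, h3⟩

section
universe u v

open Monoid in
theorem coprod_rf {A : Type u} {B : Type v} [Group A] [Group B]
    (hA : ∀ g : A, g ≠ 1 → ∃ N : Subgroup A, N.Normal ∧ N.FiniteIndex ∧ g ∉ N)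
    (hB : ∀ g : B, g ≠ 1 → ∃ N : Subgroup B, N.Normal ∧ N.FiniteIndex ∧ g ∉ N)
    (g : Coprod A B) (hg : g ≠ 1) :
    ∃ N : Subgroup (Coprod A B), N.Normal ∧ N.FiniteIndex ∧ g ∉ N := by
  exact @coprod_rf_aux A B _ _ hA hB
    (fun b => Bool.rec (ULift.{v} A) (ULift.{u} B) b)
    (fun b => Bool.rec (motive := fun b => Group
      ((fun b => Bool.rec (ULift.{v} A) (ULift.{u} B) b : Bool → Type (max u v)) b))
      (inferInstanceAs (Group (ULift.{v} A))) (inferInstanceAs (Group (ULift.{u} B))) b)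
    (MulEquiv.ulift.{u, v} (α := A)).symm (MulEquiv.ulift.{v, u} (α := B)).symm g hg

end

theorem ncard_preimage_const {X Y : Type*} [Finite X] [Finite Y] (f : X → Y) (c : ℕ)
    (hc : ∀ y, (f ⁻¹' {y}).ncard = c) (T : Set Y) : (f ⁻¹' T).ncard = c * T.ncard := by
  induction T, T.toFinite using Set.Finite.induction_on with
  | empty => simp
  | @insert a s ha hs ih =>
    have : f ⁻¹' (insert a s) = f ⁻¹' {a} ∪ f ⁻¹' s := by
      ext x; simp
    rw [this, Set.ncard_union_eq, hc, ih, Set.ncard_insert_of_notMem ha]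
    · ring
    · rw [Set.disjoint_left]
      intro x hx hx'
      simp only [Set.mem_preimage, Set.mem_singleton_iff] at hx hx'
      exact ha (hx ▸ hx')

theorem cheegerConst_nonneg {G : Type*} [Group G] (S : Finset G)
    (V : Type*) [MulAction G V] : 0 ≤ cheegerConst S V := by
  apply Real.sInf_nonneg
  rintro r ⟨A, -, -, rfl⟩
  positivity

theorem cheeger_le {G : Type*} [Group G] (S : Finset G) {V : Type*} [Finite V]
    (φ : G →* Equiv.Perm V) (v₀ : V) (htr : ∀ v, ∃ g, φ g v₀ = v)
    (N : Subgroup G) [N.FiniteIndex] (hN : N ≤ φ.ker) (A : Set V) (hA : A.Nonempty)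
    (hA2 : 2 * A.ncard ≤ Nat.card V) (D : ℕ)
    (hD : ∀ s ∈ S, {v | v ∈ A ∧ φ s v ∉ A}.ncard ≤ D) :
    cheegerConst S (G ⧸ N) ≤ (S.card * D : ℝ) / A.ncard := by
  classical
  let f : G ⧸ N → V := fun x => Quotient.liftOn' x (fun g => φ g v₀) (by
    intro a b hab
    have h := hN (QuotientGroup.leftRel_apply.mp hab)
    rw [MonoidHom.mem_ker, map_mul, map_inv, inv_mul_eq_one] at h
    exact congrArg (fun e : Equiv.Perm V => e v₀) h)
  have hf : ∀ (g : G) (x : G ⧸ N), f (g • x) = φ g (f x) := by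
    intro g x
    induction x using QuotientGroup.induction_on with
    | H z =>
      change φ (g * z) v₀ = φ g (φ z v₀)
      simp
  have hfib : ∀ v, (f ⁻¹' {v}).ncard = (f ⁻¹' {v₀}).ncard := by
    intro v
    obtain ⟨g, rfl⟩ := htr v
    have : f ⁻¹' {φ g v₀} = (fun x => g • x) '' (f ⁻¹' {v₀}) := by
      ext x
      constructor
      · intro hx
        refine ⟨g⁻¹ • x, ?_, by simp⟩
        have hx' : f x = φ g v₀ := hx
        simp [hf, hx']
      · rintro ⟨y, hy, rfl⟩
        have hy' : f y = v₀ := hy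
        simp [hf, hy']
    rw [this, Set.ncard_image_of_injective _ (MulAction.injective g)]
  set c := (f ⁻¹' {v₀}).ncard with hc
  have hcard := ncard_preimage_const f c hfib
  have h1 : f ((1 : G) : G ⧸ N) = v₀ := by
    change φ 1 v₀ = v₀
    simp
  have hcpos : 0 < c := (Set.ncard_pos (Set.toFinite _)).mpr ⟨_, h1⟩
  have hVcard : Nat.card (G ⧸ N) = c * Nat.card V := by
    have := hcard Set.univ
    rwa [Set.preimage_univ, Set.ncard_univ, Set.ncard_univ] at this
  have hApos : 0 < A.ncard := (Set.ncard_pos (Set.toFinite _)).mpr hA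
  have hbd : Set.ncard {p : (G ⧸ N) × G | p.1 ∈ f ⁻¹' A ∧ p.2 ∈ (S : Set G) ∧
      p.2 • p.1 ∉ f ⁻¹' A} ≤ S.card * (c * D) := by
    have hsub : {p : (G ⧸ N) × G | p.1 ∈ f ⁻¹' A ∧ p.2 ∈ (S : Set G) ∧ p.2 • p.1 ∉ f ⁻¹' A} ⊆
        ⋃ s ∈ S, (fun x => (x, s)) '' (f ⁻¹' {v | v ∈ A ∧ φ s v ∉ A}) := by
      rintro ⟨x, s⟩ ⟨hx, hs, hsx⟩
      simp only [Set.mem_iUnion]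
      refine ⟨s, hs, x, ⟨hx, ?_⟩, rfl⟩
      rw [← hf]
      exact hsx
    have hfin : (⋃ s ∈ S, (fun x => (x, s)) '' (f ⁻¹' {v | v ∈ A ∧ φ s v ∉ A})).Finite :=
      S.finite_toSet.biUnion (fun s _ => (Set.toFinite _))
    refine (Set.ncard_le_ncard hsub hfin).trans ?_
    refine (Finset.set_ncard_biUnion_le S _).trans ?_
    rw [← smul_eq_mul]
    apply Finset.sum_le_card_nsmul
    intro s hs
    rw [Set.ncard_image_of_injective _ (Prod.mk_left_injective s), hcard]
    exact Nat.mul_le_mul_left _ (hD s hs)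
  have hmem : (Set.ncard {p : (G ⧸ N) × G | p.1 ∈ f ⁻¹' A ∧ p.2 ∈ (S : Set G) ∧
      p.2 • p.1 ∉ f ⁻¹' A} : ℝ) / (f ⁻¹' A).ncard ∈ {r : ℝ | ∃ A : Set (G ⧸ N), A.Nonempty ∧
        2 * A.ncard ≤ Nat.card (G ⧸ N) ∧
    r = (Set.ncard {p : (G ⧸ N) × G | p.1 ∈ A ∧ p.2 ∈ (S : Set G) ∧ p.2 • p.1 ∉ A} : ℝ)
      / A.ncard} := by
    refine ⟨f ⁻¹' A, ?_, ?_, rfl⟩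
    · rw [← Set.ncard_pos, hcard]
      positivity
    · rw [hcard, hVcard]
      nlinarith
  refine (csInf_le ⟨0, ?_⟩ hmem).trans ?_
  · rintro r ⟨A, -, -, rfl⟩
    positivity
  · rw [hcard]
    have hbd' := (Nat.cast_le (α := ℝ)).mpr hbd
    push_cast at hbd' ⊢
    rw [div_le_div_iff₀ (by positivity) (by positivity)]
    have hA0 : (0 : ℝ) ≤ A.ncard := by positivity
    calc _ ≤ ((S.card : ℝ) * (c * D)) * A.ncard := mul_le_mul_of_nonneg_right hbd' hA0
      _ = _ := by ring

theorem zmod_ncard (n : ℕ) (T : Set ℕ) (hT : T ⊆ Set.Iio n) :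
    {k : ZMod n | k.val ∈ T}.ncard ≤ T.ncard ∧ T.ncard ≤ {k : ZMod n | k.val ∈ T}.ncard := by
  rcases Nat.eq_zero_or_pos n with rfl | hn
  · have : T = ∅ := by
      ext x; constructor
      · intro hx; simpa using hT hx
      · simp
    subst this; simp
  have : NeZero n := ⟨hn.ne'⟩
  have hfin : T.Finite := (Set.finite_Iio n).subset hT
  constructor
  · exact Set.ncard_le_ncard_of_injOn ZMod.val (fun k hk => hk)
      (fun a _ b _ h => ZMod.val_injective n h) hfin
  · refine Set.ncard_le_ncard_of_injOn (fun k : ℕ => (k : ZMod n)) ?_ ?_ (Set.toFinite _)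
    · intro k hk
      simp only [Set.mem_ofPred_eq, ZMod.val_natCast_of_lt (hT hk)]
      exact hk
    · intro a ha b hb h
      have := congrArg ZMod.val h
      simpa [ZMod.val_natCast_of_lt (hT ha), ZMod.val_natCast_of_lt (hT hb)] using this

open Monoid in
theorem exists_perm {A B P Q : Type*} [Group A] [Group B] [Group P] [Group Q]
    [Nontrivial P] [Nontrivial Q]
    (πA : A →* P) (πB : B →* Q) (hπA : Function.Surjective πA) (hπB : Function.Surjective πB) :
    ∃ Φ : ∀ m : ℕ, Coprod A B →* Equiv.Perm ((P × Q) × ZMod m),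
      (∀ m v, ∃ g, Φ m g ((1, 1), 0) = v) ∧
      ∀ g, ∃ C : ℕ, ∀ m v, ∃ c : ℤ, |c| ≤ C ∧ (Φ m g v).2 = v.2 + c := by
  classical
  let β : P → Q → ℤ := fun p q => if p ≠ 1 ∧ q ≠ 1 then 1 else 0
  have hβ : ∀ p q, 0 ≤ β p q ∧ β p q ≤ 1 := by
    intro p q; simp only [β]; split_ifs <;> simp
  let fA : ∀ m : ℕ, P →* Function.End ((P × Q) × ZMod m) := fun m =>
    { toFun := fun a v => ((a * v.1.1, v.1.2), v.2)
      map_one' := by funext v; simp; rfl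
      map_mul' := fun a b => by
        funext v
        change _ = ((a * (b * v.1.1), v.1.2), v.2)
        rw [mul_assoc] }
  let fB : ∀ m : ℕ, Q →* Function.End ((P × Q) × ZMod m) := fun m =>
    { toFun := fun b v => ((v.1.1, b * v.1.2),
        v.2 + ((β v.1.1 (b * v.1.2) - β v.1.1 v.1.2 : ℤ) : ZMod m))
      map_one' := by funext v; simp; rfl
      map_mul' := fun a b => by
        funext v
        change _ = ((v.1.1, a * (b * v.1.2)),
          v.2 + ((β v.1.1 (b * v.1.2) - β v.1.1 v.1.2 : ℤ) : ZMod m) +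
            ((β v.1.1 (a * (b * v.1.2)) - β v.1.1 (b * v.1.2) : ℤ) : ZMod m))
        rw [mul_assoc]
        push_cast
        congr 1
        ring }
  let Φ : ∀ m : ℕ, Coprod A B →* Equiv.Perm ((P × Q) × ZMod m) := fun m =>
    Coprod.lift ((fA m).toHomPerm.comp πA) ((fB m).toHomPerm.comp πB)
  have hΦA : ∀ m a v, Φ m (Coprod.inl a) v = ((πA a * v.1.1, v.1.2), v.2) := fun m a v => rfl
  have hΦB : ∀ m b v, Φ m (Coprod.inr b) v = ((v.1.1, πB b * v.1.2),
        v.2 + ((β v.1.1 (πB b * v.1.2) - β v.1.1 v.1.2 : ℤ) : ZMod m)) := fun m b v => rfl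
  refine ⟨Φ, ?_, ?_⟩
  · intro m
    obtain ⟨p₀, hp₀⟩ := exists_ne (1 : P)
    obtain ⟨q₀, hq₀⟩ := exists_ne (1 : Q)
    obtain ⟨a₀, rfl⟩ := hπA p₀
    obtain ⟨b₀, rfl⟩ := hπB q₀
    let t : Coprod A B := Coprod.inl a₀⁻¹ * Coprod.inr b₀⁻¹ * Coprod.inl a₀ * Coprod.inr b₀
    have ht : ∀ k : ZMod m, Φ m t ((1, 1), k) = ((1, 1), k - 1) := by
      intro k
      simp only [t, map_mul, Equiv.Perm.mul_apply, hΦA, hΦB]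
      simp [β, hp₀, hq₀, sub_eq_add_neg]
    have htn : ∀ (n : ℕ) (k : ZMod m), Φ m (t ^ n) ((1, 1), k) = ((1, 1), k - n) := by
      intro n
      induction n with
      | zero => intro k; simp
      | succ n ih =>
        intro k
        rw [pow_succ, map_mul, Equiv.Perm.mul_apply, ht, ih]
        push_cast
        congr 1; ring
    have hz : ∀ k : ZMod m, ∃ g, Φ m g ((1, 1), 0) = ((1, 1), k) := by
      intro k
      obtain ⟨z, rfl⟩ := ZMod.intCast_surjective k
      obtain ⟨n, rfl | rfl⟩ := z.eq_nat_or_neg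
      · refine ⟨(t ^ n)⁻¹, ?_⟩
        rw [map_inv, Equiv.Perm.inv_eq_iff_eq, htn]
        simp
      · refine ⟨t ^ n, ?_⟩
        rw [htn]; simp
    rintro ⟨⟨p, q⟩, k⟩
    obtain ⟨a, rfl⟩ := hπA p
    obtain ⟨b, rfl⟩ := hπB q
    obtain ⟨g, hg⟩ := hz k
    refine ⟨Coprod.inl a * Coprod.inr b * g, ?_⟩
    simp only [map_mul, Equiv.Perm.mul_apply, hΦA, hΦB, hg]
    simp [β]
  · intro g
    induction g using Coprod.induction_on with
    | inl a => exact ⟨0, fun m v => ⟨0, by simp, by simp [hΦA]⟩⟩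
    | inr b =>
      refine ⟨1, fun m v => ⟨_, ?_, by rw [hΦB]⟩⟩
      have h1 := hβ v.1.1 (πB b * v.1.2)
      have h2 := hβ v.1.1 v.1.2
      rw [abs_le]
      push_cast
      constructor <;> linarith
    | mul x y hx hy =>
      obtain ⟨C, hC⟩ := hx
      obtain ⟨D, hD⟩ := hy
      refine ⟨C + D, fun m v => ?_⟩
      obtain ⟨d, hd, hd'⟩ := hD m v
      obtain ⟨c, hc, hc'⟩ := hC m (Φ m y v)
      refine ⟨d + c, ?_, ?_⟩
      · refine (abs_add_le _ _).trans ?_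
        push_cast; linarith
      · rw [map_mul, Equiv.Perm.mul_apply, hc', hd']
        push_cast; ring

open Monoid in
theorem exists_small {A B P Q : Type*} [Group A] [Group B] [Group P] [Group Q]
    [Nontrivial P] [Nontrivial Q] [Finite P] [Finite Q]
    (πA : A →* P) (πB : B →* Q) (hπA : Function.Surjective πA) (hπB : Function.Surjective πB)
    (S : Finset (Coprod A B)) :
    ∃ C : ℕ, ∀ n : ℕ, 0 < n → ∃ M : Subgroup (Coprod A B), M.Normal ∧ M.FiniteIndex ∧
      ∀ N : Subgroup (Coprod A B), N.FiniteIndex → N ≤ M →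
        cheegerConst S (Coprod A B ⧸ N) ≤ (C : ℝ) / n := by
  classical
  obtain ⟨Φ, htr, hsh⟩ := exists_perm πA πB hπA hπB
  choose C₀ hC₀ using hsh
  let C := ∑ s ∈ S, C₀ s
  have hC : ∀ s ∈ S, C₀ s ≤ C := fun s hs => Finset.single_le_sum (fun _ _ => Nat.zero_le _) hs
  refine ⟨S.card * (2 * C), fun n hn => ?_⟩
  have : NeZero (2 * n) := ⟨by omega⟩
  refine ⟨(Φ (2 * n)).ker, inferInstance, inferInstance, fun N hN hle => ?_⟩
  let X : Set ((P × Q) × ZMod (2 * n)) := Set.univ ×ˢ {k | k.val ∈ Set.Iio n}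
  have hI : {k : ZMod (2 * n) | k.val ∈ Set.Iio n}.ncard = n := by
    have := zmod_ncard (2 * n) (Set.Iio n) (Set.Iio_subset_Iio (by omega))
    rw [show (Set.Iio n).ncard = n by
      rw [← Finset.coe_Iio, Set.ncard_coe_finset]; simp] at this
    omega
  have hX : X.ncard = Nat.card (P × Q) * n := by
    rw [Set.ncard_prod, hI, Set.ncard_univ]
  have hPQ : 0 < Nat.card (P × Q) := Nat.card_pos
  have hJ : ({k : ZMod (2 * n) | k.val ∈ Set.Iio n ∩ (Set.Iio C ∪ Set.Ico (n - C) n)}).ncard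
      ≤ 2 * C := by
    refine (zmod_ncard (2 * n) _ (Set.inter_subset_left.trans
      (Set.Iio_subset_Iio (by omega)))).1.trans ?_
    refine (Set.ncard_le_ncard Set.inter_subset_right (Set.toFinite _)).trans ?_
    refine (Set.ncard_union_le _ _).trans ?_
    rw [← Finset.coe_Iio, ← Finset.coe_Ico, Set.ncard_coe_finset, Set.ncard_coe_finset]
    simp
    omega
  have := cheeger_le S (Φ (2 * n)) ((1, 1), 0) (htr _) N hle X ?_ ?_
    (Nat.card (P × Q) * (2 * C)) ?_
  · refine this.trans (le_of_eq ?_)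
    rw [hX]
    push_cast
    field_simp
  · rw [← Set.ncard_pos, hX]; positivity
  · rw [hX, Nat.card_prod (P × Q), Nat.card_zmod]
    exact le_of_eq (by ring)
  · intro s hs
    have hsub : {v | v ∈ X ∧ Φ (2 * n) s v ∉ X} ⊆ (Set.univ : Set (P × Q)) ×ˢ
        {k : ZMod (2 * n) | k.val ∈ Set.Iio n ∩ (Set.Iio C ∪ Set.Ico (n - C) n)} := by
      rintro v ⟨hv, hv'⟩
      have hv1 : v.2.val < n := hv.2
      refine ⟨Set.mem_univ _, hv1, ?_⟩
      by_contra hcon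
      apply hv'
      refine ⟨Set.mem_univ _, ?_⟩
      obtain ⟨c, hc, hc'⟩ := hC₀ s (2 * n) v
      have hcC : |c| ≤ C := hc.trans (by exact_mod_cast hC s hs)
      rw [abs_le] at hcC
      simp only [Set.mem_union, Set.mem_Iio, Set.mem_Ico, not_or, not_and, not_lt] at hcon
      have h1 := hcon.1
      have h2 : v.2.val < n - C := by
        by_contra h
        have := hcon.2 (not_lt.mp h)
        omega
      obtain ⟨z, hz⟩ : ∃ z : ℕ, (z : ℤ) = v.2.val + c := ⟨(v.2.val + c).toNat, by omega⟩
      have hz2 : z < n := by omega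
      change (Φ (2 * n) s v).2.val < n
      have : (Φ (2 * n) s v).2 = (z : ZMod (2 * n)) := by
        rw [hc', ← Int.cast_natCast (R := ZMod (2 * n)) z, hz]
        push_cast
        rw [ZMod.natCast_zmod_val]
      rw [this, ZMod.val_natCast_of_lt (by omega)]
      exact hz2
    refine (Set.ncard_le_ncard hsub (Set.toFinite _)).trans ?_
    rw [Set.ncard_prod, Set.ncard_univ]
    exact Nat.mul_le_mul_left _ hJ

theorem countable_of_closure {G : Type*} [Group G] (S : Finset G)
    (h : Subgroup.closure (S : Set G) = ⊤) : Countable G := by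
  have hs : Function.Surjective (FreeGroup.lift (fun s : S => (s : G))) := by
    rw [← MonoidHom.range_eq_top, FreeGroup.range_lift_eq_closure]
    simpa using h
  have : Countable (FreeGroup S) := Quot.mk_surjective.countable
  exact hs.countable

/-- A free product of nontrivial finitely generated residually finite
groups has a box space which is not an expander: there is a sequence of finite-index
normal subgroups with trivial intersection whose Cheeger constants tend to `0`. -/
theorem statement3 {A B : Type*} [Group A] [Group B] [Nontrivial A] [Nontrivial B]
    (hAfg : Group.FG A) (hBfg : Group.FG B)
    (hArf : ResiduallyFinite A) (hBrf : ResiduallyFinite B)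
    (S : Finset (Monoid.Coprod A B)) (hSsym : ∀ s ∈ S, s⁻¹ ∈ S)
    (hSgen : Subgroup.closure (S : Set (Monoid.Coprod A B)) = ⊤) :
    ∃ N : ℕ → Subgroup (Monoid.Coprod A B),
      (∀ j, (N j).Normal) ∧ (∀ j, (N j).FiniteIndex) ∧ (⨅ j, N j) = ⊥ ∧
      Filter.Tendsto (fun j => cheegerConst S (Monoid.Coprod A B ⧸ N j))
        Filter.atTop (nhds 0) := by
  classical
  have hRF := coprod_rf hArf hBrf
  have hcount := countable_of_closure S hSgen
  obtain ⟨a, ha⟩ := exists_ne (1 : A)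
  obtain ⟨b, hb⟩ := exists_ne (1 : B)
  obtain ⟨KA, hA1, hA2, hA3⟩ := hArf a ha
  obtain ⟨KB, hB1, hB2, hB3⟩ := hBrf b hb
  have hntA : Nontrivial (A ⧸ KA) :=
    ⟨⟨(a : A ⧸ KA), 1, fun h => hA3 ((QuotientGroup.eq_one_iff a).mp h)⟩⟩
  have hntB : Nontrivial (B ⧸ KB) :=
    ⟨⟨(b : B ⧸ KB), 1, fun h => hB3 ((QuotientGroup.eq_one_iff b).mp h)⟩⟩
  obtain ⟨C, hC⟩ := exists_small (QuotientGroup.mk' KA) (QuotientGroup.mk' KB)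
    (QuotientGroup.mk'_surjective KA) (QuotientGroup.mk'_surjective KB) S
  choose M hM1 hM2 hM3 using fun j : ℕ => hC (j + 1) (Nat.succ_pos j)
  have hRF' : ∀ g : Monoid.Coprod A B, ∃ N : Subgroup (Monoid.Coprod A B),
      N.Normal ∧ N.FiniteIndex ∧ (g ≠ 1 → g ∉ N) := by
    intro g
    by_cases h : g = 1
    · exact ⟨⊤, inferInstance, inferInstance, fun h' => absurd h h'⟩
    · obtain ⟨N, h1, h2, h3⟩ := hRF g h
      exact ⟨N, h1, h2, fun _ => h3⟩
  choose K hK1 hK2 hK3 using hRF'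
  obtain ⟨e, he⟩ := exists_surjective_nat (Monoid.Coprod A B)
  refine ⟨fun j => K (e j) ⊓ M j, fun j => ?_, fun j => ?_, ?_, ?_⟩
  · have := hK1 (e j)
    have := hM1 j
    infer_instance
  · have := hK2 (e j)
    have := hM2 j
    infer_instance
  · rw [eq_bot_iff]
    intro g hg
    rw [Subgroup.mem_bot]
    by_contra hne
    obtain ⟨j, rfl⟩ := he g
    exact hK3 _ hne ((Subgroup.mem_iInf.mp hg j).1)
  · refine squeeze_zero (fun j => cheegerConst_nonneg _ _) (fun j => ?_)
      ((tendsto_const_div_atTop_nhds_zero_nat (C : ℝ)).comp (Filter.tendsto_add_atTop_nat 1))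
    have := hK2 (e j)
    have := hM2 j
    exact hM3 j _ inferInstance inf_le_right
end

section
/- Let A and B be residually finite groups with faithful sequences of finite quotients α_n : A ↠ Ā_n and β_n : B ↠ B̄_n (faithful: for every nontrivial element of A, resp. B, its image under α_n, resp. β_n, is nontrivial for all but finitely many n). Let G = A ∗ B, let G_n = Ā_n ∗ B̄_n with induced surjection π_n : G → G_n, and let D_n = ker(G_n → Ā_n × B̄_n) be the kernel of the canonical homomorphism. For each n let (M_{n,k})_{k∈ℕ} be subgroups of D_n such that each M_{n,k} has finite index in D_n and is characteristic in D_n, ⋂_k M_{n,k} = {1}, and for every k, M_{n,k+1} is a proper subgroup of M_{n,k} which is characteristic in M_{n,k}. Then each M_{n,k} is a finite-index normal subgroup of G_n, each quotient G_n/M_{n,k} is finite, and the family of quotients of G given by the composites G → G_n → G_n/M_{n,k} is faithful in the following sense: for every g ∈ G with g ≠ 1 there exists N such that for all n ≥ N and all k ≥ n the image of g in G_n/M_{n,k} is nontrivial. -/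
/-- The kernel of the canonical map `A ∗ B → A × B` (the "commutator" free subgroup). -/
noncomputable def coprodKer (A B : Type*) [Group A] [Group B] :
    Subgroup (Monoid.Coprod A B) :=
  (Monoid.Coprod.toProd : Monoid.Coprod A B →* A × B).ker

namespace S11
open Monoid Monoid.Coprod

universe u v

section Core
variable {A : Type u} {B : Type v} [Group A] [Group B]

/-- Steps in the Schreier graph of `M` which do not cross the base edge. -/
inductive Step (M : Subgroup (Coprod A B)) : Coprod A B → Coprod A B → Prop
  | b (y : Coprod A B) (b : B) : Step M y (inr b * y)
  | a (y : Coprod A B) (a : A) (h1 : y ∉ M) (h2 : inl a * y ∉ M) : Step M y (inl a * y)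

abbrev Pth (M : Subgroup (Coprod A B)) := Relation.EqvGen (Step M)

lemma Pth.mulRight {M : Subgroup (Coprod A B)} {x y : Coprod A B} (h : Pth M x y)
    {m : Coprod A B} (hm : m ∈ M) : Pth M (x * m) (y * m) := by
  induction h with
  | rel x y h =>
    refine Relation.EqvGen.rel _ _ ?_
    cases h with
    | b b => rw [mul_assoc]; exact Step.b _ b
    | a a h1 h2 =>
      rw [mul_assoc]
      refine Step.a _ a ?_ ?_
      · rwa [Subgroup.mul_mem_cancel_right _ hm]
      · rwa [← mul_assoc, Subgroup.mul_mem_cancel_right _ hm]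
  | refl x => exact Relation.EqvGen.refl _
  | symm x y _ ih => exact Relation.EqvGen.symm _ _ ih
  | trans x y z _ _ ih1 ih2 => exact Relation.EqvGen.trans _ _ _ ih1 ih2

open Classical in
/-- The twisting permutation. -/
noncomputable def sig (M : Subgroup (Coprod A B)) (c : M) : Equiv.Perm (Coprod A B) where
  toFun h := if h ∈ M then c * h else h
  invFun h := if h ∈ M then (c : Coprod A B)⁻¹ * h else h
  left_inv h := by
    by_cases hh : h ∈ M
    · simp [hh, Subgroup.mul_mem_cancel_left M c.2]
    · simp [hh]
  right_inv h := by
    by_cases hh : h ∈ M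
    · have : (c : Coprod A B)⁻¹ * h ∈ M := M.mul_mem (M.inv_mem c.2) hh
      simp [hh, this]
    · simp [hh]

variable (M : Subgroup (Coprod A B)) (c : M)

lemma sig_in {h : Coprod A B} (hh : h ∈ M) : sig M c h = c * h := by simp [sig, hh]
lemma sig_out {h : Coprod A B} (hh : h ∉ M) : sig M c h = h := by simp [sig, hh]
lemma sigi_in {h : Coprod A B} (hh : h ∈ M) : (sig M c)⁻¹ h = (c : Coprod A B)⁻¹ * h := by
  rw [Equiv.Perm.inv_eq_iff_eq, sig_in]
  · simp
  · exact M.mul_mem (M.inv_mem c.2) hh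
lemma sigi_out {h : Coprod A B} (hh : h ∉ M) : (sig M c)⁻¹ h = h := by
  rw [Equiv.Perm.inv_eq_iff_eq, sig_out _ _ hh]

/-- The twisted action. -/
noncomputable def Ph : Coprod A B →* Equiv.Perm (Coprod A B) :=
  Coprod.lift
    ((MulAut.conj (sig M c)).toMonoidHom.comp
      ((MulAction.toPermHom (Coprod A B) (Coprod A B)).comp inl))
    ((MulAction.toPermHom (Coprod A B) (Coprod A B)).comp inr)

lemma Ph_inr (b : B) (h : Coprod A B) : Ph M c (inr b) h = inr b * h := by
  simp [Ph]

lemma Ph_inl (a : A) (h : Coprod A B) :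
    Ph M c (inl a) h = sig M c (inl a * (sig M c)⁻¹ h) := by
  simp [Ph]

lemma Ph_out_out {a : A} {h : Coprod A B} (h1 : h ∉ M) (h2 : inl a * h ∉ M) :
    Ph M c (inl a) h = inl a * h := by
  rw [Ph_inl, sigi_out _ _ h1, sig_out _ _ h2]

lemma Ph_out_in {a : A} {h : Coprod A B} (h1 : h ∉ M) (h2 : inl a * h ∈ M) :
    Ph M c (inl a) h = (c : Coprod A B) * (inl a * h) := by
  rw [Ph_inl, sigi_out _ _ h1, sig_in _ _ h2]

lemma Ph_in_out {a : A} {h : Coprod A B} (h1 : h ∈ M) (h2 : inl a ∉ M) :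
    Ph M c (inl a) h = inl a * ((c : Coprod A B)⁻¹ * h) := by
  rw [Ph_inl, sigi_in _ _ h1, sig_out]
  rwa [Subgroup.mul_mem_cancel_right]
  exact M.mul_mem (M.inv_mem c.2) h1

lemma sig_mul {m : Coprod A B} (hm : m ∈ M) (h : Coprod A B) :
    sig M c (h * m) = sig M c h * m := by
  by_cases hh : h ∈ M
  · rw [sig_in _ _ hh, sig_in _ _ (M.mul_mem hh hm), mul_assoc]
  · rw [sig_out _ _ hh, sig_out]
    rwa [Subgroup.mul_mem_cancel_right _ hm]

lemma sigi_mul {m : Coprod A B} (hm : m ∈ M) (h : Coprod A B) :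
    (sig M c)⁻¹ (h * m) = (sig M c)⁻¹ h * m := by
  rw [Equiv.Perm.inv_eq_iff_eq, sig_mul _ _ hm]
  simp

/-- Induction by left multiplication by letters. -/
@[elab_as_elim]
lemma letter_induction {P : Coprod A B → Prop} (h1 : P 1)
    (hl : ∀ a g, P g → P (inl a * g)) (hr : ∀ b g, P g → P (inr b * g)) (g : Coprod A B) : P g := by
  have : ∀ g : Coprod A B, ∀ h, P h → P (g * h) := by
    intro g
    induction g using Coprod.induction_on with
    | inl a => exact hl a
    | inr b => exact hr b
    | mul x y hx hy => intro h hh; rw [mul_assoc]; exact hx _ (hy _ hh)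
  simpa using this g 1 h1

lemma Ph_mulRight (g : Coprod A B) {m : Coprod A B} (hm : m ∈ M) (h : Coprod A B) :
    Ph M c g (h * m) = Ph M c g h * m := by
  revert h
  induction g using letter_induction with
  | h1 => simp
  | hl a g ih =>
    intro h
    rw [map_mul (Ph M c), Equiv.Perm.mul_apply, ih, Equiv.Perm.mul_apply, Ph_inl, Ph_inl, sigi_mul _ _ hm,
      ← mul_assoc, sig_mul _ _ hm]
  | hr b g ih =>
    intro h
    rw [map_mul (Ph M c), Equiv.Perm.mul_apply, ih, Equiv.Perm.mul_apply, Ph_inr, Ph_inr, mul_assoc]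

/-- The crossed map. -/
noncomputable def ph (g : Coprod A B) : Coprod A B := Ph M c g 1

lemma ph_one : ph M c 1 = 1 := by simp [ph]
lemma ph_cons (x g : Coprod A B) : ph M c (x * g) = Ph M c x (ph M c g) := by simp [ph]

lemma sigi_coset (h : Coprod A B) : h⁻¹ * (sig M c)⁻¹ h ∈ M := by
  by_cases hh : h ∈ M
  · rw [sigi_in _ _ hh]
    exact M.mul_mem (M.inv_mem hh) (M.mul_mem (M.inv_mem c.2) hh)
  · rw [sigi_out _ _ hh]; simp

lemma sig_coset' (h : Coprod A B) : h⁻¹ * (sig M c) h ∈ M := by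
  by_cases hh : h ∈ M
  · rw [sig_in _ _ hh]
    exact M.mul_mem (M.inv_mem hh) (M.mul_mem c.2 hh)
  · rw [sig_out _ _ hh]; simp

lemma ph_coset (g : Coprod A B) : g⁻¹ * ph M c g ∈ M := by
  induction g using letter_induction with
  | h1 => simp [ph_one]
  | hl a g ih =>
    rw [ph_cons, Ph_inl]
    have e1 := sigi_coset M c (ph M c g)
    have e2 := sig_coset' M c (inl a * (sig M c)⁻¹ (ph M c g))
    have := M.mul_mem ih (M.mul_mem e1 e2)
    convert this using 1
    group
  | hr b g ih =>
    rw [ph_cons, Ph_inr]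
    convert ih using 1
    group

lemma ph_mem_iff (x g : Coprod A B) : x * ph M c g ∈ M ↔ x * g ∈ M := by
  have : x * ph M c g = (x * g) * (g⁻¹ * ph M c g) := by group
  rw [this, Subgroup.mul_mem_cancel_right _ (ph_coset M c g)]

lemma ph_mem_iff' (g : Coprod A B) : ph M c g ∈ M ↔ g ∈ M := by
  simpa using ph_mem_iff M c 1 g

lemma ph_mul (g : Coprod A B) {m : Coprod A B} (hm : m ∈ M) :
    ph M c (g * m) = ph M c g * ph M c m := by
  rw [ph_cons]
  have := Ph_mulRight M c g ((ph_mem_iff' M c m).2 hm) 1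
  rwa [one_mul] at this

lemma ph_inv {m : Coprod A B} (hm : m ∈ M) : ph M c m⁻¹ = (ph M c m)⁻¹ := by
  have := ph_mul M c m⁻¹ hm
  rw [inv_mul_cancel, ph_one] at this
  exact eq_inv_of_mul_eq_one_left this.symm

lemma ph_pth {x y : Coprod A B} (h : Pth M x y) :
    x⁻¹ * ph M c x = y⁻¹ * ph M c y := by
  induction h with
  | rel x y h =>
    cases h with
    | b b => rw [ph_cons, Ph_inr]; group
    | a a h1 h2 =>
      rw [ph_cons, Ph_out_out]
      · group
      · rwa [ph_mem_iff']
      · rwa [ph_mem_iff]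
  | refl x => rfl
  | symm x y _ ih => exact ih.symm
  | trans x y z _ _ ih1 ih2 => exact ih1.trans ih2

lemma ph_ph (hA : ∀ a : A, inl a ∈ M → a = 1) (d : M) (hd : (d : Coprod A B) = (c : Coprod A B)⁻¹)
    (hdc : ph M d c = c) (g : Coprod A B) : ph M d (ph M c g) = g := by
  have hdc' : ph M d (c : Coprod A B)⁻¹ = (c : Coprod A B)⁻¹ := by rw [ph_inv _ _ c.2, hdc]
  induction g using letter_induction with
  | h1 => simp [ph_one]
  | hl a g ih =>
    by_cases ha : a = 1
    · subst ha; simpa using ih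
    have haM : inl a ∉ M := fun h => ha (hA a h)
    rw [ph_cons]
    by_cases h1 : g ∈ M
    · have h1' := (ph_mem_iff' M c g).2 h1
      rw [Ph_in_out _ _ h1' haM, ph_cons, ph_mul _ _ _ h1', hdc', ih, Ph_in_out _ _ _ haM, hd]
      · group
      · exact M.mul_mem (M.inv_mem c.2) h1
    · have h1' := mt (ph_mem_iff' M c g).1 h1
      by_cases h2 : inl a * g ∈ M
      · have h2' := (ph_mem_iff M c (inl a) g).2 h2
        rw [Ph_out_in _ _ h1' h2', ph_mul _ _ _ h2', hdc, ph_cons, ih, Ph_out_in _ _ h1 h2, hd]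
        group
      · have h2' := mt (ph_mem_iff M c (inl a) g).1 h2
        rw [Ph_out_out _ _ h1' h2', ph_cons, ih, Ph_out_out _ _ h1 h2]
  | hr b g ih =>
    rw [ph_cons, Ph_inr, ph_cons, ih, Ph_inr]

/-- The automorphism of `M` induced by a twist. -/
noncomputable def phEquiv (hA : ∀ a : A, inl a ∈ M → a = 1) (hc : ∀ d : M, ph M d c = c) :
    M ≃* M where
  toFun m := ⟨ph M c m, (ph_mem_iff' M c _).2 m.2⟩
  invFun m := ⟨ph M c⁻¹ m, (ph_mem_iff' M c⁻¹ _).2 m.2⟩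
  left_inv m := Subtype.ext (ph_ph M c hA c⁻¹ rfl (hc _) m)
  right_inv m := Subtype.ext (ph_ph M c⁻¹ hA c (by simp) (by
    rw [Subgroup.coe_inv, ph_inv _ _ c.2, hc]) m)
  map_mul' x y := Subtype.ext (ph_mul M c x y.2)

theorem core (K : Subgroup (Coprod A B)) (hKM : K ≤ M)
    (hchar : ∀ φ : M ≃* M, ∀ x : M, (x : Coprod A B) ∈ K → (φ x : Coprod A B) ∈ K)
    (hA : ∀ a : A, inl a ∈ M → a = 1) (a1 : A) (ha1 : a1 ≠ 1)
    (w : Coprod A B) (hw : w ∈ K) (hp : Pth M (inl a1) w) : M ≤ K := by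
  have ha1M : inl a1 ∉ M := fun h => ha1 (hA _ h)
  -- loops avoiding the base edge lie in `K`
  have hT : ∀ t, Pth M 1 t → t ∈ M → t ∈ K := by
    intro t ht htM
    have hfix : ∀ d : M, ph M d t = t := by
      intro d
      have := ph_pth M d ht
      rw [ph_one] at this
      rw [inv_one, one_mul] at this
      exact (inv_mul_eq_one.1 this.symm).symm
    have h1 := hchar (phEquiv M ⟨t, htM⟩ hA hfix) ⟨w, hKM hw⟩ hw
    change ph M ⟨t, htM⟩ w ∈ K at h1
    have h2 := ph_pth M ⟨t, htM⟩ hp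
    have h3 : ph M ⟨t, htM⟩ (inl a1) = inl a1 * t⁻¹ := by
      have := ph_cons M ⟨t, htM⟩ (inl a1) 1
      rw [mul_one, ph_one, Ph_in_out _ _ M.one_mem ha1M] at this
      simpa using this
    rw [h3] at h2
    have h4 : ph M ⟨t, htM⟩ w = w * t⁻¹ := by
      rw [← mul_assoc, inv_mul_cancel, one_mul] at h2
      rw [h2]; group
    rw [h4, Subgroup.mul_mem_cancel_left _ hw] at h1
    exact inv_mem_iff.1 h1
  have hback : Pth M 1 (inl a1 * w⁻¹) := by
    have := hp.mulRight (M.inv_mem (hKM hw))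
    rw [mul_inv_cancel] at this
    exact this.symm
  have hall : ∀ g : Coprod A B, ∃ t k, Pth M 1 t ∧ k ∈ K ∧ g = t * k := by
    intro g
    refine letter_induction (P := fun g => ∃ t k, Pth M 1 t ∧ k ∈ K ∧ g = t * k)
      ⟨1, 1, Relation.EqvGen.refl _, K.one_mem, by simp⟩ ?_ ?_ g
    · rintro a g ⟨t, k, ht, hk, rfl⟩
      by_cases ha : a = 1
      · subst ha; exact ⟨t, k, ht, hk, by simp⟩
      have haM : inl a ∉ M := fun h => ha (hA _ h)
      by_cases h1 : t ∈ M
      · have htK := hT t ht h1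
        refine ⟨inl a * w⁻¹, w * t * k, ?_, K.mul_mem (K.mul_mem hw htK) hk, by group⟩
        refine hback.trans _ _ _ (Relation.EqvGen.rel _ _ ?_)
        have e : (inl a : Coprod A B) * w⁻¹ = inl (a * a1⁻¹) * (inl a1 * w⁻¹) := by
          simp [mul_assoc]
        have hwi := M.inv_mem (hKM hw)
        have e2 : inl a * w⁻¹ ∉ M := by rwa [Subgroup.mul_mem_cancel_right _ hwi]
        rw [e] at e2 ⊢
        refine Step.a _ _ ?_ e2
        rwa [Subgroup.mul_mem_cancel_right _ hwi]
      · by_cases h2 : inl a * t ∈ M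
        · have h3 : Pth M 1 (inl a1 * (inl a * t)) := by
            refine ht.trans _ _ _ (Relation.EqvGen.rel _ _ ?_)
            have e : (inl a1 : Coprod A B) * (inl a * t) = inl (a1 * a) * t := by
              simp [mul_assoc]
            have e2 : inl a1 * (inl a * t) ∉ M := by rwa [Subgroup.mul_mem_cancel_right _ h2]
            rw [e] at e2 ⊢
            exact Step.a _ _ h1 e2
          have h4 := h3.trans _ _ _ (hp.mulRight h2)
          have h5 := hT _ h4 (M.mul_mem (hKM hw) h2)
          rw [Subgroup.mul_mem_cancel_left _ hw] at h5
          exact ⟨1, inl a * t * k, Relation.EqvGen.refl _, K.mul_mem h5 hk, by group⟩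
        · exact ⟨inl a * t, k, ht.trans _ _ _ (Relation.EqvGen.rel _ _ (Step.a _ _ h1 h2)), hk,
            by group⟩
    · rintro b g ⟨t, k, ht, hk, rfl⟩
      exact ⟨inr b * t, k, ht.trans _ _ _ (Relation.EqvGen.rel _ _ (Step.b _ _)), hk, by group⟩
  intro m hm
  obtain ⟨t, k, ht, hk, rfl⟩ := hall m
  rw [Subgroup.mul_mem_cancel_right _ (hKM hk)] at hm
  exact K.mul_mem (hT t ht hm) hk

end Core

section Words
variable {A : Type u} {B : Type v} [Group A] [Group B]

/-- A letter as an element of the free product. -/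
def ltr : A ⊕ B → Coprod A B := Sum.elim inl inr

/-- The element spelled by a list of letters. -/
def Wd (l : List (A ⊕ B)) : Coprod A B := (l.map ltr).prod

@[simp] lemma Wd_nil : Wd ([] : List (A ⊕ B)) = 1 := rfl
@[simp] lemma Wd_cons (x : A ⊕ B) (l) : Wd (x :: l) = ltr x * Wd l := by simp [Wd]
@[simp] lemma Wd_append (l l' : List (A ⊕ B)) : Wd (l ++ l') = Wd l * Wd l' := by simp [Wd]
@[simp] lemma ltr_inl (a : A) : ltr (Sum.inl a : A ⊕ B) = inl a := rfl
@[simp] lemma ltr_inr (b : B) : ltr (Sum.inr b : A ⊕ B) = inr b := rfl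

lemma exists_Wd (g : Coprod A B) : ∃ l, Wd l = g := by
  refine letter_induction (P := fun g => ∃ l, Wd l = g) ⟨[], rfl⟩ ?_ ?_ g
  · rintro a g ⟨l, rfl⟩; exact ⟨Sum.inl a :: l, by simp⟩
  · rintro a g ⟨l, rfl⟩; exact ⟨Sum.inr a :: l, by simp⟩

def linv : A ⊕ B → A ⊕ B := Sum.map (·⁻¹) (·⁻¹)

lemma Wd_inv (l : List (A ⊕ B)) : Wd (l.map linv).reverse = (Wd l)⁻¹ := by
  induction l with
  | nil => simp
  | cons x l ih => 
    simp only [List.map_cons, List.reverse_cons, Wd_append, ih, Wd_cons, Wd_nil, mul_one,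
      mul_inv_rev]
    cases x <;> simp [linv]

/-- `l` spells a nontrivial element of `M` of minimal length. -/
def IsMin (M : Subgroup (Coprod A B)) (l : List (A ⊕ B)) : Prop :=
  Wd l ∈ M ∧ Wd l ≠ 1 ∧ ∀ l', Wd l' ∈ M → Wd l' ≠ 1 → l.length ≤ l'.length

lemma IsMin.suffix {M : Subgroup (Coprod A B)} {p s : List (A ⊕ B)} (h : IsMin M (p ++ s))
    (hp : p ≠ []) (hs : s ≠ []) : Wd s ∉ M := by
  intro hM
  have hp' := List.length_pos_iff.2 hp
  have hs' := List.length_pos_iff.2 hs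
  obtain ⟨h1, h2, h3⟩ := h
  by_cases h : Wd s = 1
  · have e : Wd (p ++ s) = Wd p := by simp [h]
    rw [e] at h1 h2
    have := h3 p h1 h2
    rw [List.length_append] at this; omega
  · have := h3 s hM h
    rw [List.length_append] at this; omega

lemma IsMin.pth {M : Subgroup (Coprod A B)} {b : B} {mid : List (A ⊕ B)} {a : A}
    (h : IsMin M (Sum.inr b :: mid ++ [Sum.inl a])) :
    Pth M (inl a) (Wd (Sum.inr b :: mid ++ [Sum.inl a])) := by
  have key : ∀ v2 v1, Sum.inr b :: mid = v1 ++ v2 → Pth M (inl a) (Wd (v2 ++ [Sum.inl a])) := by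
    intro v2
    induction v2 with
    | nil => intro v1 _; simpa using Relation.EqvGen.refl _
    | cons x v2 ih =>
      intro v1 hv
      have ih' := ih (v1 ++ [x]) (by simp [hv])
      refine ih'.trans _ _ _ (Relation.EqvGen.rel _ _ ?_)
      rw [List.cons_append, Wd_cons]
      cases x with
      | inr b => exact Step.b _ _
      | inl x =>
        have hv1 : v1 ≠ [] := by
          rintro rfl
          simp at hv
        rw [hv] at h
        refine Step.a _ _ ?_ ?_
        · refine IsMin.suffix (p := v1 ++ [Sum.inl x]) ?_ (by simp) (by simp)
          simpa using h
        · have := IsMin.suffix (p := v1) (s := Sum.inl x :: (v2 ++ [Sum.inl a]))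
            (by simpa using h) hv1 (by simp)
          simpa using this
  exact key _ [] rfl

lemma IsMin.ends {M : Subgroup (Coprod A B)} [M.Normal] {l : List (A ⊕ B)} (h : IsMin M l)
    (hA : ∀ a : A, inl a ∈ M → a = 1) (hB : ∀ b : B, inr b ∈ M → b = 1) :
    (∃ b mid a, l = Sum.inr b :: mid ++ [Sum.inl a]) ∨
    (∃ b mid a, l = Sum.inl a :: mid ++ [Sum.inr b]) := by
  have hconj : ∀ (x y z : A ⊕ B) mid, ltr z = ltr y * ltr x → ¬ IsMin M (x :: mid ++ [y]) := by
    rintro x y z mid hz ⟨h1, h2, h3⟩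
    have e : Wd (mid ++ [z]) = (ltr x)⁻¹ * Wd (x :: mid ++ [y]) * (ltr x)⁻¹⁻¹ := by
      simp [hz, mul_assoc]
    have e1 : Wd (mid ++ [z]) ∈ M := by
      rw [e]; exact Subgroup.Normal.conj_mem ‹_› _ h1 _
    have := h3 _ e1 (by rw [e]; exact fun hh => h2 (conj_eq_one_iff.1 hh))
    simp at this
  rcases l with _ | ⟨x, l⟩
  · exact absurd rfl h.2.1
  rcases List.eq_nil_or_concat l with rfl | ⟨mid, y, rfl⟩
  · exfalso
    obtain ⟨h1, h2, -⟩ := h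
    rcases x with x | x
    · simp at h1 h2; simp [hA x h1] at h2
    · simp at h1 h2; simp [hB x h1] at h2
  · rcases x with x | x <;> rcases y with y | y
    · exact absurd (by simpa using h) (hconj (Sum.inl x) (Sum.inl y) (Sum.inl (y * x)) mid (by simp))
    · right; exact ⟨y, mid, x, by simp⟩
    · left; exact ⟨x, mid, y, by simp⟩
    · exact absurd (by simpa using h) (hconj (Sum.inr x) (Sum.inr y) (Sum.inr (y * x)) mid (by simp))

theorem levi_step (M K : Subgroup (Coprod A B)) [M.Normal] (hKM : K ≤ M)
    (hchar : ∀ φ : M ≃* M, ∀ x : M, (x : Coprod A B) ∈ K → (φ x : Coprod A B) ∈ K)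
    (hA : ∀ a : A, inl a ∈ M → a = 1) (hB : ∀ b : B, inr b ∈ M → b = 1)
    (l : List (A ⊕ B)) (hl : IsMin M l) (hK : Wd l ∈ K) : M ≤ K := by
  have main : ∀ b mid a, IsMin M (Sum.inr b :: mid ++ [Sum.inl a]) →
      Wd (Sum.inr b :: mid ++ [Sum.inl a]) ∈ K → M ≤ K := by
    intro b mid a h hk
    refine core M K hKM hchar hA a ?_ _ hk h.pth
    rintro rfl
    have := h.suffix (by simp) (by simp)
    simp at this
  rcases hl.ends hA hB with ⟨b, mid, a, rfl⟩ | ⟨b, mid, a, rfl⟩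
  · exact main _ _ _ hl hK
  · have e : (List.map linv (Sum.inl a :: mid ++ [Sum.inr b])).reverse
        = Sum.inr b⁻¹ :: (mid.map linv).reverse ++ [Sum.inl a⁻¹] := by
      simp [linv]
    refine main b⁻¹ (mid.map linv).reverse a⁻¹ ?_ ?_
    · rw [← e]
      refine ⟨?_, ?_, ?_⟩
      · rw [Wd_inv]; exact M.inv_mem hl.1
      · rw [Wd_inv]; simpa only [ne_eq, inv_eq_one] using hl.2.1
      · intro l' h1 h2
        have := hl.2.2 l' h1 h2
        rwa [List.length_reverse, List.length_map]
    · rw [← e, Wd_inv]; exact K.inv_mem hK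

lemma exists_isMin {M : Subgroup (Coprod A B)} {l : List (A ⊕ B)} (h1 : Wd l ∈ M)
    (h2 : Wd l ≠ 1) : ∃ l', IsMin M l' ∧ l'.length ≤ l.length := by
  classical
  have hex : ∃ n, ∃ l' : List (A ⊕ B), Wd l' ∈ M ∧ Wd l' ≠ 1 ∧ l'.length = n :=
    ⟨_, l, h1, h2, rfl⟩
  obtain ⟨l', e1, e2, e3⟩ := Nat.find_spec hex
  have hmin : ∀ l'', Wd l'' ∈ M → Wd l'' ≠ 1 → l'.length ≤ l''.length := by
    intro l'' f1 f2
    rw [e3]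
    exact Nat.find_min' hex ⟨l'', f1, f2, rfl⟩
  exact ⟨l', ⟨e1, e2, hmin⟩, hmin l h1 h2⟩

theorem levi (M : ℕ → Subgroup (Coprod A B)) (hn : ∀ k, (M k).Normal)
    (hlt : ∀ k, M (k + 1) < M k)
    (hchar : ∀ k, ∀ φ : M k ≃* M k, ∀ x : M k, (x : Coprod A B) ∈ M (k + 1) →
      (φ x : Coprod A B) ∈ M (k + 1))
    (hA : ∀ k, ∀ a : A, inl a ∈ M k → a = 1) (hB : ∀ k, ∀ b : B, inr b ∈ M k → b = 1) (k : ℕ) :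
    ∀ l : List (A ⊕ B), Wd l ∈ M k → Wd l ≠ 1 → k ≤ l.length := by
  induction k with
  | zero => intros; omega
  | succ k ih =>
    intro l h1 h2
    by_contra hlen
    have hk : l.length ≤ k := by omega
    have := hn k
    refine (hlt k).not_ge (levi_step (M k) (M (k + 1)) (hlt k).le (hchar k) (hA k) (hB k) l
      ⟨(hlt k).le h1, h2, ?_⟩ h1)
    intro l' f1 f2
    exact hk.trans (ih l' f1 f2)

/-! Normal forms. -/

/-- Both factors as one family. -/
def Fam (A : Type u) (B : Type v) : Bool → Type (max u v)
  | true => ULift.{v} A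
  | false => ULift.{u} B

instance (i : Bool) : Group (Fam A B i) :=
  match i with
  | true => inferInstanceAs (Group (ULift.{v} A))
  | false => inferInstanceAs (Group (ULift.{u} B))

def Nontriv : A ⊕ B → Prop := Sum.elim (· ≠ 1) (· ≠ 1)

def Red (l : List (A ⊕ B)) : Prop :=
  (∀ x ∈ l, Nontriv x) ∧ l.IsChain (fun x y => x.isLeft ≠ y.isLeft)

def toFam : A ⊕ B → Σ i, Fam A B i :=
  Sum.elim (fun a => ⟨true, (ULift.up a : ULift.{v} A)⟩)
    (fun b => ⟨false, (ULift.up b : ULift.{u} B)⟩)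

def incA : A →* Fam A B true := (MulEquiv.ulift (α := A)).symm.toMonoidHom
def incB : B →* Fam A B false := (MulEquiv.ulift (α := B)).symm.toMonoidHom

noncomputable def toI : Coprod A B →* Monoid.CoprodI (Fam A B) :=
  Coprod.lift (CoprodI.of.comp incA) (CoprodI.of.comp incB)

lemma Red.ne_one {l : List (A ⊕ B)} (h : Red l) (hl : l ≠ []) : Wd l ≠ 1 := by
  intro h1
  let W : CoprodI.Word (Fam A B) :=
    { toList := l.map toFam
      ne_one := by
        intro x hx
        obtain ⟨y, hy, rfl⟩ := List.mem_map.1 hx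
        have := h.1 y hy
        rcases y with y | y
        · intro hh; exact this (congrArg ULift.down (show (ULift.up y : ULift.{v} A) = 1 from hh))
        · intro hh; exact this (congrArg ULift.down (show (ULift.up y : ULift.{u} B) = 1 from hh))
      chain_ne := by
        rw [List.isChain_map]
        refine h.2.imp ?_
        rintro (x | x) (y | y) hxy <;> simp [toFam] at hxy ⊢ }
  have e : toI (Wd l) = W.prod := by
    rw [Wd, map_list_prod, CoprodI.Word.prod, List.map_map, List.map_map]
    congr 1
    refine List.map_congr_left ?_
    rintro (x | x) _
    · simp only [Function.comp, ltr_inl, toI, lift_apply_inl]; rfl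
    · simp only [Function.comp, ltr_inr, toI, lift_apply_inr]; rfl
  classical
  rw [h1, map_one] at e
  have : W = CoprodI.Word.empty := by
    have := CoprodI.Word.equiv (M := Fam A B)
    have hinj : Function.Injective (CoprodI.Word.prod (M := Fam A B)) :=
      (CoprodI.Word.equiv (M := Fam A B)).symm.injective
    apply hinj
    rw [← e, CoprodI.Word.prod_empty]
  have := congrArg CoprodI.Word.toList this
  exact hl (by simpa [W, CoprodI.Word.empty] using this)

lemma exists_red (l : List (A ⊕ B)) : ∃ l', Red l' ∧ Wd l' = Wd l := by
  induction l with
  | nil => exact ⟨[], ⟨by simp, by simp⟩, rfl⟩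
  | cons x l ih =>
    obtain ⟨l', ⟨h1, h2⟩, h3⟩ := ih
    by_cases hx : Nontriv x
    swap
    · refine ⟨l', ⟨h1, h2⟩, ?_⟩
      rcases x with x | x <;> simp [Nontriv] at hx <;> simp [hx, h3]
    rcases l' with _ | ⟨y, l''⟩
    · exact ⟨[x], ⟨by simpa using hx, by simp⟩, by simp [← h3]⟩
    by_cases hxy : x.isLeft ≠ y.isLeft
    · refine ⟨x :: y :: l'', ⟨?_, ?_⟩, by simp [← h3]⟩
      · intro z hz
        rcases List.mem_cons.1 hz with rfl | hz
        · exact hx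
        · exact h1 z hz
      · exact List.isChain_cons_cons.2 ⟨hxy, h2⟩
    have merge : ∃ z : A ⊕ B, z.isLeft = y.isLeft ∧ ltr z = ltr x * ltr y ∧
        (¬ Nontriv z → ltr z = 1) := by
      rcases x with x | x <;> rcases y with y | y <;> simp at hxy
      · exact ⟨Sum.inl (x * y), rfl, by simp, by
          intro h; simp only [Nontriv, Sum.elim_inl, not_not] at h; rw [h]; simp⟩
      · exact ⟨Sum.inr (x * y), rfl, by simp, by
          intro h; simp only [Nontriv, Sum.elim_inr, not_not] at h; rw [h]; simp⟩
    obtain ⟨z, hz1, hz2, hz3⟩ := merge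
    by_cases hz : Nontriv z
    · refine ⟨z :: l'', ⟨?_, ?_⟩, by simp [← h3, hz2, mul_assoc]⟩
      · intro t ht
        rcases List.mem_cons.1 ht with rfl | ht
        · exact hz
        · exact h1 t (by simp [ht])
      · rcases l'' with _ | ⟨t, l''⟩
        · simp
        · rw [List.isChain_cons_cons] at h2 ⊢
          rw [hz1]; exact h2
    · refine ⟨l'', ⟨fun t ht => h1 t (by simp [ht]), h2.tail⟩, ?_⟩
      rw [Wd_cons, ← h3, Wd_cons, ← mul_assoc, ← hz2, hz3 hz, one_mul]

end Words

end S11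

/-- Construction of faithful sequences of finite quotients of a free
product from characteristic chains inside the commutator subgroups of the finite free
products `Ā_n ∗ B̄_n`. -/
theorem statement11 {A B : Type*} [Group A] [Group B]
    (Abar Bbar : ℕ → Type*) [∀ n, Group (Abar n)] [∀ n, Group (Bbar n)]
    [∀ n, Finite (Abar n)] [∀ n, Finite (Bbar n)]
    (α : ∀ n, A →* Abar n) (β : ∀ n, B →* Bbar n)
    (hαsurj : ∀ n, Function.Surjective (α n)) (hβsurj : ∀ n, Function.Surjective (β n))
    (hαfaith : ∀ a : A, a ≠ 1 → ∃ N, ∀ n ≥ N, α n a ≠ 1)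
    (hβfaith : ∀ b : B, b ≠ 1 → ∃ N, ∀ n ≥ N, β n b ≠ 1)
    (M : ∀ n : ℕ, ℕ → Subgroup (coprodKer (Abar n) (Bbar n)))
    (hMfi : ∀ n k, (M n k).FiniteIndex)
    (hMchar : ∀ n k, (M n k).Characteristic)
    (hMint : ∀ n, (⨅ k, M n k) = ⊥)
    (hMproper : ∀ n k, M n (k + 1) < M n k)
    (hMcharIn : ∀ n k, ((M n (k + 1)).subgroupOf (M n k)).Characteristic) :
    (∀ n k, ((M n k).map (coprodKer (Abar n) (Bbar n)).subtype).Normal) ∧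
    (∀ n k, ((M n k).map (coprodKer (Abar n) (Bbar n)).subtype).FiniteIndex) ∧
    (∀ n k, Finite
      (Monoid.Coprod (Abar n) (Bbar n) ⧸ (M n k).map (coprodKer (Abar n) (Bbar n)).subtype)) ∧
    (∀ g : Monoid.Coprod A B, g ≠ 1 → ∃ N, ∀ n ≥ N, ∀ k ≥ n,
      Monoid.Coprod.map (α n) (β n) g ∉
        (M n k).map (coprodKer (Abar n) (Bbar n)).subtype) := by
  have hnorm : ∀ n k, ((M n k).map (coprodKer (Abar n) (Bbar n)).subtype).Normal := by
    intro n k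
    have := hMchar n k
    have : (coprodKer (Abar n) (Bbar n)).Normal := by unfold coprodKer; infer_instance
    infer_instance
  have hfi : ∀ n k, ((M n k).map (coprodKer (Abar n) (Bbar n)).subtype).FiniteIndex := by
    intro n k
    have := hMfi n k
    have : (coprodKer (Abar n) (Bbar n)).FiniteIndex := by unfold coprodKer; infer_instance
    refine ⟨?_⟩
    rw [Subgroup.index_map_subtype]
    exact mul_ne_zero (hMfi n k).index_ne_zero this.index_ne_zero
  refine ⟨hnorm, hfi, fun n k => ?_, ?_⟩
  · have := hfi n k
    infer_instance
  intro g hg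
  obtain ⟨l0, rfl⟩ := S11.exists_Wd g
  obtain ⟨l, hl, hl0⟩ := S11.exists_red l0
  rw [← hl0] at hg ⊢
  have hne : l ≠ [] := by rintro rfl; exact hg rfl
  have hmap : ∀ n, Monoid.Coprod.map (α n) (β n) (S11.Wd l)
      = S11.Wd (l.map (Sum.map (α n) (β n))) := by
    intro n
    rw [S11.Wd, S11.Wd, map_list_prod, List.map_map, List.map_map]
    congr 1
    refine List.map_congr_left ?_
    rintro (x | x) _ <;> simp
  have hN : ∀ l : List (A ⊕ B), (∀ x ∈ l, S11.Nontriv x) →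
      ∃ N, ∀ n ≥ N, ∀ x ∈ l, S11.Nontriv (Sum.map (α n) (β n) x) := by
    intro l
    induction l with
    | nil => intro _; exact ⟨0, by simp⟩
    | cons x l ih =>
      intro h
      obtain ⟨N1, h1⟩ := ih (fun x hx => h x (by simp [hx]))
      have hx := h x (by simp)
      have : ∃ N, ∀ n ≥ N, S11.Nontriv (Sum.map (α n) (β n) x) := by
        rcases x with x | x
        · exact hαfaith x hx
        · exact hβfaith x hx
      obtain ⟨N2, h2⟩ := this
      refine ⟨max N1 N2, fun n hn y hy => ?_⟩
      rcases List.mem_cons.1 hy with rfl | hy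
      · exact h2 n (le_of_max_le_right hn)
      · exact h1 n (le_of_max_le_left hn) y hy
  obtain ⟨N, hN⟩ := hN l hl.1
  refine ⟨max N (l.length + 1), fun n hn k hk hmem => ?_⟩
  rw [hmap] at hmem
  have hred : S11.Red (l.map (Sum.map (α n) (β n))) := by
    refine ⟨?_, ?_⟩
    · intro x hx
      obtain ⟨y, hy, rfl⟩ := List.mem_map.1 hx
      exact hN n (le_of_max_le_left hn) y hy
    · rw [List.isChain_map]
      refine hl.2.imp ?_
      intro x y hxy
      simpa using hxy
  have h1 := hred.ne_one (by simpa using hne)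
  have hsub : ∀ k, (M n k).map (coprodKer (Abar n) (Bbar n)).subtype ≤ coprodKer (Abar n) (Bbar n) :=
    fun k => Subgroup.map_subtype_le _
  have hlen := S11.levi (fun k => (M n k).map (coprodKer (Abar n) (Bbar n)).subtype) (hnorm n)
    ?_ ?_ ?_ ?_ k _ hmem h1
  · rw [List.length_map] at hlen
    have := le_of_max_le_right hn
    omega
  · intro k
    exact (Subgroup.map_lt_map_iff_of_injective (Subgroup.subtype_injective _)).2 (hMproper n k)
  · intro k φ x hx
    let e := (M n k).equivMapOfInjective (coprodKer (Abar n) (Bbar n)).subtype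
      (Subgroup.subtype_injective _)
    let ψ : M n k ≃* M n k := (e.trans φ).trans e.symm
    obtain ⟨y, rfl⟩ := e.surjective x
    have hy : y ∈ (M n (k + 1)).subgroupOf (M n k) := by
      obtain ⟨z, hz, hz2⟩ := hx
      have : z = (y : coprodKer (Abar n) (Bbar n)) := Subgroup.subtype_injective _ hz2
      rw [Subgroup.mem_subgroupOf, ← this]; exact hz
    have hfix := (hMcharIn n k).fixed ψ
    rw [← hfix, Subgroup.mem_comap, Subgroup.mem_subgroupOf] at hy
    refine ⟨_, hy, ?_⟩
    change ((e (ψ y) : _) : Monoid.Coprod (Abar n) (Bbar n)) = _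
    simp [ψ]
  · intro k a ha
    have := hsub k ha
    simpa [coprodKer, MonoidHom.mem_ker] using this
  · intro k a ha
    have := hsub k ha
    simpa [coprodKer, MonoidHom.mem_ker] using this
end
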